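/- If two plane algebraic curves C₁, C₂ in ℂ² of degrees d₁, d₂ intersect in exactly d₁·d₂ distinct points, then the fundamental group of the complement of C₁ ∪ C₂ in ℂ² is isomorphic to the direct product of the fundamental groups of the complements of C₁ and of C₂. -/

import Mathlib

/-- The zero set in `ℂ²` of a bivariate polynomial. -/
def zeroSet (f : MvPolynomial (Fin 2) ℂ) : Set (ℂ × ℂ) :=
  {p : ℂ × ℂ | MvPolynomial.eval (fun i : Fin 2 => if i = 0 then p.1 else p.2) f = 0}


open Set Topology

set_option linter.all false

namespace OS

universe u v

/-! ### Path induction -/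

theorem path_induction {X : Type*} [TopologicalSpace X] {ι : Type*} (U : ι → Set X)
    (hU : ∀ i, IsOpen (U i)) (hc : ∀ x, ∃ i, x ∈ U i) (a : X)
    (P : ∀ x, Path.Homotopic.Quotient a x → Prop)
    (h0 : P a (Path.Homotopic.Quotient.refl a))
    (hs : ∀ x y (γ : Path.Homotopic.Quotient a x) (δ : Path x y) (i : ι), (∀ t, δ t ∈ U i) →
      P x γ → P y (γ.trans (Path.Homotopic.Quotient.mk δ))) :
    ∀ y (γ : Path.Homotopic.Quotient a y), P y γ := by
  intro y γ
  induction γ using Path.Homotopic.Quotient.ind with | _ γ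
  obtain ⟨t, t0, tm, ⟨n, hn⟩, ht⟩ := exists_monotone_Icc_subset_open_cover_unitInterval
    (c := fun i => γ ⁻¹' (U i)) (fun i => (hU i).preimage γ.continuous) (by
      intro s _
      obtain ⟨i, hi⟩ := hc (γ s)
      exact mem_iUnion.2 ⟨i, hi⟩)
  have key : ∀ k, P (γ (t k)) (Path.Homotopic.Quotient.mk
      ((γ.subpath 0 (t k)).cast γ.source.symm rfl)) := by
    intro k
    induction k with
    | zero =>
      have : ∀ s : unitInterval, s = 0 → P (γ s) (Path.Homotopic.Quotient.mk
        ((γ.subpath 0 s).cast γ.source.symm rfl)) := by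
        rintro s rfl
        have h2 : ∀ (b : X) (p : Path a b) (hb : b = a), (∀ r, p r = a) →
            P b (Path.Homotopic.Quotient.mk p) := by
          rintro b p rfl hp
          have : p = Path.refl b := by ext r; simp [hp]
          rw [this]; exact h0
        apply h2 _ _ γ.source
        intro r
        simp
      exact this _ t0
    | succ k ih =>
      obtain ⟨i, hi⟩ := ht k
      have h1 := hs _ _ _ (γ.subpath (t k) (t (k+1))) i (by
        intro r
        have : γ.subpath (t k) (t (k+1)) r ∈ range (γ.subpath (t k) (t (k+1))) := ⟨r, rfl⟩
        rw [Path.range_subpath_of_le _ _ _ (tm (Nat.le_succ k))] at this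
        obtain ⟨q, hq, hq'⟩ := this
        rw [← hq']
        exact hi hq) ih
      convert h1 using 1
      rw [← Path.Homotopic.Quotient.mk_trans]
      symm
      apply Path.Homotopic.Quotient.eq.2
      have hcast : ∀ (a a' b c : X) (h : a = a') (p : Path a' b) (q : Path b c) (r : Path a' c),
          (p.trans q).Homotopic r → ((p.cast h rfl).trans q).Homotopic (r.cast h rfl) := by
        rintro a _ b c rfl p q r h
        exact h
      exact hcast _ _ _ _ _ _ _ _ ⟨Path.Homotopy.subpathTransSubpath γ 0 (t k) (t (k+1))⟩
  have := key n
  have h3 : ∀ s : unitInterval, s = 1 → P (γ s) (Path.Homotopic.Quotient.mk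
        ((γ.subpath 0 s).cast γ.source.symm rfl)) → P y (Path.Homotopic.Quotient.mk γ) := by
    rintro s rfl h
    have h2 : ∀ (b : X) (p : Path a b) (hb : b = y), (∀ r, p r = γ r) →
        P b (Path.Homotopic.Quotient.mk p) → P y (Path.Homotopic.Quotient.mk γ) := by
      rintro b p rfl hp h
      have : p = γ := by ext r; simp [hp]
      rwa [this] at h
    exact h2 _ _ γ.target (fun r => by simp) h
  exact h3 _ (hn n le_rfl) this


/-! ### Transport along paths of a locally constant family -/

/-- Total space of a family of sets. -/
structure TrSp {Y : Type u} (F : Y → Type v) where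
  pt : Y
  val : F pt

section transport

variable {Y : Type u} [TopologicalSpace Y] {F : Y → Type v} {ι : Type*}

/-- The topology on the total space. -/
@[reducible] def trTop (U : ι → Set Y) (T : ∀ (_ : ι) (x y : Y), F x → F y) :
    TopologicalSpace (TrSp F) where
  IsOpen O := ∀ i, ∀ x ∈ U i, ∀ f : F x, (⟨x, f⟩ : TrSp F) ∈ O →
    ∀ᶠ y in 𝓝 x, (⟨y, T i x y f⟩ : TrSp F) ∈ O
  isOpen_univ := by simp
  isOpen_inter := by
    intro s t hs ht i x hx f hf
    exact (hs i x hx f hf.1).and (ht i x hx f hf.2)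
  isOpen_sUnion := by
    rintro S hS i x hx f ⟨O, hO, hf⟩
    filter_upwards [hS O hO i x hx f hf] with y hy
    exact ⟨O, hO, hy⟩

theorem exists_transport (U : ι → Set Y) (T : ∀ (_ : ι) (x y : Y), F x → F y)
    (hU : ∀ i, IsOpen (U i)) (hc : ∀ x, ∃ i, x ∈ U i)
    (hid : ∀ i x, x ∈ U i → ∀ f, T i x x f = f)
    (hco : ∀ i x y z, x ∈ U i → y ∈ U i → z ∈ U i → ∀ f, T i y z (T i x y f) = T i x z f)
    (hag : ∀ i j x y, x ∈ U i → y ∈ U i → x ∈ U j → y ∈ U j → ∀ f, T i x y f = T j x y f) :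
    ∃ Tr : ∀ x y : Y, Path.Homotopic.Quotient x y → F x → F y,
      (∀ x f, Tr x x (Path.Homotopic.Quotient.refl x) f = f) ∧
      (∀ x y z γ δ f, Tr x z (Path.Homotopic.Quotient.trans γ δ) f = Tr y z δ (Tr x y γ f)) ∧
      ∀ i x y (γ : Path x y), (∀ t, γ t ∈ U i) → ∀ f,
        Tr x y (Path.Homotopic.Quotient.mk γ) f = T i x y f := by
  let _ : TopologicalSpace (TrSp F) := trTop U T
  have hopen : ∀ O : Set (TrSp F), IsOpen O ↔ ∀ i, ∀ x ∈ U i, ∀ f : F x, (⟨x, f⟩ : TrSp F) ∈ O →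
    ∀ᶠ y in 𝓝 x, (⟨y, T i x y f⟩ : TrSp F) ∈ O := fun O => Iff.rfl
  have hp : Continuous (TrSp.pt : TrSp F → Y) := by
    rw [continuous_def]
    intro W hW
    rw [hopen]
    intro i x hx f hf
    exact hW.mem_nhds hf
  have hsl : ∀ i x, x ∈ U i → ∀ f : F x,
      Continuous (fun y : U i => (⟨y.1, T i x y.1 f⟩ : TrSp F)) := by
    intro i x hx f
    rw [continuous_def]
    intro O hO
    rw [isOpen_iff_mem_nhds]
    rintro ⟨y0, hy0⟩ h0
    rw [mem_nhds_subtype_iff_nhdsWithin]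
    have h1 := (hopen O).1 hO i y0 hy0 _ h0
    apply mem_nhdsWithin_of_mem_nhds
    filter_upwards [h1, (hU i).mem_nhds hy0] with y hy hyU
    refine ⟨⟨y, hyU⟩, ?_, rfl⟩
    rw [hco i x y0 y hx hy0 hyU] at hy
    exact hy
  have cov : IsCoveringMap (TrSp.pt : TrSp F → Y) := by
    intro x
    obtain ⟨i, hi⟩ := hc x
    let _ : TopologicalSpace (F x) := ⊥
    have : DiscreteTopology (F x) := ⟨rfl⟩
    apply IsEvenlyCovered.to_isEvenlyCovered_preimage (I := F x)
    refine ⟨inferInstance, U i, hi, hU i, (hU i).preimage hp, ?_⟩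
    refine ⟨⟨⟨fun e => (⟨e.1.pt, e.2⟩, T i e.1.pt x e.1.val),
      fun q => ⟨⟨q.1.1, T i x q.1.1 q.2⟩, q.1.2⟩, ?_, ?_⟩, ?_, ?_⟩, ?_⟩
    · rintro ⟨⟨y, f⟩, hy⟩
      have hy' : y ∈ U i := hy
      simp [hco i y x y hy' hi hy', hid i y hy']
    · rintro ⟨⟨y, hy⟩, f⟩
      simp [hco i x y x hi hy hi, hid i x hi]
    · refine Continuous.prodMk (by fun_prop) ?_
      refine continuous_discrete_rng.2 ?_
      intro f
      have : IsOpen {e : TrSp F | e.pt ∈ U i ∧ T i e.pt x e.val = f} := by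
        rw [hopen]
        rintro j y0 hj v ⟨hyi, hv⟩
        filter_upwards [(hU i).mem_nhds hyi, (hU j).mem_nhds hj] with y h1 h2
        refine ⟨h1, ?_⟩
        change T i y x (T j y0 y v) = f
        rw [hag j i y0 y hj h2 hyi h1, hco i y0 y x hyi h1 hi]
        exact hv
      convert this.preimage continuous_subtype_val using 1
      ext ⟨e, he⟩
      simpa using fun _ => he
    · refine Continuous.subtype_mk ?_ _
      rw [continuous_def]
      intro O hO
      rw [isOpen_prod_iff]
      rintro y f hy
      refine ⟨_, {f}, (hO.preimage (hsl i x hi f)), isOpen_discrete _, hy, rfl, ?_⟩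
      rintro ⟨y', f'⟩ ⟨h1, h2⟩
      obtain rfl : f' = f := h2
      exact h1
    · intro e; rfl
  have hval : ∀ {x : Y} (e : (TrSp.pt : TrSp F → Y) ⁻¹' {x}), ∃ f : F x, e.1 = ⟨x, f⟩ := by
    rintro x ⟨⟨y, f⟩, h⟩
    obtain rfl : y = x := h
    exact ⟨f, rfl⟩
  choose V hV using @hval
  have hV' : ∀ (x : Y) (f : F x), V (⟨⟨x, f⟩, rfl⟩ : (TrSp.pt : TrSp F → Y) ⁻¹' {x}) = f := by
    intro x f
    have := hV (⟨⟨x, f⟩, rfl⟩ : (TrSp.pt : TrSp F → Y) ⁻¹' {x})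
    simp only [TrSp.mk.injEq, heq_eq_eq, true_and] at this
    exact this.symm
  refine ⟨fun x y γ f => V (cov.monodromy γ ⟨⟨x, f⟩, rfl⟩), ?_, ?_, ?_⟩
  · intro x f
    have h := congrFun (cov.monodromy_refl (x := x)) ⟨⟨x, f⟩, rfl⟩
    exact (congrArg V h).trans (hV' x f)
  · intro x y z γ δ f
    have h := cov.monodromy_trans_apply γ δ ⟨⟨x, f⟩, rfl⟩
    refine (congrArg V h).trans (congrArg V (congrArg (cov.monodromy δ) ?_))
    exact Subtype.ext (hV _)
  · intro i x y γ hγ f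
    have hx : x ∈ U i := by simpa using hγ 0
    have hy : y ∈ U i := by simpa using hγ 1
    let Γ : Path (⟨x, f⟩ : TrSp F) ⟨y, T i x y f⟩ :=
      { toFun := fun t => ⟨γ t, T i x (γ t) f⟩
        continuous_toFun := (hsl i x hx f).comp (γ.continuous.subtype_mk hγ)
        source' := by
          rw [γ.source, hid i x hx]
        target' := by
          rw [γ.target] }
    have := cov.monodromy_map (Path.Homotopic.Quotient.mk Γ)
    have h2 : (Path.Homotopic.Quotient.mk Γ).map ⟨TrSp.pt, cov.continuous⟩ =
      Path.Homotopic.Quotient.mk γ := by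
      rw [← Path.Homotopic.Quotient.mk_map]
      congr 1
    rw [h2] at this
    change V (cov.monodromy (Path.Homotopic.Quotient.mk γ) ⟨⟨x, f⟩, rfl⟩) = _
    rw [this]
    exact hV' _ _

end transport
end OS


open Set Topology
set_option linter.all false

namespace OS

/-! ### Homotopy classes of paths -/

abbrev Q {X : Type*} [TopologicalSpace X] (a b : X) := Path.Homotopic.Quotient a b

infixl:70 "⊚" => Path.Homotopic.Quotient.trans

section Qapi
variable {X Y Z : Type*} [TopologicalSpace X] [TopologicalSpace Y] [TopologicalSpace Z]

theorem Q_assoc {a b c d : X} (p : Q a b) (q : Q b c) (r : Q c d) : p ⊚ q ⊚ r = p ⊚ (q ⊚ r) :=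
  Path.Homotopic.Quotient.trans_assoc p q r

theorem Q_refl_l {a b : X} (p : Q a b) : (Path.Homotopic.Quotient.refl a) ⊚ p = p :=
  Path.Homotopic.Quotient.refl_trans p

theorem Q_refl_r {a b : X} (p : Q a b) : p ⊚ (Path.Homotopic.Quotient.refl b) = p :=
  Path.Homotopic.Quotient.trans_refl p

theorem Q_inv_l {a b : X} (p : Q a b) : p.symm ⊚ p = Path.Homotopic.Quotient.refl b :=
  Path.Homotopic.Quotient.symm_trans p

theorem Q_inv_r {a b : X} (p : Q a b) : p ⊚ p.symm = Path.Homotopic.Quotient.refl a :=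
  Path.Homotopic.Quotient.trans_symm p

theorem Q_cancel_l {a b c : X} (p : Q a b) (q : Q b c) : p.symm ⊚ (p ⊚ q) = q := by
  rw [← Q_assoc, Q_inv_l, Q_refl_l]

theorem Q_cancel_l' {a b c : X} (p : Q b a) (q : Q b c) : p ⊚ (p.symm ⊚ q) = q := by
  rw [← Q_assoc, Q_inv_r, Q_refl_l]

theorem Q_left_cancel {a b c : X} (p : Q a b) {q r : Q b c} (h : p ⊚ q = p ⊚ r) : q = r := by
  rw [← Q_cancel_l p q, h, Q_cancel_l]

theorem Q_right_cancel {a b c : X} {p q : Q a b} (r : Q b c) (h : p ⊚ r = q ⊚ r) : p = q := by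
  have := congrArg (fun x => x ⊚ r.symm) h
  simpa only [Q_assoc, Q_inv_r, Q_refl_r] using this

theorem Q_symm_trans {a b c : X} (p : Q a b) (q : Q b c) : (p ⊚ q).symm = q.symm ⊚ p.symm := by
  apply Q_left_cancel (p ⊚ q)
  rw [Q_inv_r, Q_assoc, Q_cancel_l', Q_inv_r]

theorem Q_symm_symm {a b : X} (p : Q a b) : p.symm.symm = p := by
  apply Q_left_cancel p.symm
  rw [Q_inv_r, Q_inv_l]

theorem Q_symm_refl (a : X) : (Path.Homotopic.Quotient.refl a).symm =
    Path.Homotopic.Quotient.refl a := by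
  apply Q_left_cancel (Path.Homotopic.Quotient.refl a)
  rw [Q_inv_r, Q_refl_l]

/-- Induced map on classes of paths, with prescribed end points. -/
noncomputable def mapE (f : C(X, Y)) {x y : X} {x' y' : Y} (hx : f x = x') (hy : f y = y')
    (γ : Q x y) : Q x' y' := (γ.map f).cast hx.symm hy.symm

theorem mapE_trans (f : C(X, Y)) {x y z : X} {x' y' z' : Y} (hx : f x = x') (hy : f y = y')
    (hz : f z = z') (γ : Q x y) (δ : Q y z) :
    mapE f hx hz (γ ⊚ δ) = mapE f hx hy γ ⊚ mapE f hy hz δ := by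
  subst hx hy hz
  induction γ using Path.Homotopic.Quotient.ind
  induction δ using Path.Homotopic.Quotient.ind
  simp [mapE, ← Path.Homotopic.Quotient.mk_trans, ← Path.Homotopic.Quotient.mk_map]

theorem mapE_refl (f : C(X, Y)) {x : X} {x' : Y} (hx : f x = x') :
    mapE f hx hx (Path.Homotopic.Quotient.refl x) = Path.Homotopic.Quotient.refl x' := by
  subst hx
  rfl

theorem mapE_symm (f : C(X, Y)) {x y : X} {x' y' : Y} (hx : f x = x') (hy : f y = y')
    (γ : Q x y) : mapE f hy hx γ.symm = (mapE f hx hy γ).symm := by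
  apply Q_left_cancel (mapE f hx hy γ)
  rw [← mapE_trans, Q_inv_r, Q_inv_r, mapE_refl]

theorem mapE_mapE (f : C(X, Y)) (g : C(Y, Z)) {x y : X} {x' y' : Y} {x'' y'' : Z}
    (hx : f x = x') (hy : f y = y') (hx' : g x' = x'') (hy' : g y' = y'') (γ : Q x y) :
    mapE g hx' hy' (mapE f hx hy γ) =
      mapE (g.comp f) (by simp [hx, hx']) (by simp [hy, hy']) γ := by
  subst hx hy hx' hy'
  induction γ using Path.Homotopic.Quotient.ind
  rfl

theorem mapE_congr (f g : C(X, Y)) (h : ∀ x, f x = g x) {x y : X} {x' y' : Y}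
    (hx : f x = x') (hy : f y = y') (γ : Q x y) :
    mapE f hx hy γ = mapE g ((h x).symm.trans hx) ((h y).symm.trans hy) γ := by
  obtain rfl : f = g := ContinuousMap.ext h
  rfl

theorem mapE_id (f : C(X, X)) (h : ∀ x, f x = x) {x y : X}
    (hx : f x = x) (hy : f y = y) (γ : Q x y) : mapE f hx hy γ = γ := by
  rw [mapE_congr f (ContinuousMap.id X) h]
  induction γ using Path.Homotopic.Quotient.ind
  rfl

theorem mapE_mk (f : C(X, Y)) {x y : X} {x' y' : Y} (hx : f x = x') (hy : f y = y')
    (p : Path x y) : mapE f hx hy (Path.Homotopic.Quotient.mk p) =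
      Path.Homotopic.Quotient.mk ((p.map f.continuous).cast hx.symm hy.symm) := by
  subst hx hy
  rfl

theorem mapE_eq_of (f : C(X, Y)) {x y : X} {x' y' : Y} (hx : f x = x') (hy : f y = y')
    (p : Path x y) (q : Path x' y') (h : ∀ t, f (p t) = q t) :
    mapE f hx hy (Path.Homotopic.Quotient.mk p) = Path.Homotopic.Quotient.mk q := by
  subst hx hy
  rw [mapE_mk]
  congr 1
  ext t
  exact h t

theorem mapE_htpy {f g : C(X, Y)} (H : f.Homotopy g) {x y : X} {a b a' b' : Y}
    (hx : f x = a) (hy : f y = b) (hx' : g x = a') (hy' : g y = b')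
    (u : Path a a') (v : Path b b') (hu : ∀ t, H (t, x) = u t) (hv : ∀ t, H (t, y) = v t)
    (γ : Q x y) :
    mapE f hx hy γ ⊚ Path.Homotopic.Quotient.mk v =
      Path.Homotopic.Quotient.mk u ⊚ mapE g hx' hy' γ := by
  subst hx hy hx' hy'
  induction γ using Path.Homotopic.Quotient.ind with | _ p
  have := Path.Homotopic.Quotient.eq.2 (Path.Homotopic.map_trans_evalAt H p)
  have hu' : H.evalAt x = u := by ext t; exact hu t
  have hv' : H.evalAt y = v := by ext t; exact hv t
  rw [hu', hv', Path.Homotopic.Quotient.mk_trans, Path.Homotopic.Quotient.mk_trans] at this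
  exact this

theorem mapE_htpy_rel {f g : C(X, Y)} (H : f.Homotopy g) {x y : X} {a b : Y}
    (hx : f x = a) (hy : f y = b) (hx' : g x = a) (hy' : g y = b)
    (hu : ∀ t, H (t, x) = a) (hv : ∀ t, H (t, y) = b)
    (γ : Q x y) : mapE f hx hy γ = mapE g hx' hy' γ := by
  have := mapE_htpy H hx hy hx' hy' (Path.refl a) (Path.refl b) (by simpa using hu)
    (by simpa using hv) γ
  rw [Path.Homotopic.Quotient.mk_refl, Path.Homotopic.Quotient.mk_refl, Q_refl_l, Q_refl_r] at this
  exact this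

/-- In a simply connected space: the unique class. -/
noncomputable def uq [SimplyConnectedSpace X] (a b : X) : Q a b :=
  Path.Homotopic.Quotient.mk (PathConnectedSpace.somePath a b)

theorem eq_uq [SimplyConnectedSpace X] {a b : X} (p : Q a b) : p = uq a b := by
  induction p using Path.Homotopic.Quotient.ind
  exact Path.Homotopic.Quotient.eq.2 (SimplyConnectedSpace.paths_homotopic _ _)

theorem Q_sub [SimplyConnectedSpace X] {a b : X} (p q : Q a b) : p = q := by
  rw [eq_uq p, eq_uq q]

end Qapi

theorem convex_sc {E : Type*} [NormedAddCommGroup E] [NormedSpace ℝ E] {C : Set E}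
    (hC : Convex ℝ C) (hne : C.Nonempty) : SimplyConnectedSpace C := by
  have := hC.contractibleSpace hne
  infer_instance

end OS


open Set Topology
set_option linter.all false

namespace OS

noncomputable section

/-! ### Families of plane sets -/

/-- A continuous family of functions on `ℂ` with a continuous section of the complement of
the zero sets. -/
structure Fam (S : Type*) [TopologicalSpace S] where
  A : S → ℂ → ℂ
  hA : Continuous fun q : S × ℂ => A q.1 q.2
  m : S → ℂ
  hm : Continuous m
  ne : ∀ s, A s (m s) ≠ 0

namespace Fam
section basic
variable {S : Type*} [TopologicalSpace S] (𝒜 : Fam S)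

def Fib (s : S) : Set ℂ := {z | 𝒜.A s z ≠ 0}
def Tot (C : Set S) : Set (S × ℂ) := {p | p.1 ∈ C ∧ 𝒜.A p.1 p.2 ≠ 0}

def inF {C : Set S} (s : C) : C(𝒜.Fib s, 𝒜.Tot C) :=
  ⟨fun z => ⟨(s.1, z.1), s.2, z.2⟩, by fun_prop⟩

def sec (C : Set S) : C(C, 𝒜.Tot C) :=
  ⟨fun s => ⟨(s.1, 𝒜.m s.1), s.2, 𝒜.ne s.1⟩, by
    have := 𝒜.hm
    fun_prop⟩

def incl {C D : Set S} (h : C ⊆ D) : C(𝒜.Tot C, 𝒜.Tot D) :=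
  ⟨fun x => ⟨x.1, h x.2.1, x.2.2⟩, by fun_prop⟩

def bp (s : S) : 𝒜.Fib s := ⟨𝒜.m s, 𝒜.ne s⟩

/-- Class of the path in the section between two points. -/
def sg {C : Set S} [SimplyConnectedSpace C] (s s' : C) :
    Q (𝒜.sec C s) (𝒜.sec C s') := mapE (𝒜.sec C) rfl rfl (uq s s')

theorem sg_eq {C : Set S} [SimplyConnectedSpace C] {s s' : C} (p : Q s s') :
    mapE (𝒜.sec C) rfl rfl p = 𝒜.sg s s' := by
  rw [sg, eq_uq p]

theorem sg_trans {C : Set S} [SimplyConnectedSpace C] (s s' s'' : C) :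
    𝒜.sg s s' ⊚ 𝒜.sg s' s'' = 𝒜.sg s s'' := by
  rw [sg, sg, ← mapE_trans, sg_eq]

theorem sg_self {C : Set S} [SimplyConnectedSpace C] (s : C) :
    𝒜.sg s s = Path.Homotopic.Quotient.refl _ := by
  rw [← 𝒜.sg_eq (Path.Homotopic.Quotient.refl s), mapE_refl]

theorem sg_symm {C : Set S} [SimplyConnectedSpace C] (s s' : C) :
    (𝒜.sg s s').symm = 𝒜.sg s' s := by
  apply Q_left_cancel (𝒜.sg s s')
  rw [Q_inv_r, sg_trans, sg_self]

theorem sg_incl {C D : Set S} [SimplyConnectedSpace C] [SimplyConnectedSpace D] (h : C ⊆ D)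
    (s s' : C) : mapE (𝒜.incl h) rfl rfl (𝒜.sg s s') =
      𝒜.sg (C := D) ⟨s.1, h s.2⟩ ⟨s'.1, h s'.2⟩ := by
  have h1 : 𝒜.sg (C := D) ⟨s.1, h s.2⟩ ⟨s'.1, h s'.2⟩ = mapE (𝒜.sec D) rfl rfl
      (mapE ⟨inclusion h, continuous_inclusion h⟩ rfl rfl (uq s s')) :=
    (𝒜.sg_eq (s := (⟨s.1, h s.2⟩ : D)) (s' := (⟨s'.1, h s'.2⟩ : D)) _).symm
  rw [h1, sg, mapE_mapE, mapE_mapE]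
  rfl

theorem isOpen_Tot {C : Set S} (hC : IsOpen C) : IsOpen (𝒜.Tot C) := by
  have h1 : IsOpen {p : S × ℂ | 𝒜.A p.1 p.2 ≠ 0} := isOpen_ne_fun 𝒜.hA continuous_const
  exact (hC.preimage continuous_fst).inter h1

end basic

section triv
variable {S : Type*} [NormedAddCommGroup S] [NormedSpace ℝ S] (𝒜 : Fam S)

/-- A trivialisation over `U`. -/
structure Triv (U : Set S) where
  φ : S → S → ℂ → ℂ
  cont : ContinuousOn (fun q : S × S × ℂ => φ q.1 q.2.1 q.2.2) (U ×ˢ (U ×ˢ univ))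
  ne : ∀ s ∈ U, ∀ s' ∈ U, ∀ z, 𝒜.A s' z ≠ 0 → 𝒜.A s (φ s s' z) ≠ 0
  self : ∀ s ∈ U, ∀ z, φ s s z = z
  sec : ∀ s ∈ U, ∀ s' ∈ U, φ s s' (𝒜.m s') = 𝒜.m s
  co : ∀ s ∈ U, ∀ s' ∈ U, ∀ s'' ∈ U, ∀ z, φ s s' (φ s' s'' z) = φ s s'' z

variable {𝒜} {U : Set S} (τ : 𝒜.Triv U)

/-- The retraction on a fiber. -/
def Triv.ret {C : Set S} (h : C ⊆ U) (s : C) : C(𝒜.Tot C, 𝒜.Fib s) :=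
  ⟨fun x => ⟨τ.φ s.1 x.1.1 x.1.2, τ.ne _ (h s.2) _ (h x.2.1) _ x.2.2⟩, by
    refine Continuous.subtype_mk ?_ _
    exact τ.cont.comp_continuous (f := fun x : 𝒜.Tot C => (s.1, x.1.1, x.1.2)) (by fun_prop)
      (fun x => ⟨h s.2, h x.2.1, trivial⟩)⟩

/-- The homeomorphism between the fibers. -/
def Triv.fm (s s' : U) : C(𝒜.Fib s', 𝒜.Fib s) := (τ.ret subset_rfl s).comp (𝒜.inF s')

theorem Triv.fm_bp (s s' : U) : τ.fm s s' (𝒜.bp s') = 𝒜.bp s :=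
  Subtype.ext (τ.sec _ s.2 _ s'.2)

theorem Triv.ret_inF {C : Set S} (h : C ⊆ U) (s : C) (a : 𝒜.Fib s) :
    τ.ret h s (𝒜.inF s a) = a := Subtype.ext (τ.self _ (h s.2) _)

theorem Triv.ret_inF' {C : Set S} (h : C ⊆ U) (s s' : C) (a : 𝒜.Fib s') :
    τ.ret h s (𝒜.inF s' a) = τ.fm ⟨s.1, h s.2⟩ ⟨s'.1, h s'.2⟩ a := rfl

/-- The deformation retraction. -/
def Triv.htp {C : Set S} (hC : Convex ℝ C) (h : C ⊆ U) (s : C) :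
    ((𝒜.inF s).comp (τ.ret h s)).Homotopy (ContinuousMap.id (𝒜.Tot C)) where
  toFun q := ⟨(AffineMap.lineMap s.1 q.2.1.1 (q.1 : ℝ),
      τ.φ (AffineMap.lineMap s.1 q.2.1.1 (q.1 : ℝ)) q.2.1.1 q.2.1.2),
      hC.lineMap_mem s.2 q.2.2.1 q.1.2,
      τ.ne _ (h (hC.lineMap_mem s.2 q.2.2.1 q.1.2)) _ (h q.2.2.1) _ q.2.2.2⟩
  continuous_toFun := by
    have hl : Continuous (fun q : unitInterval × 𝒜.Tot C =>
        AffineMap.lineMap (k := ℝ) s.1 q.2.1.1 (q.1 : ℝ)) := by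
      simp only [AffineMap.lineMap_apply_module]
      fun_prop
    refine Continuous.subtype_mk (hl.prodMk ?_) _
    exact τ.cont.comp_continuous (f := fun q : unitInterval × 𝒜.Tot C =>
      (AffineMap.lineMap (k := ℝ) s.1 q.2.1.1 (q.1 : ℝ), q.2.1.1, q.2.1.2))
      (by fun_prop)
      (fun q => ⟨h (hC.lineMap_mem s.2 q.2.2.1 q.1.2), h q.2.2.1, trivial⟩)
  map_zero_left x := by
    apply Subtype.ext
    simp [inF, Triv.ret]
  map_one_left x := by
    apply Subtype.ext
    have : τ.φ x.1.1 x.1.1 x.1.2 = x.1.2 := τ.self _ (h x.2.1) _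
    simp [this]

theorem Triv.htp_coe {C : Set S} (hC : Convex ℝ C) (h : C ⊆ U) (s : C) (t : unitInterval)
    (x : 𝒜.Tot C) : (τ.htp hC h s (t, x)).1 = (AffineMap.lineMap s.1 x.1.1 (t : ℝ),
      τ.φ (AffineMap.lineMap s.1 x.1.1 (t : ℝ)) x.1.1 x.1.2) := rfl

theorem Triv.G_surj {C : Set S} (hC : Convex ℝ C) (h : C ⊆ U) (s : C) (a b : 𝒜.Fib s)
    (p : Q (𝒜.inF s a) (𝒜.inF s b)) :
    mapE (𝒜.inF s) rfl rfl (mapE (τ.ret h s) (τ.ret_inF h s a) (τ.ret_inF h s b) p) = p := by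
  rw [mapE_mapE]
  have e : ∀ a : 𝒜.Fib s, ∀ t, τ.htp hC h s (t, 𝒜.inF s a) = 𝒜.inF s a := by
    intro a t
    apply Subtype.ext
    have : τ.φ s.1 s.1 a.1 = a.1 := τ.self _ (h s.2) _
    rw [Triv.htp_coe]
    simp [inF, this]
  refine (mapE_htpy_rel (τ.htp hC h s) _ _ rfl rfl (e a) (e b) p).trans ?_
  exact mapE_id _ (fun _ => rfl) _ _ _

theorem Triv.G_inj (τ : 𝒜.Triv U) {C : Set S} (h : C ⊆ U) (s : C) (a b : 𝒜.Fib s) (q q' : Q a b)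
    (hq : mapE (𝒜.inF s) rfl rfl q = mapE (𝒜.inF s) rfl rfl q') : q = q' := by
  have := congrArg (mapE (τ.ret h s) (τ.ret_inF h s a) (τ.ret_inF h s b)) hq
  rw [mapE_mapE, mapE_mapE, mapE_id _ (τ.ret_inF h s), mapE_id _ (τ.ret_inF h s)] at this
  exact this

theorem Triv.G2 {C : Set S} [SimplyConnectedSpace C] (hC : Convex ℝ C) (h : C ⊆ U) (s s' : C)
    (a : Q (𝒜.bp s') (𝒜.bp s')) :
    mapE (𝒜.inF s) rfl rfl (mapE (τ.fm ⟨s.1, h s.2⟩ ⟨s'.1, h s'.2⟩) (τ.fm_bp _ _) (τ.fm_bp _ _) a)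
      ⊚ 𝒜.sg s s' = 𝒜.sg s s' ⊚ mapE (𝒜.inF s') rfl rfl a := by
  let ℓ : Path s s' :=
    { toFun := fun t => ⟨AffineMap.lineMap s.1 s'.1 (t : ℝ), hC.lineMap_mem s.2 s'.2 t.2⟩
      continuous_toFun := by
        refine Continuous.subtype_mk ?_ _
        simp only [AffineMap.lineMap_apply_module]
        fun_prop
      source' := by simp
      target' := by simp }
  have hℓ : 𝒜.sg s s' = Path.Homotopic.Quotient.mk (ℓ.map (𝒜.sec C).continuous) := by
    rw [← 𝒜.sg_eq (Path.Homotopic.Quotient.mk ℓ)]; rfl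
  have e : 𝒜.inF s (τ.ret h s (𝒜.sec C s')) = 𝒜.sec C s := by
    apply Subtype.ext
    have := τ.sec _ (h s.2) _ (h s'.2)
    simp [inF, Fam.sec, Triv.ret, this]
  have e2 : ∀ t, τ.htp hC h s (t, 𝒜.sec C s') = (ℓ.map (𝒜.sec C).continuous) t := by
    intro t
    apply Subtype.ext
    have := τ.sec _ (h (ℓ t).2) _ (h s'.2)
    simp only [ℓ, Path.coe_mk_mk] at this
    rw [Triv.htp_coe]
    simp only [Fam.sec, ContinuousMap.coe_mk, this]
    rfl
  have key := mapE_htpy (τ.htp hC h s) e e rfl rfl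
    (ℓ.map (𝒜.sec C).continuous) (ℓ.map (𝒜.sec C).continuous) e2 e2
    (mapE (𝒜.inF s') rfl rfl a : Q (𝒜.sec C s') (𝒜.sec C s'))
  rw [hℓ]
  refine Eq.trans ?_ (key.trans (congrArg _ (mapE_id (ContinuousMap.id _) (fun _ => rfl) _ _ _)))
  congr 1
  exact (mapE_mapE _ _ _ _ _ _ _).trans (mapE_mapE (𝒜.inF s') ((𝒜.inF s).comp (τ.ret h s))
    (x' := 𝒜.sec C s') (y' := 𝒜.sec C s') rfl rfl e e a).symm

end triv
end Fam
end
end OS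


open Set Topology
set_option linter.all false

namespace OS

noncomputable section

/-! ### Convex pieces and pushing paths off thin sets -/

section cv
variable {E : Type*} [TopologicalSpace E]

def inc {V X : Set E} (h : V ⊆ X) : C(V, X) := ⟨inclusion h, continuous_inclusion h⟩

theorem inc_mk {V X : Set E} (h : V ⊆ X) (x : X) (hx : x.1 ∈ V) : inc h ⟨x.1, hx⟩ = x := rfl

/-- The class of a path in a simply connected piece `V` of `X`. -/
def cv {V X : Set E} (h : V ⊆ X) (hV : SimplyConnectedSpace V) (x y : X) (hx : x.1 ∈ V)
    (hy : y.1 ∈ V) : Q x y :=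
  mapE (inc h) (inc_mk h x hx) (inc_mk h y hy) (uq _ _)

theorem cv_mapE {V X : Set E} (h : V ⊆ X) (hV : SimplyConnectedSpace V) (x y : V) (p : Q x y) :
    mapE (inc h) rfl rfl p = cv h hV (inc h x) (inc h y) x.2 y.2 := by
  rw [eq_uq p]; rfl

theorem cv_trans {V X : Set E} (h : V ⊆ X) (hV : SimplyConnectedSpace V) (x y z : X) (hx : x.1 ∈ V)
    (hy : y.1 ∈ V) (hz : z.1 ∈ V) :
    cv h hV x y hx hy ⊚ cv h hV y z hy hz = cv h hV x z hx hz := by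
  unfold cv
  rw [← mapE_trans, eq_uq (_ ⊚ _)]

theorem cv_eq {V X : Set E} (h : V ⊆ X) (hV : SimplyConnectedSpace V) (x y : X)
    (p : Path x y) (hp : ∀ t, (p t).1 ∈ V) :
    Path.Homotopic.Quotient.mk p = cv h hV x y (by simpa using hp 0) (by simpa using hp 1) := by
  have hx : x.1 ∈ V := by simpa using hp 0
  have hy : y.1 ∈ V := by simpa using hp 1
  let q : Path (⟨x.1, hx⟩ : V) ⟨y.1, hy⟩ :=
    { toFun := fun t => ⟨(p t).1, hp t⟩
      continuous_toFun := by fun_prop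
      source' := by simp
      target' := by simp }
  rw [cv, ← eq_uq (Path.Homotopic.Quotient.mk q)]
  symm
  apply mapE_eq_of
  intro t
  rfl

theorem cv_self {V X : Set E} (h : V ⊆ X) (hV : SimplyConnectedSpace V) (x : X)
    (hx : x.1 ∈ V) : cv h hV x x hx hx = Path.Homotopic.Quotient.refl x := by
  rw [← Path.Homotopic.Quotient.mk_refl]
  exact (cv_eq h hV x x (Path.refl x) (fun t => by simpa using hx)).symm

theorem cv_symm {V X : Set E} (h : V ⊆ X) (hV : SimplyConnectedSpace V) (x y : X) (hx : x.1 ∈ V)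
    (hy : y.1 ∈ V) : (cv h hV x y hx hy).symm = cv h hV y x hy hx := by
  apply Q_left_cancel (cv h hV x y hx hy)
  rw [Q_inv_r, cv_trans, cv_self]

/-- Compatibility for two overlapping pieces. -/
theorem cv_ag {V W X : Set E} (h : V ⊆ X) (hV : SimplyConnectedSpace V) (h' : W ⊆ X)
    (hW : SimplyConnectedSpace W) (x y : X) (hVW : ∃ p : Path x y, ∀ t, (p t).1 ∈ V ∩ W)
    (hx : x.1 ∈ V) (hy : y.1 ∈ V) (hx' : x.1 ∈ W) (hy' : y.1 ∈ W) :
    cv h hV x y hx hy = cv h' hW x y hx' hy' := by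
  obtain ⟨p, hp⟩ := hVW
  rw [← cv_eq h hV x y p (fun t => (hp t).1), ← cv_eq h' hW x y p (fun t => (hp t).2)]

end cv

theorem joined_path {E : Type*} [TopologicalSpace E] {X V : Set E} (h : V ⊆ X) (x y : X)
    (hj : JoinedIn V x.1 y.1) : ∃ p : Path x y, ∀ t, (p t).1 ∈ V := by
  obtain ⟨p, hp⟩ := hj
  exact ⟨{ toFun := fun t => ⟨p t, h (hp t)⟩
           continuous_toFun := by fun_prop
           source' := by simp
           target' := by simp }, hp⟩

section push
variable {E : Type*} [NormedAddCommGroup E] [NormedSpace ℝ E]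

theorem push_path {X Y : Set E} (hX : IsOpen X) (hYX : Y ⊆ X)
    (hY : ∀ V : Set E, V ⊆ X → IsOpen V → Convex ℝ V → V.Nonempty → IsPathConnected (V ∩ Y))
    (a b : Y) (γ : Q (inc hYX a) (inc hYX b)) : ∃ q : Q a b, mapE (inc hYX) rfl rfl q = γ := by
  -- moving inside a convex piece
  have mv : ∀ V : Set E, ∀ (h : V ⊆ X) (ho : IsOpen V) (hc : Convex ℝ V) (hV : SimplyConnectedSpace V)
      (x y : Y) (hx : x.1 ∈ V) (hy : y.1 ∈ V), ∃ q : Q x y, mapE (inc hYX) rfl rfl q =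
        cv h hV (inc hYX x) (inc hYX y) hx hy := by
    intro V h ho hc hV x y hx hy
    obtain ⟨p, hp⟩ := joined_path (X := Y) (V := V ∩ Y) inter_subset_right x y
      ((hY V h ho hc ⟨_, hx⟩).joinedIn _ ⟨hx, x.2⟩ _ ⟨hy, y.2⟩)
    refine ⟨Path.Homotopic.Quotient.mk p, ?_⟩
    rw [mapE_mk]
    exact cv_eq h hV (inc hYX x) (inc hYX y) _ (fun t => (hp t).1)
  let U : {V : Set E // V ⊆ X ∧ IsOpen V ∧ Convex ℝ V} → Set X := fun V => {x | x.1 ∈ V.1}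
  have key := path_induction U (fun V => V.2.2.1.preimage continuous_subtype_val) (by
      rintro ⟨x, hx⟩
      obtain ⟨ε, hε, hb⟩ := Metric.isOpen_iff.1 hX x hx
      exact ⟨⟨Metric.ball x ε, hb, Metric.isOpen_ball, convex_ball _ _⟩, Metric.mem_ball_self hε⟩)
    (inc hYX a)
    (fun x γ => ∀ V : Set E, ∀ (h : V ⊆ X) (ho : IsOpen V) (hc : Convex ℝ V)
      (hV : SimplyConnectedSpace V) (hx : x.1 ∈ V) (y : Y) (hy : y.1 ∈ V),
      ∃ q : Q a y, mapE (inc hYX) rfl rfl q = γ ⊚ cv h hV x (inc hYX y) hx hy) (by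
      intro V h ho hc hV hx y hy
      obtain ⟨q, hq⟩ := mv V h ho hc hV a y hx hy
      exact ⟨q, by rw [hq, Q_refl_l]⟩) (by
      rintro x x' γ δ ⟨W, hWX, hWo, hWc⟩ hδ hP V h ho hc hV hx y hy
      have hxW : x.1 ∈ W := by
        have := hδ 0
        rw [Path.source] at this
        exact this
      have hx'W : x'.1 ∈ W := by
        have := hδ 1
        rw [Path.target] at this
        exact this
      have hW : SimplyConnectedSpace W := convex_sc hWc ⟨_, hxW⟩
      obtain ⟨y1, ⟨hy1W, hy1V⟩, hy1Y⟩ := (hY (W ∩ V) (inter_subset_right.trans h) (hWo.inter ho)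
        (hWc.inter hc) ⟨x'.1, hx'W, hx⟩).nonempty
      obtain ⟨q, hq⟩ := hP W hWX hWo hWc hW hxW ⟨y1, hy1Y⟩ hy1W
      obtain ⟨q', hq'⟩ := mv V h ho hc hV ⟨y1, hy1Y⟩ y hy1V hy
      refine ⟨q ⊚ q', ?_⟩
      rw [mapE_trans (hy := rfl), hq, hq', cv_eq hWX hW _ _ δ hδ,
        ← cv_trans hWX hW x x' _ hxW hx'W hy1W, ← cv_trans h hV x' (inc hYX ⟨y1, hy1Y⟩) _ hx hy1V hy,
        cv_ag hWX hW h hV x' (inc hYX ⟨y1, hy1Y⟩) (joined_path (V := W ∩ V)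
          (inter_subset_right.trans h) _ _ (((hWc.inter hc).isPathConnected
            ⟨x'.1, hx'W, hx⟩).joinedIn _ ⟨hx'W, hx⟩ _ ⟨hy1W, hy1V⟩)) hx'W hy1W hx hy1V]
      simp only [Q_assoc]) (inc hYX b) γ
  obtain ⟨ε, hε, hb⟩ := Metric.isOpen_iff.1 hX b.1 (hYX b.2)
  obtain ⟨q, hq⟩ := key (Metric.ball b.1 ε) hb Metric.isOpen_ball (convex_ball _ _)
    (convex_sc (convex_ball _ _) ⟨_, Metric.mem_ball_self hε⟩) (Metric.mem_ball_self hε) b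
    (Metric.mem_ball_self hε)
  refine ⟨q, ?_⟩
  exact hq.trans ((congrArg _ (cv_self hb _ _ _)).trans (Q_refl_r γ))

end push

end
end OS


open Set Topology
set_option linter.all false

namespace OS

noncomputable section

namespace Fam

variable {S : Type*} [NormedAddCommGroup S] [NormedSpace ℝ S] (𝒜 : Fam S)

/-- Data for local triviality over `D`. -/
def LocTriv (D : Set S) : Prop :=
  ∀ s ∈ D, ∃ U : Set S, IsOpen U ∧ Convex ℝ U ∧ s ∈ U ∧ U ⊆ D ∧ Nonempty (𝒜.Triv U)

/-- base point of a point of the total space -/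
def bs {C : Set S} (x : 𝒜.Tot C) : C := ⟨x.1.1, x.2.1⟩
/-- fiber coordinate of a point of the total space -/
def fc {C : Set S} (x : 𝒜.Tot C) : 𝒜.Fib (𝒜.bs x) := ⟨x.1.2, x.2.2⟩
theorem inF_fc {C : Set S} (x : 𝒜.Tot C) : 𝒜.inF (𝒜.bs x) (𝒜.fc x) = x := rfl
theorem inF_bp {C : Set S} (s : C) : 𝒜.inF s (𝒜.bp s) = 𝒜.sec C s := rfl
theorem incl_sec {C D : Set S} (h : C ⊆ D) (s : C) :
  𝒜.incl h (𝒜.sec C s) = 𝒜.sec D (inc h s) := rfl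
theorem incl_inF {C D : Set S} (h : C ⊆ D) (s : C) (z : 𝒜.Fib s) :
  𝒜.incl h (𝒜.inF s z) = 𝒜.inF (inc h s) z := rfl

theorem factor_path {D : Set S} (hD : IsOpen D) (hloc : 𝒜.LocTriv D) (s₀ : D) :
    ∀ (x : 𝒜.Tot D) (γ : Q (𝒜.sec D s₀) x), ∃ (β : Q s₀ (𝒜.bs x))
      (κ : Q (𝒜.bp (𝒜.bs x)) (𝒜.fc x)), γ = mapE (𝒜.sec D) rfl rfl β ⊚
        mapE (𝒜.inF (𝒜.bs x)) (𝒜.inF_bp _) (𝒜.inF_fc x) κ := by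
  let ι := {U : Set S // IsOpen U ∧ Convex ℝ U ∧ U ⊆ D ∧ Nonempty (𝒜.Triv U)}
  let W : ι → Set (𝒜.Tot D) := fun U => {x | x.1.1 ∈ U.1}
  refine path_induction W (fun U => U.2.1.preimage (by fun_prop)) ?_ (𝒜.sec D s₀) _ ?_ ?_
  · rintro ⟨⟨s, z⟩, hs, hz⟩
    obtain ⟨U, h1, h2, h3, h4, h5⟩ := hloc s hs
    exact ⟨⟨U, h1, h2, h4, h5⟩, h3⟩
  · refine ⟨Path.Homotopic.Quotient.refl _, Path.Homotopic.Quotient.refl _, ?_⟩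
    refine Eq.symm (Eq.trans (congrArg₂ _ (mapE_refl _ _) (mapE_refl _ _)) (Q_refl_l _))
  · rintro x x' γ δ ⟨U, hUo, hUc, hUD, ⟨τ⟩⟩ hδ ⟨β, κ, hγ⟩
    have hδ' : ∀ t, (δ t).1.1 ∈ U := hδ
    have hx : x.1.1 ∈ U := by simpa using hδ' 0
    have hx' : x'.1.1 ∈ U := by simpa using hδ' 1
    have hU : SimplyConnectedSpace U := convex_sc hUc ⟨_, hx⟩
    let s : U := ⟨x.1.1, hx⟩
    let s' : U := ⟨x'.1.1, hx'⟩
    let xU : 𝒜.Tot U := ⟨x.1, hx, x.2.2⟩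
    let xU' : 𝒜.Tot U := ⟨x'.1, hx', x'.2.2⟩
    let δU : Path xU xU' :=
      { toFun := fun t => ⟨(δ t).1, hδ t, (δ t).2.2⟩
        continuous_toFun := by fun_prop
        source' := by simp [xU]
        target' := by simp [xU'] }
    have hδU : mapE (𝒜.incl hUD) (x' := x) (y' := x') rfl rfl (Path.Homotopic.Quotient.mk δU) =
        Path.Homotopic.Quotient.mk δ := mapE_eq_of _ _ _ _ _ (fun t => rfl)
    let κU : Q (𝒜.sec U s) xU := mapE (𝒜.inF s) rfl rfl κ
    let e : Q (𝒜.inF s' (𝒜.bp s')) (𝒜.inF s' (𝒜.fc x')) :=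
      𝒜.sg s' s ⊚ κU ⊚ Path.Homotopic.Quotient.mk δU
    have he := τ.G_surj hUc subset_rfl s' (𝒜.bp s') (𝒜.fc x') e
    set κ' := mapE (τ.ret subset_rfl s') (τ.ret_inF subset_rfl s' (𝒜.bp s'))
      (τ.ret_inF subset_rfl s' (𝒜.fc x')) e with hκ'
    refine ⟨β ⊚ mapE (inc hUD) (x := s) (y := s') rfl rfl (uq s s'), κ', ?_⟩
    have h1 := congrArg (mapE (𝒜.incl hUD) (x' := 𝒜.sec D (𝒜.bs x')) (y' := x') rfl rfl) he
    have h2 : mapE (𝒜.incl hUD) (x' := 𝒜.sec D (𝒜.bs x')) (y' := x') rfl rfl e =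
        mapE (𝒜.sec D) (x' := 𝒜.sec D (𝒜.bs x')) (y' := 𝒜.sec D (𝒜.bs x)) rfl rfl
          (mapE (inc hUD) (x' := 𝒜.bs x') (y' := 𝒜.bs x) rfl rfl (uq s' s)) ⊚
        mapE (𝒜.inF (𝒜.bs x)) (𝒜.inF_bp _) (𝒜.inF_fc x) κ ⊚ Path.Homotopic.Quotient.mk δ := by
      refine (mapE_trans (𝒜.incl hUD) rfl (y' := x) rfl rfl _ _).trans ?_
      refine congrArg₂ _ ?_ hδU
      refine (mapE_trans (𝒜.incl hUD) rfl (y' := 𝒜.sec D (𝒜.bs x)) rfl rfl _ _).trans ?_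
      refine congrArg₂ _ ?_ ?_
      · exact (mapE_mapE (𝒜.sec U) (𝒜.incl hUD) (x' := 𝒜.sec U s') (y' := 𝒜.sec U s) rfl rfl
          rfl rfl (uq s' s)).trans (mapE_mapE (inc hUD) (𝒜.sec D) (x' := 𝒜.bs x')
          (y' := 𝒜.bs x) rfl rfl rfl rfl (uq s' s)).symm
      · exact mapE_mapE (𝒜.inF s) (𝒜.incl hUD) (x' := 𝒜.sec U s) (y' := xU) rfl rfl
          (𝒜.incl_sec hUD s) rfl κ
    have h3 : mapE (𝒜.inF (𝒜.bs x')) (𝒜.inF_bp _) (𝒜.inF_fc x') κ' =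
        mapE (𝒜.incl hUD) (x' := 𝒜.sec D (𝒜.bs x')) (y' := x') rfl rfl e := by
      rw [← h1]
      exact (mapE_mapE (𝒜.inF s') (𝒜.incl hUD) (x' := 𝒜.sec U s') (y' := xU') rfl rfl
          (𝒜.incl_sec hUD s') rfl κ').symm
    have h4 : mapE (𝒜.sec D) rfl rfl (β ⊚ mapE (inc hUD) (x := s) (y := s') rfl rfl (uq s s')) =
        mapE (𝒜.sec D) (x' := 𝒜.sec D s₀) (y' := 𝒜.sec D (𝒜.bs x)) rfl rfl β ⊚
        mapE (𝒜.sec D) (x' := 𝒜.sec D (𝒜.bs x)) (y' := 𝒜.sec D (𝒜.bs x')) rfl rfl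
          (mapE (inc hUD) (x' := 𝒜.bs x) (y' := 𝒜.bs x') rfl rfl (uq s s')) :=
      mapE_trans _ _ _ _ _ _
    have h5 : mapE (𝒜.sec D) (x' := 𝒜.sec D (𝒜.bs x')) (y' := 𝒜.sec D (𝒜.bs x)) rfl rfl
          (mapE (inc hUD) (x' := 𝒜.bs x') (y' := 𝒜.bs x) rfl rfl (uq s' s)) =
         (mapE (𝒜.sec D) (x' := 𝒜.sec D (𝒜.bs x)) (y' := 𝒜.sec D (𝒜.bs x')) rfl rfl
          (mapE (inc hUD) (x' := 𝒜.bs x) (y' := 𝒜.bs x') rfl rfl (uq s s'))).symm := by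
      refine Eq.trans ?_ (mapE_symm _ _ _ _)
      refine congrArg _ ?_
      refine Eq.trans ?_ (mapE_symm _ _ _ _)
      refine congrArg _ ?_
      exact (eq_uq _).symm
    refine Eq.trans ?_ (congrArg₂ _ h4.symm (h2.symm.trans h3.symm))
    rw [h5, hγ]
    simp only [Q_assoc]
    rw [Q_cancel_l']

/-- A point as a point of `univ`. -/
def un (s : S) : (univ : Set S) := ⟨s, mem_univ s⟩

theorem mapE_loop_sc {Y Z : Type*} [TopologicalSpace Y] [TopologicalSpace Z]
    [SimplyConnectedSpace Y] (g : C(Y, Z)) {y : Y} {z : Z} (h : g y = z) (p : Q y y) :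
    mapE g h h p = Path.Homotopic.Quotient.refl z := by
  rw [Q_sub p (Path.Homotopic.Quotient.refl y), mapE_refl]

theorem univ_sc : SimplyConnectedSpace (univ : Set S) := convex_sc convex_univ ⟨0, trivial⟩

theorem Tot_sub (D : Set S) : 𝒜.Tot D ⊆ 𝒜.Tot univ := fun x hx => ⟨mem_univ _, hx.2⟩

/-- The fundamental group of a generic fiber surjects on that of the total space. -/
theorem lemmaA {D : Set S} (hD : IsOpen D) (hloc : 𝒜.LocTriv D)
    (hthin : ∀ V : Set (S × ℂ), V ⊆ 𝒜.Tot univ → IsOpen V → Convex ℝ V → V.Nonempty →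
      IsPathConnected (V ∩ 𝒜.Tot D)) (s₀ : S) (hs₀ : s₀ ∈ D) (b : 𝒜.Fib s₀)
    (γ : Q (𝒜.sec univ (un s₀)) (𝒜.inF (un s₀) b)) :
    ∃ a : Q (𝒜.bp s₀) b, mapE (𝒜.inF (un s₀)) (𝒜.inF_bp (un s₀)) rfl a = γ := by
  obtain ⟨q, hq⟩ := push_path (𝒜.isOpen_Tot isOpen_univ) (𝒜.Tot_sub D) hthin
    (𝒜.sec D ⟨s₀, hs₀⟩) (𝒜.inF ⟨s₀, hs₀⟩ b) γ
  obtain ⟨β, κ, h⟩ := 𝒜.factor_path hD hloc ⟨s₀, hs₀⟩ _ q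
  refine ⟨κ, ?_⟩
  rw [← hq, h]
  have hu := univ_sc (S := S)
  have h1 : mapE (inc (𝒜.Tot_sub D)) (x' := 𝒜.sec univ (un s₀)) (y' := 𝒜.sec univ (un s₀))
      rfl rfl (mapE (𝒜.sec D) (x' := 𝒜.sec D ⟨s₀, hs₀⟩)
      (y' := 𝒜.sec D ⟨s₀, hs₀⟩) rfl rfl β) = Path.Homotopic.Quotient.refl _ := by
    refine Eq.trans (mapE_mapE _ _ _ _ _ _ _) ?_
    refine Eq.trans (Eq.symm (mapE_mapE (inc (subset_univ D)) (𝒜.sec univ) (x' := un s₀)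
      (y' := un s₀) rfl rfl rfl rfl β)) ?_
    exact mapE_loop_sc _ _ _
  refine Eq.symm ((mapE_trans (inc (𝒜.Tot_sub D)) rfl (y' := 𝒜.sec univ (un s₀)) rfl rfl _ _).trans ?_)
  refine (congrArg₂ _ h1 rfl).trans ((Q_refl_l _).trans ?_)
  exact mapE_mapE (𝒜.inF (⟨s₀, hs₀⟩ : D)) (inc (𝒜.Tot_sub D)) (x' := 𝒜.sec D ⟨s₀, hs₀⟩)
    (y' := 𝒜.inF ⟨s₀, hs₀⟩ b) rfl rfl rfl rfl κ

end Fam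
end
end OS


open Set Topology
set_option linter.all false

namespace OS

noncomputable section

namespace Fam

variable {S : Type*} [NormedAddCommGroup S] [NormedSpace ℝ S] (𝒜 : Fam S)

theorem Triv.fm_co {𝒜 : Fam S} {U : Set S} (τ : 𝒜.Triv U) (s s' s'' : U) (z : 𝒜.Fib s'') :
    τ.fm s s' (τ.fm s' s'' z) = τ.fm s s'' z :=
  Subtype.ext (τ.co _ s.2 _ s'.2 _ s''.2 _)

theorem Triv.fm_self {𝒜 : Fam S} {U : Set S} (τ : 𝒜.Triv U) (s : U) (z : 𝒜.Fib s) :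
    τ.fm s s z = z :=
  Subtype.ext (τ.self _ s.2 _)

/-- Action of a trivialisation on loops of fibers. -/
def Triv.fl {𝒜 : Fam S} {U : Set S} (τ : 𝒜.Triv U) (s s' : U) (a : Q (𝒜.bp s') (𝒜.bp s')) :
    Q (𝒜.bp s) (𝒜.bp s) := mapE (τ.fm s s') (τ.fm_bp _ _) (τ.fm_bp _ _) a

theorem Triv.fl_co {𝒜 : Fam S} {U : Set S} (τ : 𝒜.Triv U) (s s' s'' : U)
    (a : Q (𝒜.bp s'') (𝒜.bp s'')) : τ.fl s s' (τ.fl s' s'' a) = τ.fl s s'' a := by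
  unfold Triv.fl
  rw [mapE_mapE]
  exact mapE_congr _ _ (τ.fm_co s s' s'') _ _ _

theorem Triv.fl_self {𝒜 : Fam S} {U : Set S} (τ : 𝒜.Triv U) (s : U)
    (a : Q (𝒜.bp s) (𝒜.bp s)) : τ.fl s s a = a :=
  mapE_id _ (τ.fm_self s) _ _ _

theorem Triv.fl_trans {𝒜 : Fam S} {U : Set S} (τ : 𝒜.Triv U) (s s' : U)
    (a b : Q (𝒜.bp s') (𝒜.bp s')) : τ.fl s s' (a ⊚ b) = τ.fl s s' a ⊚ τ.fl s s' b :=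
  mapE_trans _ _ _ _ _ _

/-- characterisation of `fl` -/
theorem Triv.fl_eq {𝒜 : Fam S} {U : Set S} (τ : 𝒜.Triv U) {C : Set S} [SimplyConnectedSpace C]
    (hC : Convex ℝ C) (h : C ⊆ U) (s s' : C) (a : Q (𝒜.bp s') (𝒜.bp s')) (b : Q (𝒜.bp s) (𝒜.bp s))
    (hb : mapE (𝒜.inF s) rfl rfl b ⊚ 𝒜.sg s s' = 𝒜.sg s s' ⊚ mapE (𝒜.inF s') rfl rfl a) :
    τ.fl ⟨s.1, h s.2⟩ ⟨s'.1, h s'.2⟩ a = b := by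
  have h1 := τ.G2 hC h s s' a
  exact τ.G_inj h s _ _ _ _ (Q_right_cancel _ (h1.trans hb.symm))

theorem exists_mono {D : Set S} (hloc : 𝒜.LocTriv D) :
    ∃ Tr : ∀ s s' : D, Q s s' → Q (𝒜.bp s) (𝒜.bp s) → Q (𝒜.bp s') (𝒜.bp s'),
      (∀ s a, Tr s s (Path.Homotopic.Quotient.refl s) a = a) ∧
      (∀ s s' s'' γ δ a, Tr s s'' (γ ⊚ δ) a = Tr s' s'' δ (Tr s s' γ a)) ∧
      (∀ (U : Set S) (hUo : IsOpen U) (hUc : Convex ℝ U) (hUD : U ⊆ D) (τ : 𝒜.Triv U) (s s' : D)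
        (γ : Path s s') (hγ : ∀ t, (γ t).1 ∈ U) (hs : s.1 ∈ U) (hs' : s'.1 ∈ U) a,
        Tr s s' (Path.Homotopic.Quotient.mk γ) a = τ.fl ⟨s'.1, hs'⟩ ⟨s.1, hs⟩ a) ∧
      (∀ s s' γ a b, Tr s s' γ (a ⊚ b) = Tr s s' γ a ⊚ Tr s s' γ b) := by
  classical
  let ι := {U : Σ U : Set S, 𝒜.Triv U // IsOpen U.1 ∧ Convex ℝ U.1 ∧ U.1 ⊆ D}
  let W : ι → Set D := fun U => {x | x.1 ∈ U.1.1}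
  let T : ∀ (_ : ι) (s s' : D), Q (𝒜.bp s) (𝒜.bp s) → Q (𝒜.bp s') (𝒜.bp s') := fun U s s' a =>
    if h : s.1 ∈ U.1.1 ∧ s'.1 ∈ U.1.1 then U.1.2.fl ⟨s'.1, h.2⟩ ⟨s.1, h.1⟩ a
      else Path.Homotopic.Quotient.refl _
  have hT : ∀ (U : ι) (s s' : D) (hs : s.1 ∈ U.1.1) (hs' : s'.1 ∈ U.1.1) a,
      T U s s' a = U.1.2.fl ⟨s'.1, hs'⟩ ⟨s.1, hs⟩ a := fun U s s' hs hs' a => dif_pos ⟨hs, hs'⟩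
  have hWo : ∀ i, IsOpen (W i) := fun U => U.2.1.preimage continuous_subtype_val
  have hWc : ∀ x, ∃ i, x ∈ W i := by
    rintro ⟨s, hs⟩
    obtain ⟨U, h1, h2, h3, h4, ⟨τ⟩⟩ := hloc s hs
    exact ⟨⟨⟨U, τ⟩, h1, h2, h4⟩, h3⟩
  have k1 : ∀ i x, x ∈ W i → ∀ f, T i x x f = f := by
    intro U s hs a
    rw [hT U s s hs hs]
    exact Triv.fl_self _ _ _
  have k2 : ∀ i x y z, x ∈ W i → y ∈ W i → z ∈ W i → ∀ f, T i y z (T i x y f) = T i x z f := by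
    intro U s s' s'' hs hs' hs'' a
    rw [hT U _ _ hs hs', hT U _ _ hs' hs'', hT U _ _ hs hs'']
    exact Triv.fl_co _ _ _ _ _
  have k3 : ∀ i j x y, x ∈ W i → y ∈ W i → x ∈ W j → y ∈ W j → ∀ f, T i x y f = T j x y f := by
    intro U V s s' hs hs' ht ht' a
    rw [hT U _ _ hs hs', hT V _ _ ht ht']
    have hC : Convex ℝ (U.1.1 ∩ V.1.1) := U.2.2.1.inter V.2.2.1
    have hsc := convex_sc hC ⟨s.1, hs, ht⟩
    exact U.1.2.fl_eq hC inter_subset_left ⟨s'.1, hs', ht'⟩ ⟨s.1, hs, ht⟩ a _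
      (V.1.2.G2 hC inter_subset_right ⟨s'.1, hs', ht'⟩ ⟨s.1, hs, ht⟩ a)
  obtain ⟨Tr, h1, h2, h3⟩ := exists_transport (F := fun s : D => Q (𝒜.bp s) (𝒜.bp s)) W T
    hWo hWc k1 k2 k3
  have h3' : ∀ (U : Set S) (hUo : IsOpen U) (hUc : Convex ℝ U) (hUD : U ⊆ D) (τ : 𝒜.Triv U)
      (s s' : D)
      (γ : Path s s') (hγ : ∀ t, (γ t).1 ∈ U) (hs : s.1 ∈ U) (hs' : s'.1 ∈ U) a,
      Tr s s' (Path.Homotopic.Quotient.mk γ) a = τ.fl ⟨s'.1, hs'⟩ ⟨s.1, hs⟩ a := by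
    intro U hUo hUc hUD τ s s' γ hγ hs hs' a
    rw [h3 ⟨⟨U, τ⟩, hUo, hUc, hUD⟩ s s' γ hγ a]
    exact hT ⟨⟨U, τ⟩, hUo, hUc, hUD⟩ s s' hs hs' a
  refine ⟨Tr, h1, h2, h3', ?_⟩
  intro s
  refine path_induction W hWo hWc s _ ?_ ?_
  · intro a b
    rw [h1, h1, h1]
  · rintro x y γ δ ⟨⟨U, τ⟩, hUo, hUc, hUD⟩ hδ ih a b
    have hδ' : ∀ t, (δ t).1 ∈ U := hδ
    have hx : x.1 ∈ U := by simpa using hδ' 0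
    have hy : y.1 ∈ U := by simpa using hδ' 1
    have e := h3' U hUo hUc hUD τ x y δ hδ' hx hy
    rw [h2, ih, h2, h2, e, e, e, Triv.fl_trans]

/-- `G2` in the whole total space -/
theorem Triv.G2u {𝒜 : Fam S} {U : Set S} (τ : 𝒜.Triv U) (hUc : Convex ℝ U)
    [SimplyConnectedSpace (univ : Set S)] (s s' : U) (a : Q (𝒜.bp s') (𝒜.bp s')) :
    mapE (𝒜.inF (un s.1)) (𝒜.inF_bp (un s.1)) (𝒜.inF_bp (un s.1)) (τ.fl s s' a) ⊚
      𝒜.sg (un s.1) (un s'.1) = 𝒜.sg (un s.1) (un s'.1) ⊚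
      mapE (𝒜.inF (un s'.1)) (𝒜.inF_bp (un s'.1)) (𝒜.inF_bp (un s'.1)) a := by
  have hsc := convex_sc hUc ⟨s.1, s.2⟩
  have h := congrArg (mapE (𝒜.incl (subset_univ U)) (x' := 𝒜.sec univ (un s.1))
    (y' := 𝒜.sec univ (un s'.1)) rfl rfl) (τ.G2 hUc subset_rfl s s' a)
  have e1 := mapE_trans (𝒜.incl (subset_univ U)) (x' := 𝒜.sec univ (un s.1))
    (y' := 𝒜.sec univ (un s.1)) (z' := 𝒜.sec univ (un s'.1)) rfl rfl rfl
    (mapE (𝒜.inF s) (x' := 𝒜.sec U s) (y' := 𝒜.sec U s) rfl rfl (τ.fl s s' a)) (𝒜.sg s s')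
  have e2 := mapE_trans (𝒜.incl (subset_univ U)) (x' := 𝒜.sec univ (un s.1))
    (y' := 𝒜.sec univ (un s'.1)) (z' := 𝒜.sec univ (un s'.1)) rfl rfl rfl
    (𝒜.sg s s') (mapE (𝒜.inF s') (x' := 𝒜.sec U s') (y' := 𝒜.sec U s') rfl rfl a)
  have e3 := 𝒜.sg_incl (subset_univ U) s s'
  have h' := e1.symm.trans (h.trans e2)
  refine Eq.trans ?_ (h'.trans ?_)
  · refine congrArg₂ _ ?_ e3.symm
    exact (mapE_mapE (𝒜.inF s) (𝒜.incl (subset_univ U)) (x' := 𝒜.sec U s) (y' := 𝒜.sec U s)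
      rfl rfl rfl rfl (τ.fl s s' a)).symm
  · refine congrArg₂ _ e3 ?_
    exact (mapE_mapE (𝒜.inF s') (𝒜.incl (subset_univ U)) (x' := 𝒜.sec U s') (y' := 𝒜.sec U s')
      rfl rfl rfl rfl a)

end Fam
end
end OS


open Set Topology
set_option linter.all false

namespace OS

noncomputable section

namespace Fam

variable {S : Type*} [NormedAddCommGroup S] [NormedSpace ℝ S] (𝒜 : Fam S)
variable {S' : Type*} [NormedAddCommGroup S'] [NormedSpace ℝ S'] (ι : S' →L[ℝ] S)

/-- Pulled back family. -/
def pull : Fam S' where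
  A l z := 𝒜.A (ι l) z
  hA := 𝒜.hA.comp (f := fun q : S' × ℂ => (ι q.1, q.2)) (by fun_prop)
  m l := 𝒜.m (ι l)
  hm := 𝒜.hm.comp ι.continuous
  ne l := 𝒜.ne (ι l)

/-- Pulled back trivialisation. -/
def Triv.pull {𝒜 : Fam S} {U : Set S} (τ : 𝒜.Triv U) : (𝒜.pull ι).Triv (ι ⁻¹' U) where
  φ l l' z := τ.φ (ι l) (ι l') z
  cont := τ.cont.comp (f := fun q : S' × S' × ℂ => (ι q.1, ι q.2.1, q.2.2))
    (Continuous.continuousOn (by fun_prop)) (fun q hq => ⟨hq.1, hq.2.1, trivial⟩)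
  ne l hl l' hl' := τ.ne _ hl _ hl'
  self l hl := τ.self _ hl
  sec l hl l' hl' := τ.sec _ hl _ hl'
  co l hl l' hl' l'' hl'' := τ.co _ hl _ hl' _ hl''

theorem pull_loc {D : Set S} (h : 𝒜.LocTriv D) : (𝒜.pull ι).LocTriv (ι ⁻¹' D) := by
  intro l hl
  obtain ⟨U, h1, h2, h3, h4, ⟨τ⟩⟩ := h (ι l) hl
  exact ⟨ι ⁻¹' U, h1.preimage ι.continuous, h2.linear_preimage ι.toLinearMap, h3,
    preimage_mono h4, ⟨τ.pull ι⟩⟩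

/-- the restriction of `ι` -/
def iD (D : Set S) : C(ι ⁻¹' D, D) := ⟨fun l => ⟨ι l.1, l.2⟩, by fun_prop⟩

theorem iD_ap (D : Set S) (l : ι ⁻¹' D) : iD ι D l = ⟨ι l.1, l.2⟩ := rfl
theorem iD_mk (D : Set S) (l : S') (hl : ι l ∈ D) :
  iD ι D (⟨l, hl⟩ : ι ⁻¹' D) = ⟨ι l, hl⟩ := rfl

/-- class in the pulled back total space of a loop in the fiber -/
def inL (l₀ : S') (a : Q (𝒜.bp (ι l₀)) (𝒜.bp (ι l₀))) :
    Q ((𝒜.pull ι).sec univ (un l₀)) ((𝒜.pull ι).sec univ (un l₀)) :=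
  mapE ((𝒜.pull ι).inF (un l₀)) rfl rfl a

theorem exists_rho {D : Set S} (hloc : 𝒜.LocTriv D) (hDc : IsPathConnected D) (l₀ : S')
    (hl₀ : ι l₀ ∈ D)
    (hZ : ∀ β : Q (⟨ι l₀, hl₀⟩ : D) ⟨ι l₀, hl₀⟩, ∃ β' : Q (⟨l₀, hl₀⟩ : ι ⁻¹' D) ⟨l₀, hl₀⟩,
      mapE (iD ι D) (iD_mk ι D l₀ hl₀) (iD_mk ι D l₀ hl₀) β' = β) :
    ∃ ρ : ∀ s : D, Q (𝒜.bp s) (𝒜.bp s) →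
        Q ((𝒜.pull ι).sec univ (un l₀)) ((𝒜.pull ι).sec univ (un l₀)),
      (∀ s a b, ρ s (a ⊚ b) = ρ s a ⊚ ρ s b) ∧
      (∀ (U : Set S) (hUo : IsOpen U) (hUc : Convex ℝ U) (hUD : U ⊆ D) (τ : 𝒜.Triv U) (s s' : U) a,
        ρ ⟨s.1, hUD s.2⟩ (τ.fl s s' a) = ρ ⟨s'.1, hUD s'.2⟩ a) ∧
      (∀ a, ρ ⟨ι l₀, hl₀⟩ a = 𝒜.inL ι l₀ a) := by
  have hu := univ_sc (S := S')
  obtain ⟨Tr, h1, h2, h3, h4⟩ := 𝒜.exists_mono hloc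
  -- monodromy along paths of `S'`
  have key : ∀ (l : ι ⁻¹' D) (β : Q (⟨l₀, hl₀⟩ : ι ⁻¹' D) l), ∀ a,
      𝒜.inL ι l₀ a ⊚ (𝒜.pull ι).sg (un l₀) (un l.1) = (𝒜.pull ι).sg (un l₀) (un l.1) ⊚
        𝒜.inL ι l.1 (Tr ⟨ι l₀, hl₀⟩ ⟨ι l.1, l.2⟩ (mapE (iD ι D) (iD_mk ι D l₀ hl₀) (iD_ap ι D l) β) a) := by
    let I := {U : Σ U : Set S, 𝒜.Triv U // IsOpen U.1 ∧ Convex ℝ U.1 ∧ U.1 ⊆ D}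
    let W : I → Set (ι ⁻¹' D) := fun U => {x | ι x.1 ∈ U.1.1}
    have hWo : ∀ i, IsOpen (W i) := fun U => U.2.1.preimage (by fun_prop)
    have hWc : ∀ x, ∃ i, x ∈ W i := by
      rintro ⟨s, hs⟩
      obtain ⟨U, h1, h2, h3, h4, ⟨τ⟩⟩ := hloc (ι s) hs
      exact ⟨⟨⟨U, τ⟩, h1, h2, h4⟩, h3⟩
    refine path_induction W hWo hWc (⟨l₀, hl₀⟩ : ι ⁻¹' D) _ ?_ ?_
    · intro a
      have e0 : Tr ⟨ι l₀, hl₀⟩ ⟨ι l₀, hl₀⟩ (mapE (iD ι D) (iD_mk ι D l₀ hl₀) (iD_mk ι D l₀ hl₀)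
        (Path.Homotopic.Quotient.refl _)) a = a := by rw [mapE_refl, h1]
      refine Eq.trans ?_ (congrArg (fun c => (𝒜.pull ι).sg (un l₀) (un l₀) ⊚ 𝒜.inL ι l₀ c) e0.symm)
      rw [sg_self, Q_refl_l]
      exact Q_refl_r _
    · rintro x y γ δ ⟨⟨U, τ⟩, hUo, hUc, hUD⟩ hδ ih a
      have hδ' : ∀ t, ι (δ t).1 ∈ U := hδ
      have hx : ι x.1 ∈ U := by simpa using hδ' 0
      have hy : ι y.1 ∈ U := by simpa using hδ' 1
      let δ' : Path (⟨ι x.1, x.2⟩ : D) ⟨ι y.1, y.2⟩ := δ.map (iD ι D).continuous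
      have e1 : mapE (iD ι D) (iD_mk ι D l₀ hl₀) (iD_ap ι D y)
          (γ ⊚ Path.Homotopic.Quotient.mk δ) =
          mapE (iD ι D) (iD_mk ι D l₀ hl₀) (iD_ap ι D x) γ ⊚
          Path.Homotopic.Quotient.mk δ' := mapE_trans _ _ _ _ _ _
      rw [e1, h2]
      have e2 := h3 U hUo hUc hUD τ ⟨ι x.1, x.2⟩ ⟨ι y.1, y.2⟩ δ'
        (fun t => hδ' t) hx hy
      rw [e2]
      set c := Tr ⟨ι l₀, hl₀⟩ ⟨ι x.1, x.2⟩ (mapE (iD ι D) (iD_mk ι D l₀ hl₀) (iD_ap ι D x) γ) a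
      have e3 : 𝒜.inL ι y.1 (τ.fl ⟨ι y.1, hy⟩ ⟨ι x.1, hx⟩ c) ⊚ (𝒜.pull ι).sg (un y.1) (un x.1) =
        (𝒜.pull ι).sg (un y.1) (un x.1) ⊚ 𝒜.inL ι x.1 c :=
        (τ.pull ι).G2u (hUc.linear_preimage ι.toLinearMap) ⟨y.1, hy⟩ ⟨x.1, hx⟩ c
      apply Q_right_cancel ((𝒜.pull ι).sg (un y.1) (un x.1))
      rw [Q_assoc, Q_assoc, e3, sg_trans, ← Q_assoc, sg_trans]
      exact ih a
  have hloop : ∀ (β : Q (⟨ι l₀, hl₀⟩ : D) ⟨ι l₀, hl₀⟩) a,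
      𝒜.inL ι l₀ (Tr _ _ β a) = 𝒜.inL ι l₀ a := by
    intro β a
    obtain ⟨β', rfl⟩ := hZ β
    have := key ⟨l₀, hl₀⟩ β' a
    rw [sg_self, Q_refl_l, Q_refl_r] at this
    exact this.symm
  have hPC : PathConnectedSpace D := isPathConnected_iff_pathConnectedSpace.1 hDc
  let bet : ∀ s : D, Q (⟨ι l₀, hl₀⟩ : D) s := fun s =>
    Path.Homotopic.Quotient.mk (PathConnectedSpace.somePath _ _)
  let ρ : ∀ s : D, Q (𝒜.bp s) (𝒜.bp s) →
        Q ((𝒜.pull ι).sec univ (un l₀)) ((𝒜.pull ι).sec univ (un l₀)) := fun s a =>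
    𝒜.inL ι l₀ (Tr s ⟨ι l₀, hl₀⟩ (bet s).symm a)
  have hρ : ∀ (s : D) (β : Q (⟨ι l₀, hl₀⟩ : D) s) a,
      ρ s a = 𝒜.inL ι l₀ (Tr s ⟨ι l₀, hl₀⟩ β.symm a) := by
    intro s β a
    rw [← hloop (β ⊚ (bet s).symm), ← h2, ← Q_assoc, Q_inv_l, Q_refl_l]
  refine ⟨ρ, ?_, ?_, ?_⟩
  · intro s a b
    change 𝒜.inL ι l₀ (Tr s ⟨ι l₀, hl₀⟩ (bet s).symm (a ⊚ b)) = _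
    rw [h4]
    exact mapE_trans _ _ _ _ _ _
  · intro U hUo hUc hUD τ s s' a
    have hsc := convex_sc hUc ⟨s.1, s.2⟩
    let p : Path s s' := PathConnectedSpace.somePath s s'
    let δ : Path (⟨s.1, hUD s.2⟩ : D) ⟨s'.1, hUD s'.2⟩ := p.map (inc hUD).continuous
    have e := h3 U hUo hUc hUD τ _ _ δ (fun t => (p t).2) s.2 s'.2
    rw [hρ ⟨s.1, hUD s.2⟩ (bet ⟨s'.1, hUD s'.2⟩ ⊚ (Path.Homotopic.Quotient.mk δ).symm),
      Q_symm_trans, Q_symm_symm, h2, e, Triv.fl_co, Triv.fl_self]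
  · intro a
    rw [hρ ⟨ι l₀, hl₀⟩ (Path.Homotopic.Quotient.refl _), Q_symm_refl, h1]

end Fam
end
end OS


open Set Topology
set_option linter.all false

namespace OS

noncomputable section

/-- the standard path in the unit interval -/
def idP : Path (0 : unitInterval) 1 where
  toFun t := t
  continuous_toFun := continuous_id
  source' := rfl
  target' := rfl

namespace Fam

variable {S : Type*} [NormedAddCommGroup S] [NormedSpace ℝ S] (𝒜 : Fam S)

/-- A continuous choice of paths in the fibers from the base point. -/
structure Strip where
  V : Set (S × ℂ)
  hV : IsOpen V
  hc : Convex ℝ V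
  sub : V ⊆ 𝒜.Tot univ
  κ : (S × ℂ) × unitInterval → ℂ
  hκ : Continuous κ
  k0 : ∀ p, κ (p, 0) = 𝒜.m p.1
  k1 : ∀ p, κ (p, 1) = p.2
  ne : ∀ p ∈ V, ∀ t, 𝒜.A p.1 (κ (p, t)) ≠ 0

theorem exists_strip (hfib : ∀ s, IsPathConnected (𝒜.Fib s)) (x : S × ℂ) (hx : x ∈ 𝒜.Tot univ) :
    ∃ σ : 𝒜.Strip, x ∈ σ.V := by
  obtain ⟨p, hp⟩ := (hfib x.1).joinedIn (𝒜.m x.1) (𝒜.ne x.1) x.2 hx.2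
  let κ : (S × ℂ) × unitInterval → ℂ := fun q =>
    p q.2 + (1 - ((q.2 : ℝ) : ℂ)) * (𝒜.m q.1.1 - 𝒜.m x.1) + ((q.2 : ℝ) : ℂ) * (q.1.2 - x.2)
  have hm := 𝒜.hm
  have hκ : Continuous κ := by fun_prop
  have hO : IsOpen {q : (S × ℂ) × unitInterval | 𝒜.A q.1.1 (κ q) ≠ 0} :=
    isOpen_ne_fun (𝒜.hA.comp (f := fun q : (S × ℂ) × unitInterval => (q.1.1, κ q)) (by fun_prop))
      continuous_const
  have hsub : ({x} : Set (S × ℂ)) ×ˢ (univ : Set unitInterval) ⊆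
      {q : (S × ℂ) × unitInterval | 𝒜.A q.1.1 (κ q) ≠ 0} := by
    rintro ⟨q, t⟩ ⟨hq, -⟩
    obtain rfl : q = x := hq
    have : κ (q, t) = p t := by simp [κ]
    change 𝒜.A q.1 (κ (q, t)) ≠ 0
    rw [this]
    exact hp t
  obtain ⟨u, v, hu, hv, hxu, hIv, huv⟩ := generalized_tube_lemma isCompact_singleton
    isCompact_univ hO hsub
  have hux : u ∈ 𝓝 x := hu.mem_nhds (hxu rfl)
  obtain ⟨ε, hε, hb⟩ := Metric.mem_nhds_iff.1 hux
  have hne : ∀ q ∈ Metric.ball x ε, ∀ t, 𝒜.A q.1 (κ (q, t)) ≠ 0 := fun q hq t =>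
    huv (⟨hb hq, hIv (mem_univ t)⟩ : (q, t) ∈ u ×ˢ v)
  have h1 : ∀ q, κ (q, 1) = q.2 := fun q => by simp [κ]
  refine ⟨⟨Metric.ball x ε, Metric.isOpen_ball, convex_ball x ε, ?_, κ, hκ, ?_, h1, hne⟩,
    Metric.mem_ball_self hε⟩
  · intro q hq
    refine ⟨trivial, ?_⟩
    have := hne q hq 1
    rwa [h1] at this
  · intro q
    simp [κ]

variable {𝒜}

/-- The path of a strip at a point. -/
def Strip.pth (σ : 𝒜.Strip) (p : S × ℂ) (hp : p ∈ σ.V) :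
    Path (𝒜.bp p.1) (⟨p.2, (σ.sub hp).2⟩ : 𝒜.Fib p.1) where
  toFun t := ⟨σ.κ (p, t), σ.ne p hp t⟩
  continuous_toFun := by
    have := σ.hκ
    fun_prop
  source' := Subtype.ext (σ.k0 p)
  target' := Subtype.ext (σ.k1 p)

def Strip.kp (σ : 𝒜.Strip) (p : S × ℂ) (hp : p ∈ σ.V) :
    Q (𝒜.bp p.1) (⟨p.2, (σ.sub hp).2⟩ : 𝒜.Fib p.1) := Path.Homotopic.Quotient.mk (σ.pth p hp)

/-- Moving a strip path along a path in the total space. -/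
theorem Strip.move (σ : 𝒜.Strip) {U : Set S} [SimplyConnectedSpace U] (x y : 𝒜.Tot U)
    (ℓ : Path x y) (hℓ : ∀ t, (ℓ t).1 ∈ σ.V) (hx : x.1 ∈ σ.V) (hy : y.1 ∈ σ.V) :
    mapE (𝒜.inF (𝒜.bs x)) (𝒜.inF_bp _) (𝒜.inF_fc x) (σ.kp x.1 hx) ⊚
        Path.Homotopic.Quotient.mk ℓ =
      𝒜.sg (𝒜.bs x) (𝒜.bs y) ⊚
        mapE (𝒜.inF (𝒜.bs y)) (𝒜.inF_bp _) (𝒜.inF_fc y) (σ.kp y.1 hy) := by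
  have hκ := σ.hκ
  let f : C(unitInterval, 𝒜.Tot U) := ⟨fun u => ⟨(x.1.1, σ.κ (x.1, u)), x.2.1, σ.ne _ hx u⟩,
    by fun_prop⟩
  let g : C(unitInterval, 𝒜.Tot U) := ⟨fun u => ⟨(y.1.1, σ.κ (y.1, u)), y.2.1, σ.ne _ hy u⟩,
    by fun_prop⟩
  let H : f.Homotopy g :=
    { toFun := fun q => ⟨((ℓ q.1).1.1, σ.κ ((ℓ q.1).1, q.2)), (ℓ q.1).2.1, σ.ne _ (hℓ q.1) q.2⟩
      continuous_toFun := by fun_prop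
      map_zero_left := fun u => by simp [f]
      map_one_left := fun u => by simp [g] }
  let b : Path (𝒜.bs x) (𝒜.bs y) :=
    { toFun := fun t => 𝒜.bs (ℓ t)
      continuous_toFun := by
        unfold Fam.bs
        fun_prop
      source' := by simp
      target' := by simp }
  let u : Path (𝒜.sec U (𝒜.bs x)) (𝒜.sec U (𝒜.bs y)) := b.map (𝒜.sec U).continuous
  have hu : Path.Homotopic.Quotient.mk u = 𝒜.sg (𝒜.bs x) (𝒜.bs y) :=
    𝒜.sg_eq (Path.Homotopic.Quotient.mk b)
  have f0 : f 0 = 𝒜.sec U (𝒜.bs x) := Subtype.ext (Prod.ext rfl (σ.k0 _))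
  have f1 : f 1 = x := Subtype.ext (Prod.ext rfl (σ.k1 _))
  have g0 : g 0 = 𝒜.sec U (𝒜.bs y) := Subtype.ext (Prod.ext rfl (σ.k0 _))
  have g1 : g 1 = y := Subtype.ext (Prod.ext rfl (σ.k1 _))
  have key := mapE_htpy H f0 f1 g0 g1 u ℓ (fun t => Subtype.ext (Prod.ext rfl (σ.k0 _)))
    (fun t => Subtype.ext (Prod.ext rfl (σ.k1 _))) (Path.Homotopic.Quotient.mk idP)
  have e1 : mapE f f0 f1 (Path.Homotopic.Quotient.mk idP) =
      mapE (𝒜.inF (𝒜.bs x)) (𝒜.inF_bp _) (𝒜.inF_fc x) (σ.kp x.1 hx) := by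
    let px : Path (𝒜.sec U (𝒜.bs x)) x := ⟨f, f0, f1⟩
    exact (mapE_eq_of f f0 f1 idP px (fun t => rfl)).trans
      (mapE_eq_of (𝒜.inF (𝒜.bs x)) (𝒜.inF_bp _) (𝒜.inF_fc x) (σ.pth x.1 hx) px
        (fun t => rfl)).symm
  have e2 : mapE g g0 g1 (Path.Homotopic.Quotient.mk idP) =
      mapE (𝒜.inF (𝒜.bs y)) (𝒜.inF_bp _) (𝒜.inF_fc y) (σ.kp y.1 hy) := by
    let px : Path (𝒜.sec U (𝒜.bs y)) y := ⟨g, g0, g1⟩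
    exact (mapE_eq_of g g0 g1 idP px (fun t => rfl)).trans
      (mapE_eq_of (𝒜.inF (𝒜.bs y)) (𝒜.inF_bp _) (𝒜.inF_fc y) (σ.pth y.1 hy) px
        (fun t => rfl)).symm
  rw [e1, e2, hu] at key
  exact key

/-- Paths of a strip inside a fiber. -/
theorem Strip.slice (σ : 𝒜.Strip) {s : S} (x y : 𝒜.Fib s) (δ : Path x y)
    (hδ : ∀ t, (s, (δ t).1) ∈ σ.V) (hx : (s, x.1) ∈ σ.V) (hy : (s, y.1) ∈ σ.V) :
    σ.kp (s, x.1) hx ⊚ Path.Homotopic.Quotient.mk δ = σ.kp (s, y.1) hy := by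
  have hκ := σ.hκ
  let f : C(unitInterval, 𝒜.Fib s) := ⟨fun u => ⟨σ.κ ((s, x.1), u), σ.ne _ hx u⟩, by fun_prop⟩
  let g : C(unitInterval, 𝒜.Fib s) := ⟨fun u => ⟨σ.κ ((s, y.1), u), σ.ne _ hy u⟩, by fun_prop⟩
  let H : f.Homotopy g :=
    { toFun := fun q => ⟨σ.κ ((s, (δ q.1).1), q.2), σ.ne _ (hδ q.1) q.2⟩
      continuous_toFun := by fun_prop
      map_zero_left := fun u => by simp [f]
      map_one_left := fun u => by simp [g] }
  have f0 : f 0 = 𝒜.bp s := Subtype.ext (σ.k0 _)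
  have f1 : f 1 = x := Subtype.ext (σ.k1 _)
  have g0 : g 0 = 𝒜.bp s := Subtype.ext (σ.k0 _)
  have g1 : g 1 = y := Subtype.ext (σ.k1 _)
  have key := mapE_htpy H f0 f1 g0 g1 (Path.refl _) δ (fun t => Subtype.ext (σ.k0 _))
    (fun t => Subtype.ext (σ.k1 _)) (Path.Homotopic.Quotient.mk idP)
  rw [Path.Homotopic.Quotient.mk_refl, Q_refl_l] at key
  have e1 : mapE f f0 f1 (Path.Homotopic.Quotient.mk idP) = σ.kp (s, x.1) hx :=
    mapE_eq_of _ _ _ _ _ (fun t => rfl)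
  have e2 : mapE g g0 g1 (Path.Homotopic.Quotient.mk idP) = σ.kp (s, y.1) hy :=
    mapE_eq_of _ _ _ _ _ (fun t => rfl)
  rw [e1, e2] at key
  exact key

end Fam
end
end OS


open Set Topology
set_option linter.all false

namespace OS

noncomputable section

namespace Fam

variable {S : Type*} [NormedAddCommGroup S] [NormedSpace ℝ S] {𝒜 : Fam S}

/-- Difference of two strips. -/
def dl (σ σ' : 𝒜.Strip) (p : S × ℂ) (h : p ∈ σ.V) (h' : p ∈ σ'.V) : Q (𝒜.bp p.1) (𝒜.bp p.1) :=
  σ.kp p h ⊚ (σ'.kp p h').symm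

theorem dl_move (σ σ' : 𝒜.Strip) {U : Set S} (τ : 𝒜.Triv U) (hUc : Convex ℝ U) (x y : 𝒜.Tot U)
    (ℓ : Path x y) (hℓ : ∀ t, (ℓ t).1 ∈ σ.V ∩ σ'.V) (hx : x.1 ∈ σ.V) (hy : y.1 ∈ σ.V)
    (hx' : x.1 ∈ σ'.V) (hy' : y.1 ∈ σ'.V) :
    τ.fl (𝒜.bs x) (𝒜.bs y) (dl σ σ' y.1 hy hy') = dl σ σ' x.1 hx hx' := by
  have hsc := convex_sc hUc ⟨x.1.1, x.2.1⟩
  have h1 := σ.move x y ℓ (fun t => (hℓ t).1) hx hy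
  have h2 := σ'.move x y ℓ (fun t => (hℓ t).2) hx' hy'
  have e : ∀ (x : 𝒜.Tot U) (hx : x.1 ∈ σ.V) (hx' : x.1 ∈ σ'.V),
      mapE (𝒜.inF (𝒜.bs x)) (𝒜.inF_bp _) (𝒜.inF_bp _) (dl σ σ' x.1 hx hx') =
      mapE (𝒜.inF (𝒜.bs x)) (𝒜.inF_bp _) (𝒜.inF_fc x) (σ.kp x.1 hx) ⊚
      (mapE (𝒜.inF (𝒜.bs x)) (𝒜.inF_bp _) (𝒜.inF_fc x) (σ'.kp x.1 hx')).symm := by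
    intro x hx hx'
    refine (mapE_trans _ _ (𝒜.inF_fc x) _ _ _).trans (congrArg _ (mapE_symm _ _ _ _))
  have h3 : mapE (𝒜.inF (𝒜.bs x)) (𝒜.inF_bp _) (𝒜.inF_bp _) (dl σ σ' x.1 hx hx') ⊚
      𝒜.sg (𝒜.bs x) (𝒜.bs y) = 𝒜.sg (𝒜.bs x) (𝒜.bs y) ⊚
      mapE (𝒜.inF (𝒜.bs y)) (𝒜.inF_bp _) (𝒜.inF_bp _) (dl σ σ' y.1 hy hy') := by
    rw [e, e, ← Q_assoc, ← h1]
    apply Q_right_cancel (mapE (𝒜.inF (𝒜.bs y)) (𝒜.inF_bp _) (𝒜.inF_fc y) (σ'.kp y.1 hy'))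
    simp only [Q_assoc, Q_inv_l, Q_refl_r, ← h2]
    rw [Q_cancel_l]
  exact τ.fl_eq hUc subset_rfl (𝒜.bs x) (𝒜.bs y) _ _ h3

/-- segment path -/
theorem seg_path {E : Type*} [NormedAddCommGroup E] [NormedSpace ℝ E] {N X : Set E} (hN : Convex ℝ N)
    (h : N ⊆ X) (x y : X) (hx : x.1 ∈ N) (hy : y.1 ∈ N) : ∃ p : Path x y, ∀ t, (p t).1 ∈ N :=
  joined_path h x y ((hN.isPathConnected ⟨x.1, hx⟩).joinedIn _ hx _ hy)

theorem lemmaC {D : Set S} (hloc : 𝒜.LocTriv D)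
    (hthin : ∀ V : Set (S × ℂ), V ⊆ 𝒜.Tot univ → IsOpen V → Convex ℝ V → V.Nonempty →
      IsPathConnected (V ∩ 𝒜.Tot D)) (hfib : ∀ s, IsPathConnected (𝒜.Fib s))
    {Γ : Type*} [Group Γ] (ρ : ∀ s : D, Q (𝒜.bp s) (𝒜.bp s) → Γ)
    (hρ : ∀ s a b, ρ s (a ⊚ b) = ρ s a * ρ s b)
    (hτ : ∀ (U : Set S) (hUo : IsOpen U) (hUc : Convex ℝ U) (hUD : U ⊆ D) (τ : 𝒜.Triv U)
      (s s' : U) a, ρ ⟨s.1, hUD s.2⟩ (τ.fl s s' a) = ρ ⟨s'.1, hUD s'.2⟩ a)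
    (s₀ : D) (a : Q (𝒜.bp s₀) (𝒜.bp s₀))
    (ha : mapE (𝒜.inF (un s₀.1)) (𝒜.inF_bp (un s₀.1)) (𝒜.inF_bp (un s₀.1)) a =
      Path.Homotopic.Quotient.refl _) : ρ s₀ a = 1 := by
  classical
  have ρ1 : ∀ s, ρ s (Path.Homotopic.Quotient.refl _) = 1 := by
    intro s
    have := hρ s (Path.Homotopic.Quotient.refl _) (Path.Homotopic.Quotient.refl _)
    rw [Q_refl_l] at this
    exact left_eq_mul.1 this
  let g : ∀ (σ σ' : 𝒜.Strip), (σ.V ∩ σ'.V ∩ 𝒜.Tot D : Set (S × ℂ)) → Γ := fun σ σ' p =>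
    ρ ⟨p.1.1, p.2.2.1⟩ (dl σ σ' p.1 p.2.1.1 p.2.1.2)
  have hg : ∀ σ σ' p q, g σ σ' p = g σ σ' q := by
    intro σ σ' p q
    have hlc : IsLocallyConstant (g σ σ') := by
      rw [IsLocallyConstant.iff_eventually_eq]
      intro p
      obtain ⟨U, hUo, hUc, hpU, hUD, ⟨τ⟩⟩ := hloc p.1.1 p.2.2.1
      have hO : IsOpen (σ.V ∩ σ'.V ∩ (Prod.fst ⁻¹' U)) :=
        (σ.hV.inter σ'.hV).inter (hUo.preimage continuous_fst)
      obtain ⟨ε, hε, hb⟩ := Metric.mem_nhds_iff.1 (hO.mem_nhds ⟨p.2.1, hpU⟩)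
      have : ∀ᶠ y in 𝓝 p, y.1 ∈ Metric.ball p.1 ε :=
        continuous_subtype_val.continuousAt.eventually_mem (Metric.ball_mem_nhds _ hε)
      filter_upwards [this] with y hy
      have hN : Metric.ball p.1 ε ⊆ 𝒜.Tot U := fun z hz => ⟨(hb hz).2, (σ.sub (hb hz).1.1).2⟩
      have hpN := Metric.mem_ball_self (x := p.1) hε
      let x' : 𝒜.Tot U := ⟨p.1, hN hpN⟩
      let y' : 𝒜.Tot U := ⟨y.1, hN hy⟩
      obtain ⟨ℓ, hℓ⟩ := seg_path (convex_ball p.1 ε) hN x' y' hpN hy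
      have key := dl_move σ σ' τ hUc x' y' ℓ (fun t => (hb (hℓ t)).1) p.2.1.1 y.2.1.1
        p.2.1.2 y.2.1.2
      have := hτ U hUo hUc hUD τ (𝒜.bs x') (𝒜.bs y') (dl σ σ' y.1 y.2.1.1 y.2.1.2)
      rw [key] at this
      exact this.symm
    have hpc : IsPathConnected (σ.V ∩ σ'.V ∩ 𝒜.Tot D) :=
      hthin _ (fun x hx => σ.sub hx.1) (σ.hV.inter σ'.hV) (σ.hc.inter σ'.hc) ⟨p.1, p.2.1⟩
    have : PathConnectedSpace (σ.V ∩ σ'.V ∩ 𝒜.Tot D : Set (S × ℂ)) :=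
      isPathConnected_iff_pathConnectedSpace.1 hpc
    exact hlc.apply_eq_of_preconnectedSpace p q
  let G : 𝒜.Strip → 𝒜.Strip → Γ := fun σ σ' =>
    if h : Nonempty (σ.V ∩ σ'.V ∩ 𝒜.Tot D : Set (S × ℂ)) then g σ σ' h.some else 1
  have hG : ∀ σ σ' p, G σ σ' = g σ σ' p := by
    intro σ σ' p
    have h : Nonempty (σ.V ∩ σ'.V ∩ 𝒜.Tot D : Set (S × ℂ)) := ⟨p⟩
    change (if h : Nonempty (σ.V ∩ σ'.V ∩ 𝒜.Tot D : Set (S × ℂ)) then g σ σ' h.some else 1) = _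
    rw [dif_pos h]
    exact hg _ _ _ _
  have hco : ∀ (σ τ υ : 𝒜.Strip) x, x ∈ σ.V → x ∈ τ.V → x ∈ υ.V → G σ τ * G τ υ = G σ υ := by
    intro σ τ υ x h1 h2 h3
    obtain ⟨p, ⟨⟨hp1, hp2⟩, hp3⟩, hpD⟩ := (hthin (σ.V ∩ τ.V ∩ υ.V) (fun x hx => σ.sub hx.1.1)
      ((σ.hV.inter τ.hV).inter υ.hV) ((σ.hc.inter τ.hc).inter υ.hc) ⟨x, ⟨h1, h2⟩, h3⟩).nonempty
    rw [hG σ τ ⟨p, ⟨hp1, hp2⟩, hpD⟩, hG τ υ ⟨p, ⟨hp2, hp3⟩, hpD⟩, hG σ υ ⟨p, ⟨hp1, hp3⟩, hpD⟩]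
    change ρ _ _ * ρ _ _ = ρ _ _
    rw [← hρ]
    congr 1
    unfold dl
    rw [Q_assoc, Q_cancel_l]
  have hself : ∀ (σ : 𝒜.Strip) x, x ∈ σ.V → G σ σ = 1 := by
    intro σ x h
    have := hco σ σ σ x h h h
    exact mul_eq_left.1 this
  choose I hI using fun x : 𝒜.Tot univ => exists_strip 𝒜 hfib x.1 x.2
  let T : ∀ (_ : 𝒜.Strip) (x y : 𝒜.Tot univ), Γ → Γ := fun σ x y f => f * (G (I x) σ * G σ (I y))
  have k1 : ∀ (σ : 𝒜.Strip) (x : 𝒜.Tot univ), x.1 ∈ σ.V → ∀ f, T σ x x f = f := by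
    intro σ x hx f
    change f * (G (I x) σ * G σ (I x)) = f
    rw [hco _ _ _ x.1 (hI x) hx (hI x), hself _ x.1 (hI x), mul_one]
  have k2 : ∀ (σ : 𝒜.Strip) (x y z : 𝒜.Tot univ), x.1 ∈ σ.V → y.1 ∈ σ.V → z.1 ∈ σ.V → ∀ f,
      T σ y z (T σ x y f) = T σ x z f := by
    intro σ x y z hx hy hz f
    change f * (G (I x) σ * G σ (I y)) * (G (I y) σ * G σ (I z)) = f * (G (I x) σ * G σ (I z))
    have : G σ (I y) * G (I y) σ = 1 := by
      rw [hco _ _ _ y.1 hy (hI y) hy, hself _ y.1 hy]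
    calc _ = f * (G (I x) σ * (G σ (I y) * G (I y) σ) * G σ (I z)) := by group
      _ = _ := by rw [this, mul_one]
  have k3 : ∀ (σ τ : 𝒜.Strip) (x y : 𝒜.Tot univ), x.1 ∈ σ.V → y.1 ∈ σ.V → x.1 ∈ τ.V → y.1 ∈ τ.V →
      ∀ f, T σ x y f = T τ x y f := by
    intro σ τ x y hx hy hx' hy' f
    change f * (G (I x) σ * G σ (I y)) = f * (G (I x) τ * G τ (I y))
    have : G σ τ * G τ σ = 1 := by
      rw [hco _ _ _ y.1 hy hy' hy, hself _ y.1 hy]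
    rw [← hco (I x) σ τ x.1 (hI x) hx hx', ← hco τ σ (I y) y.1 hy' hy (hI y)]
    calc _ = f * (G (I x) σ * 1 * G σ (I y)) := by rw [mul_one]
      _ = _ := by rw [← this]; group
  obtain ⟨Tr, t1, t2, t3⟩ := exists_transport (F := fun _ : 𝒜.Tot univ => Γ)
    (fun σ : 𝒜.Strip => {x : 𝒜.Tot univ | x.1 ∈ σ.V}) T
    (fun σ => σ.hV.preimage continuous_subtype_val) (fun x => ⟨I x, hI x⟩) k1 k2 k3
  -- the fiber
  let x₀ : 𝒜.Fib s₀ := 𝒜.bp s₀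
  let jj : ∀ z : 𝒜.Fib s₀, 𝒜.Tot univ := fun z => 𝒜.inF (un s₀.1) z
  let jm : C(𝒜.Fib s₀.1, 𝒜.Tot univ) := 𝒜.inF (un s₀.1)
  have hj : ∀ z, jm z = jj z := fun z => rfl
  have hjV : ∀ z : 𝒜.Fib s₀, (s₀.1, z.1) ∈ (I (jj z)).V := fun z => hI (jj z)
  let kk : ∀ z : 𝒜.Fib s₀, Q (𝒜.bp s₀) z := fun z => (I (jj z)).kp (s₀.1, z.1) (hjV z)
  have key : ∀ (z : 𝒜.Fib s₀) (δ : Q x₀ z),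
      Tr (jj x₀) (jj z) (mapE jm (hj _) (hj _) δ) 1 =
        ρ s₀ (kk x₀ ⊚ δ ⊚ (kk z).symm) := by
    refine path_induction (fun σ : 𝒜.Strip => {z : 𝒜.Fib s₀ | (s₀.1, z.1) ∈ σ.V})
      (fun σ => σ.hV.preimage (by fun_prop)) (fun z => ⟨I (jj z), hjV z⟩) x₀ _ ?_ ?_
    · rw [mapE_refl, t1, Q_refl_r, Q_inv_r, ρ1]
    · intro x y γ δ σ hδ ih
      have hδ' : ∀ t, (s₀.1, (δ t).1) ∈ σ.V := hδ
      have hx : (s₀.1, x.1) ∈ σ.V := by simpa using hδ' 0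
      have hy : (s₀.1, y.1) ∈ σ.V := by simpa using hδ' 1
      let δ' : Path (jj x) (jj y) := δ.map jm.continuous
      have e1 : mapE jm (hj x₀) (hj y)
          (γ ⊚ Path.Homotopic.Quotient.mk δ) = mapE jm (hj x₀) (hj x) γ ⊚ Path.Homotopic.Quotient.mk δ' :=
        mapE_trans _ _ _ _ _ _
      have e2 := t3 σ (jj x) (jj y) δ' hδ'
      refine (congrArg (fun q => Tr (jj x₀) (jj y) q 1) e1).trans ?_
      rw [t2]
      refine (e2 _).trans ?_
      rw [ih]
      change ρ s₀ _ * (G (I (jj x)) σ * G σ (I (jj y))) = _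
      rw [hG (I (jj x)) σ ⟨(s₀.1, x.1), ⟨hjV x, hx⟩, s₀.2, x.2⟩,
        hG σ (I (jj y)) ⟨(s₀.1, y.1), ⟨hy, hjV y⟩, s₀.2, y.2⟩]
      change ρ s₀ _ * (ρ s₀ _ * ρ s₀ _) = _
      rw [← hρ, ← hρ]
      congr 1
      have e3 := σ.slice x y δ hδ' hx hy
      change kk x₀ ⊚ γ ⊚ (kk x).symm ⊚ (kk x ⊚ (σ.kp (s₀.1, x.1) hx).symm ⊚
        (σ.kp (s₀.1, y.1) hy ⊚ (kk y).symm)) = kk x₀ ⊚ (γ ⊚ Path.Homotopic.Quotient.mk δ) ⊚ (kk y).symm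
      rw [← e3]
      simp only [Q_assoc]
      rw [Q_cancel_l, Q_cancel_l]
  have h1 := key x₀ a
  have h2 : Tr (jj x₀) (jj x₀) (mapE jm (hj _) (hj _) a) 1 = 1 := by
    refine (congrArg (fun q => Tr (jj x₀) (jj x₀) q 1) ha).trans ?_
    exact t1 _ _
  rw [h2, hρ, hρ] at h1
  have h3 : ρ s₀ (kk x₀).symm * ρ s₀ (kk x₀) = 1 := by
    rw [← hρ, Q_inv_l, ρ1]
  have h4 : ρ s₀ (kk x₀).symm = (ρ s₀ (kk x₀))⁻¹ := eq_inv_of_mul_eq_one_left h3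
  rw [h4] at h1
  have h5 := h1.symm
  rw [mul_inv_eq_one] at h5
  exact mul_eq_left.1 h5

end Fam
end
end OS


open Set Topology
set_option linter.all false

namespace OS

noncomputable section

namespace Fam

variable {S : Type*} [NormedAddCommGroup S] [NormedSpace ℝ S] (𝒜 : Fam S)
variable {S' : Type*} [NormedAddCommGroup S'] [NormedSpace ℝ S'] (ι : S' →L[ℝ] S)

theorem lemmaB {D : Set S} (hloc : 𝒜.LocTriv D)
    (hthin : ∀ V : Set (S × ℂ), V ⊆ 𝒜.Tot univ → IsOpen V → Convex ℝ V → V.Nonempty →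
      IsPathConnected (V ∩ 𝒜.Tot D)) (hfib : ∀ s, IsPathConnected (𝒜.Fib s))
    (hDc : IsPathConnected D) (l₀ : S') (hl₀ : ι l₀ ∈ D)
    (hZ : ∀ β : Q (⟨ι l₀, hl₀⟩ : D) ⟨ι l₀, hl₀⟩, ∃ β' : Q (⟨l₀, hl₀⟩ : ι ⁻¹' D) ⟨l₀, hl₀⟩,
      mapE (iD ι D) (iD_mk ι D l₀ hl₀) (iD_mk ι D l₀ hl₀) β' = β)
    (a : Q (𝒜.bp (ι l₀)) (𝒜.bp (ι l₀)))
    (ha : mapE (𝒜.inF (un (ι l₀))) (𝒜.inF_bp (un (ι l₀))) (𝒜.inF_bp (un (ι l₀))) a =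
      Path.Homotopic.Quotient.refl _) : 𝒜.inL ι l₀ a = Path.Homotopic.Quotient.refl _ := by
  obtain ⟨ρ, h1, h2, h3⟩ := 𝒜.exists_rho ι hloc hDc l₀ hl₀ hZ
  let X := (𝒜.pull ι).Tot univ
  let b : X := (𝒜.pull ι).sec univ (un l₀)
  have key := lemmaC hloc hthin hfib (Γ := (FundamentalGroup X b)ᵐᵒᵖ)
    (fun s a => MulOpposite.op (ρ s a)) (fun s a b => by rw [h1]; rfl)
    (fun U hUo hUc hUD τ s s' a => by rw [h2 U hUo hUc hUD τ s s' a]) ⟨ι l₀, hl₀⟩ a ha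
  have := MulOpposite.op_injective key
  exact (h3 a).symm.trans this

theorem mapE_null {X Y Z : Type*} [TopologicalSpace X] [TopologicalSpace Y] [TopologicalSpace Z]
    [SimplyConnectedSpace Z] (f : C(X, Y)) (p : C(X, Z)) (g : C(Z, Y)) (h : ∀ x, f x = g (p x))
    {x : X} {y : Y} (hx : f x = y) (γ : Q x x) :
    mapE f hx hx γ = Path.Homotopic.Quotient.refl _ := by
  subst hx
  obtain rfl : f = g.comp p := ContinuousMap.ext h
  have h1 := mapE_mapE p g (x := x) (y := x) (x' := p x) (y' := p x) (x'' := g (p x))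
    (y'' := g (p x)) rfl rfl rfl rfl γ
  exact h1.symm.trans (mapE_loop_sc g rfl _)

end Fam

section OSabs

variable (P R : ℂ → ℂ → ℂ)

/-- Family of the two curves, one translated by `t`. -/
def fam2 (hP : Continuous fun q : ℂ × ℂ => P q.1 q.2) (hR : Continuous fun q : ℂ × ℂ => R q.1 q.2)
    (m : ℂ × ℂ → ℂ) (hm : Continuous m) (mP : ∀ s, P s.1 (m s) ≠ 0)
    (mR : ∀ s, R s.1 (m s - s.2) ≠ 0) : Fam (ℂ × ℂ) where
  A s z := P s.1 z * R s.1 (z - s.2)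
  hA := (hP.comp (f := fun q : (ℂ × ℂ) × ℂ => (q.1.1, q.2)) (by fun_prop)).mul
    (hR.comp (f := fun q : (ℂ × ℂ) × ℂ => (q.1.1, q.2 - q.1.2)) (by fun_prop))
  m := m
  hm := hm
  ne s := mul_ne_zero (mP s) (mR s)

/-- the inclusion of the line `t = 0` -/
def iL : ℂ →L[ℝ] ℂ × ℂ := ContinuousLinearMap.inl ℝ ℂ ℂ

theorem iL_ap (w : ℂ) : iL w = (w, 0) := rfl

variable (hP : Continuous fun q : ℂ × ℂ => P q.1 q.2) (hR : Continuous fun q : ℂ × ℂ => R q.1 q.2)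
    (m : ℂ × ℂ → ℂ) (hm : Continuous m) (mP : ∀ s, P s.1 (m s) ≠ 0)
    (mR : ∀ s, R s.1 (m s - s.2) ≠ 0)

/-- complement of a curve -/
def cmp (P : ℂ → ℂ → ℂ) : Set (ℂ × ℂ) := {p | P p.1 p.2 ≠ 0}

theorem os_abs (D : Set (ℂ × ℂ)) (hD : IsOpen D) 
    (hloc : (fam2 P R hP hR m hm mP mR).LocTriv D)
    (hthin : ∀ V : Set ((ℂ × ℂ) × ℂ), V ⊆ (fam2 P R hP hR m hm mP mR).Tot univ → IsOpen V →
      Convex ℝ V → V.Nonempty → IsPathConnected (V ∩ (fam2 P R hP hR m hm mP mR).Tot D))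
    (hthin' : ∀ V : Set (ℂ × ℂ), V ⊆ ((fam2 P R hP hR m hm mP mR).pull iL).Tot univ → IsOpen V →
      Convex ℝ V → V.Nonempty →
      IsPathConnected (V ∩ ((fam2 P R hP hR m hm mP mR).pull iL).Tot (iL ⁻¹' D)))
    (hfib : ∀ s, IsPathConnected ((fam2 P R hP hR m hm mP mR).Fib s))
    (hDc : IsPathConnected D) (w₀ : ℂ) (hl₀ : iL w₀ ∈ D)
    (hZ : ∀ β : Q (⟨iL w₀, hl₀⟩ : D) ⟨iL w₀, hl₀⟩, ∃ β' : Q (⟨w₀, hl₀⟩ : iL ⁻¹' D) ⟨w₀, hl₀⟩,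
      mapE (Fam.iD iL D) (Fam.iD_mk iL D w₀ hl₀) (Fam.iD_mk iL D w₀ hl₀) β' = β) 
    (b : ℂ × ℂ) (hb : b = (w₀, m (w₀, 0))) (b1 : P b.1 b.2 ≠ 0) (b2 : R b.1 b.2 ≠ 0)
    (X : Set (ℂ × ℂ)) (hX : X = {p | P p.1 p.2 ≠ 0 ∧ R p.1 p.2 ≠ 0}) (bX : b ∈ X) :
    Nonempty (FundamentalGroup X ⟨b, bX⟩ ≃* FundamentalGroup (cmp P) ⟨b, b1⟩ ×
      FundamentalGroup (cmp R) ⟨b, b2⟩) := by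
  subst hb hX
  set 𝒜 := fam2 P R hP hR m hm mP mR with h𝒜
  let L := (𝒜.pull iL).Tot univ
  let T := 𝒜.Tot univ
  let X : Set (ℂ × ℂ) := {p | P p.1 p.2 ≠ 0 ∧ R p.1 p.2 ≠ 0}
  let bL : L := (𝒜.pull iL).sec univ (Fam.un w₀)
  let bT : T := 𝒜.sec univ (Fam.un (w₀, 0))
  let bP : cmp P := ⟨(w₀, m (w₀, 0)), b1⟩
  let bR : cmp R := ⟨(w₀, m (w₀, 0)), b2⟩
  have hA : ∀ s z, 𝒜.A s z = P s.1 z * R s.1 (z - s.2) := fun _ _ => rfl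
  have hA' : ∀ w z, (𝒜.pull iL).A w z = P w z * R w (z - 0) := fun _ _ => rfl
  have hPT : ∀ x : T, P x.1.1.1 x.1.2 ≠ 0 := fun x => left_ne_zero_of_mul x.2.2
  have hRT : ∀ x : T, R x.1.1.1 (x.1.2 - x.1.1.2) ≠ 0 := fun x => right_ne_zero_of_mul x.2.2
  have hPL : ∀ x : L, P x.1.1 x.1.2 ≠ 0 := fun x => left_ne_zero_of_mul x.2.2
  have hRL : ∀ x : L, R x.1.1 x.1.2 ≠ 0 := fun x => by
    have h : R x.1.1 (x.1.2 - 0) ≠ 0 := right_ne_zero_of_mul x.2.2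
    rwa [sub_zero] at h
  let q₁ : C(L, cmp P) := ⟨fun x => ⟨x.1, hPL x⟩, by fun_prop⟩
  let q₂ : C(L, cmp R) := ⟨fun x => ⟨x.1, hRL x⟩, by fun_prop⟩
  let p₁ : C(T, cmp P) := ⟨fun x => ⟨(x.1.1.1, x.1.2), hPT x⟩, by fun_prop⟩
  let p₂ : C(T, cmp R) := ⟨fun x => ⟨(x.1.1.1, x.1.2 - x.1.1.2), hRT x⟩, by fun_prop⟩
  have mR' : ∀ w, R w (m (w, 0)) ≠ 0 := fun w => by simpa using mR (w, 0)
  let J₁ : C(cmp P, T) := ⟨fun x => ⟨((x.1.1, x.1.2 - m (x.1.1, 0)), x.1.2), mem_univ _,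
    by
      rw [hA]
      refine mul_ne_zero x.2 ?_
      have := mR' x.1.1
      simpa using this⟩, by fun_prop⟩
  let J₂ : C(cmp R, T) := ⟨fun x => ⟨((x.1.1, m (x.1.1, 0) - x.1.2), m (x.1.1, 0)), mem_univ _,
    by
      rw [hA]
      refine mul_ne_zero (mP (x.1.1, 0)) ?_
      have : R x.1.1 x.1.2 ≠ 0 := x.2
      simpa using this⟩, by fun_prop⟩
  let iLT : C(L, T) := ⟨fun x => ⟨((x.1.1, 0), x.1.2), mem_univ _, x.2.2⟩, by fun_prop⟩
  let sP : C(ℂ, cmp P) := ⟨fun w => ⟨(w, m (w, 0)), mP (w, 0)⟩, by fun_prop⟩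
  let sR : C(ℂ, cmp R) := ⟨fun w => ⟨(w, m (w, 0)), mR' w⟩, by fun_prop⟩
  let fP : C(cmp P, ℂ) := ⟨fun x => x.1.1, by fun_prop⟩
  let fR : C(cmp R, ℂ) := ⟨fun x => x.1.1, by fun_prop⟩
  have eJ1 : J₁ bP = bT := Subtype.ext (Prod.ext (Prod.ext rfl (sub_self _)) rfl)
  have eJ2 : J₂ bR = bT := Subtype.ext (Prod.ext (Prod.ext rfl (sub_self _)) rfl)
  have ep1 : p₁ bT = bP := rfl
  have ep2 : p₂ bT = bR := Subtype.ext (Prod.ext rfl (sub_zero _))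
  have eq1 : q₁ bL = bP := rfl
  have eq2 : q₂ bL = bR := rfl
  have eiT : iLT bL = bT := rfl
  have hDl : IsOpen (iL ⁻¹' D) := hD.preimage iL.continuous
  -- compatibilities
  have c1 : ∀ γ : Q bL bL, mapE p₁ ep1 ep1 (mapE iLT eiT eiT γ) = mapE q₁ eq1 eq1 γ := by
    intro γ
    rw [mapE_mapE]
    exact mapE_congr _ _ (fun x => rfl) _ _ _
  have c2 : ∀ γ : Q bL bL, mapE p₂ ep2 ep2 (mapE iLT eiT eiT γ) = mapE q₂ eq2 eq2 γ := by
    intro γ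
    exact (mapE_mapE _ _ _ _ _ _ _).trans (mapE_congr (p₂.comp iLT) q₂
      (fun x => Subtype.ext (Prod.ext rfl (sub_zero _))) _ _ γ)
  have d11 : ∀ c, mapE p₁ ep1 ep1 (mapE J₁ eJ1 eJ1 c) = c := by
    intro c
    rw [mapE_mapE]
    exact mapE_id _ (fun x => rfl) _ _ _
  have d22 : ∀ c, mapE p₂ ep2 ep2 (mapE J₂ eJ2 eJ2 c) = c := by
    intro c
    rw [mapE_mapE]
    exact mapE_id _ (fun x => Subtype.ext (Prod.ext rfl (sub_sub_cancel _ _))) _ _ _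
  have d12 : ∀ c, mapE p₁ ep1 ep1 (mapE J₂ eJ2 eJ2 c) = Path.Homotopic.Quotient.refl _ := by
    intro c
    exact (mapE_mapE _ _ _ _ _ _ _).trans (Fam.mapE_null (p₁.comp J₂) fR sP (fun x => rfl) _ c)
  have d21 : ∀ c, mapE p₂ ep2 ep2 (mapE J₁ eJ1 eJ1 c) = Path.Homotopic.Quotient.refl _ := by
    intro c
    exact (mapE_mapE _ _ _ _ _ _ _).trans (Fam.mapE_null (p₂.comp J₁) fP sR
      (fun x => Subtype.ext (Prod.ext rfl (sub_sub_cancel _ _))) _ c)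
  have hin : ∀ a : Q (𝒜.bp (w₀, 0)) (𝒜.bp (w₀, 0)), mapE iLT eiT eiT (𝒜.inL iL w₀ a) =
      mapE (𝒜.inF (Fam.un (w₀, 0))) (𝒜.inF_bp (Fam.un (w₀, 0))) (𝒜.inF_bp (Fam.un (w₀, 0))) a := by
    intro a
    exact mapE_mapE ((𝒜.pull iL).inF (Fam.un w₀)) iLT (x' := bL) (y' := bL) rfl rfl rfl rfl a
  have surj : ∀ c₁ c₂, ∃ γ : Q bL bL, mapE q₁ eq1 eq1 γ = c₁ ∧ mapE q₂ eq2 eq2 γ = c₂ := by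
    intro c₁ c₂
    obtain ⟨a, ha⟩ := 𝒜.lemmaA hD hloc hthin (w₀, 0) hl₀ (𝒜.bp (w₀, 0))
      (mapE J₁ eJ1 eJ1 c₁ ⊚ mapE J₂ eJ2 eJ2 c₂)
    have h := (hin a).trans ha
    refine ⟨𝒜.inL iL w₀ a, ?_, ?_⟩
    · exact (c1 _).symm.trans ((congrArg _ h).trans ((mapE_trans p₁ ep1 ep1 ep1 _ _).trans
        ((congrArg₂ _ (d11 c₁) (d12 c₂)).trans (Q_refl_r _))))
    · exact (c2 _).symm.trans ((congrArg _ h).trans ((mapE_trans p₂ ep2 ep2 ep2 _ _).trans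
        ((congrArg₂ _ (d21 c₁) (d22 c₂)).trans (Q_refl_l _))))
  have inj : ∀ γ : Q bL bL, mapE q₁ eq1 eq1 γ = Path.Homotopic.Quotient.refl _ →
      mapE q₂ eq2 eq2 γ = Path.Homotopic.Quotient.refl _ → γ = Path.Homotopic.Quotient.refl _ := by
    intro γ h1 h2
    obtain ⟨a, ha⟩ := (𝒜.pull iL).lemmaA hDl (𝒜.pull_loc iL hloc) hthin' w₀ hl₀
      ((𝒜.pull iL).bp w₀) γ
    have ha' : 𝒜.inL iL w₀ a = γ := ha
    rw [← ha']
    refine 𝒜.lemmaB iL hloc hthin hfib hDc w₀ hl₀ hZ a ?_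
    let FP : Set ℂ := {z | P w₀ z ≠ 0}
    let FR : Set ℂ := {z | R w₀ z ≠ 0}
    let Pi : C(FP × FR, T) := ⟨fun x => ⟨((w₀, x.1.1 - x.2.1), x.1.1), mem_univ _, by
      rw [hA]
      refine mul_ne_zero x.1.2 ?_
      have : R w₀ x.2.1 ≠ 0 := x.2.2
      simpa using this⟩, by fun_prop⟩
    have ePi : Pi (⟨m (w₀, 0), b1⟩, ⟨m (w₀, 0), b2⟩) = bT :=
      Subtype.ext (Prod.ext (Prod.ext rfl (sub_self _)) rfl)
    have hFR : ∀ z : 𝒜.Fib (w₀, 0), R w₀ z.1 ≠ 0 := fun z => by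
      have h : R w₀ (z.1 - 0) ≠ 0 := right_ne_zero_of_mul z.2
      rwa [sub_zero] at h
    induction a using Path.Homotopic.Quotient.ind with | _ p
    have hp0 : (p 0).1 = m (w₀, 0) := congrArg (fun z : (𝒜.pull iL).Fib w₀ => z.1) p.source
    have hp1 : (p 1).1 = m (w₀, 0) := congrArg (fun z : (𝒜.pull iL).Fib w₀ => z.1) p.target
    let u : Path (⟨m (w₀, 0), b1⟩ : FP) ⟨m (w₀, 0), b1⟩ :=
      { toFun := fun t => ⟨(p t).1, left_ne_zero_of_mul (p t).2⟩
        continuous_toFun := by fun_prop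
        source' := Subtype.ext hp0
        target' := Subtype.ext hp1 }
    let v : Path (⟨m (w₀, 0), b2⟩ : FR) ⟨m (w₀, 0), b2⟩ :=
      { toFun := fun t => ⟨(p t).1, hFR (p t)⟩
        continuous_toFun := by fun_prop
        source' := Subtype.ext hp0
        target' := Subtype.ext hp1 }
    let pL : Path bL bL :=
      { toFun := fun t => ⟨(w₀, (p t).1), mem_univ _, (p t).2⟩
        continuous_toFun := by fun_prop
        source' := Subtype.ext (Prod.ext rfl hp0)
        target' := Subtype.ext (Prod.ext rfl hp1) }
    have hpL : Path.Homotopic.Quotient.mk pL = γ := by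
      rw [← ha']
      exact (mapE_eq_of _ _ _ _ _ (fun t => rfl)).symm
    have f1 : mapE Pi ePi ePi (Path.Homotopic.Quotient.mk (u.prod (Path.refl _))) =
        mapE J₁ eJ1 eJ1 (mapE q₁ eq1 eq1 (Path.Homotopic.Quotient.mk pL)) := by
      rw [mapE_mk q₁, mapE_mk J₁]
      exact mapE_eq_of _ _ _ _ _ (fun t => rfl)
    have f2 : mapE Pi ePi ePi (Path.Homotopic.Quotient.mk ((Path.refl _).prod v)) =
        mapE J₂ eJ2 eJ2 (mapE q₂ eq2 eq2 (Path.Homotopic.Quotient.mk pL)) := by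
      rw [mapE_mk q₂, mapE_mk J₂]
      exact mapE_eq_of _ _ _ _ _ (fun t => rfl)
    have f3 : Path.Homotopic.Quotient.mk (u.prod (Path.refl (⟨m (w₀, 0), b2⟩ : FR))) ⊚
        Path.Homotopic.Quotient.mk ((Path.refl (⟨m (w₀, 0), b1⟩ : FP)).prod v) =
        Path.Homotopic.Quotient.mk (u.prod v) := by
      rw [← Path.Homotopic.prod_lift, ← Path.Homotopic.prod_lift,
        Path.Homotopic.comp_prod_eq_prod_comp, ← Path.Homotopic.prod_lift]
      congr 1
      · rw [Path.Homotopic.Quotient.mk_refl]; exact Q_refl_r _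
      · rw [Path.Homotopic.Quotient.mk_refl]; exact Q_refl_l _
    have f4 : mapE (𝒜.inF (Fam.un (w₀, 0))) (𝒜.inF_bp (Fam.un (w₀, 0))) (𝒜.inF_bp (Fam.un (w₀, 0)))
        (Path.Homotopic.Quotient.mk p) =
        mapE Pi ePi ePi (Path.Homotopic.Quotient.mk (u.prod v)) := by
      rw [mapE_mk Pi]
      exact mapE_eq_of _ _ _ _ _ (fun t => Subtype.ext (Prod.ext (Prod.ext rfl
        (sub_self _).symm) rfl))
    refine f4.trans ?_
    rw [← f3, mapE_trans Pi ePi ePi ePi, f1, f2, hpL, h1, h2, mapE_refl, mapE_refl, Q_refl_l]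
    rfl
  -- the equivalence
  let hXL : C(X, L) := ⟨fun x => ⟨x.1, mem_univ _, by
    rw [hA', sub_zero]
    exact mul_ne_zero x.2.1 x.2.2⟩, by fun_prop⟩
  let hLX : C(L, X) := ⟨fun x => ⟨x.1, hPL x, hRL x⟩, by fun_prop⟩
  let bX' : X := ⟨(w₀, m (w₀, 0)), bX⟩
  have e1 : hXL bX' = bL := rfl
  have e2 : hLX bL = bX' := rfl
  have e12 : ∀ γ, mapE hXL e1 e1 (mapE hLX e2 e2 γ) = γ := fun γ => by
    rw [mapE_mapE]
    exact mapE_id _ (fun x => rfl) _ _ _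
  have e21 : ∀ γ, mapE hLX e2 e2 (mapE hXL e1 e1 γ) = γ := fun γ => by
    rw [mapE_mapE]
    exact mapE_id _ (fun x => rfl) _ _ _
  let Φ : FundamentalGroup X bX' →* FundamentalGroup (cmp P) bP × FundamentalGroup (cmp R) bR :=
    { toFun := fun γ => (mapE q₁ eq1 eq1 (mapE hXL e1 e1 γ), mapE q₂ eq2 eq2 (mapE hXL e1 e1 γ))
      map_one' := Prod.ext (by
          change mapE q₁ eq1 eq1 (mapE hXL e1 e1 (Path.Homotopic.Quotient.refl _)) = _
          rw [mapE_refl, mapE_refl]; rfl) (by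
          change mapE q₂ eq2 eq2 (mapE hXL e1 e1 (Path.Homotopic.Quotient.refl _)) = _
          rw [mapE_refl, mapE_refl]; rfl)
      map_mul' := fun x y => Prod.ext (by
          change mapE q₁ eq1 eq1 (mapE hXL e1 e1 (y ⊚ x)) = _
          rw [mapE_trans hXL e1 e1 e1, mapE_trans q₁ eq1 eq1 eq1]; rfl) (by
          change mapE q₂ eq2 eq2 (mapE hXL e1 e1 (y ⊚ x)) = _
          rw [mapE_trans hXL e1 e1 e1, mapE_trans q₂ eq2 eq2 eq2]; rfl) }
  refine ⟨MulEquiv.ofBijective Φ ⟨?_, ?_⟩⟩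
  · rw [injective_iff_map_eq_one]
    intro γ hγ
    have h := inj (mapE hXL e1 e1 γ) (congrArg Prod.fst hγ) (congrArg Prod.snd hγ)
    have h' := congrArg (mapE hLX e2 e2) h
    rw [e21, mapE_refl] at h'
    exact h'
  · rintro ⟨c₁, c₂⟩
    obtain ⟨γ, h1, h2⟩ := surj c₁ c₂
    refine ⟨mapE hLX e2 e2 γ, ?_⟩
    refine Prod.ext ?_ ?_
    · change mapE q₁ eq1 eq1 (mapE hXL e1 e1 (mapE hLX e2 e2 γ)) = _
      rw [e12, h1]
    · change mapE q₂ eq2 eq2 (mapE hXL e1 e1 (mapE hLX e2 e2 γ)) = _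
      rw [e12, h2]

end OSabs
end
end OS


open Set Topology
set_option linter.all false

namespace OS

noncomputable section

section thin

variable {S : Type*} [NormedAddCommGroup S] [NormedSpace ℂ S] [NormedSpace ℝ S]
  [IsScalarTower ℝ ℂ S]

/-- functions that are polynomial on every complex line -/
def PolyLine (k : S → ℂ) : Prop :=
  ∀ x v : S, ∃ p : Polynomial ℂ, ∀ l : ℂ, k (x + l • v) = p.eval l

theorem PolyLine.finite {k : S → ℂ} (hk : PolyLine k) (x v : S) (hx : k x ≠ 0) :
    {l : ℂ | k (x + l • v) = 0}.Finite := by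
  obtain ⟨p, hp⟩ := hk x v
  have hp0 : p ≠ 0 := by
    rintro rfl
    have := hp 0
    simp at this
    exact hx this
  have : {l : ℂ | k (x + l • v) = 0} ⊆ {l | l ∈ p.roots} := by
    intro l hl
    simp only [mem_setOf_eq] at hl ⊢
    rw [Polynomial.mem_roots hp0, Polynomial.IsRoot, ← hp, hl]
  refine Set.Finite.subset ?_ this
  exact (p.roots.toFinset.finite_toSet).subset (fun l hl => by simpa using hl)

theorem thin_path {k : S → ℂ} (hk : PolyLine k) (hne : ∃ s, k s ≠ 0) {V : Set S} (hV : IsOpen V)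
    (hc : Convex ℝ V) (hn : V.Nonempty) : IsPathConnected (V ∩ {s | k s ≠ 0}) := by
  -- nonemptiness
  have hne' : (V ∩ {s | k s ≠ 0}).Nonempty := by
    obtain ⟨s, hs⟩ := hne
    obtain ⟨v, hv⟩ := hn
    have hf := hk.finite s (v - s) hs
    have hcont : Continuous fun l : ℂ => s + l • (v - s) := by fun_prop
    have ho : IsOpen ((fun l : ℂ => s + l • (v - s)) ⁻¹' V) := hV.preimage hcont
    have h1 : (1 : ℂ) ∈ (fun l : ℂ => s + l • (v - s)) ⁻¹' V := by
      simpa using hv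
    have hinf : ((fun l : ℂ => s + l • (v - s)) ⁻¹' V).Infinite :=
      infinite_of_mem_nhds 1 (ho.mem_nhds h1)
    obtain ⟨l, hl, hl'⟩ := (hinf.diff hf).nonempty
    exact ⟨_, hl, hl'⟩
  rw [isPathConnected_iff]
  refine ⟨hne', ?_⟩
  rintro x ⟨hxV, hxk⟩ y ⟨hyV, hyk⟩
  have hf := hk.finite x (y - x) hxk
  set F := {l : ℂ | k (x + l • (y - x)) = 0} with hF
  let g : ℂ → S := fun l => x + l • (y - x)
  have hg : Continuous g := by
    show Continuous fun l : ℂ => x + l • (y - x)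
    fun_prop
  have hgo : IsOpen (g ⁻¹' V) := hV.preimage hg
  have hgc : Convex ℝ (g ⁻¹' V) := by
    intro a ha b hb s t hs ht hst
    have := hc ha hb hs ht hst
    show g (s • a + t • b) ∈ V
    convert this using 1
    show x + (s • a + t • b) • (y - x) = s • (x + a • (y - x)) + t • (x + b • (y - x))
    have e : x = s • x + t • x := by rw [← add_smul, hst, one_smul]
    rw [add_smul, smul_assoc, smul_assoc, smul_add, smul_add]
    nth_rewrite 1 [e]
    abel
  have h0 : (0 : ℂ) ∈ g ⁻¹' V := by simpa [g] using hxV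
  have h1 : (1 : ℂ) ∈ g ⁻¹' V := by simpa [g] using hyV
  have h0F : (0 : ℂ) ∉ F := by simpa [F] using hxk
  have h1F : (1 : ℂ) ∉ F := by simpa [F] using hyk
  let c : ℝ → ℂ := fun η => ⟨1/2, η⟩
  have hcc : Continuous c := by
    have : c = fun η : ℝ => ((1/2 : ℂ)) + (η : ℂ) * Complex.I := by
      funext η
      apply Complex.ext <;> simp [c]
    rw [this]
    fun_prop
  have hc0 : c 0 ∈ g ⁻¹' V := by
    have := hgc h0 h1 (by norm_num : (0:ℝ) ≤ 1/2) (by norm_num : (0:ℝ) ≤ 1/2) (by norm_num)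
    convert this using 1
    apply Complex.ext <;> simp [c]
  have hinf : (c ⁻¹' (g ⁻¹' V)).Infinite :=
    infinite_of_mem_nhds 0 ((hgo.preimage hcc).mem_nhds hc0)
  have hbad : ((fun f : ℂ => f.im / (2 * f.re)) '' F ∪ (fun f : ℂ => f.im / (2 * (1 - f.re))) '' F).Finite :=
    (hf.image _).union (hf.image _)
  obtain ⟨η, hη, hη'⟩ := (hinf.diff hbad).nonempty
  have key0 : segment ℝ 0 (c η) ⊆ g ⁻¹' V ∩ Fᶜ := by
    intro z hz
    refine ⟨hgc.segment_subset h0 hη hz, fun hzF => ?_⟩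
    obtain ⟨a, b, ha, hb, hab, rfl⟩ := hz
    by_cases hb0 : b = 0
    · apply h0F; simpa [hb0] using hzF
    · apply hη'
      refine Or.inl ⟨_, hzF, ?_⟩
      simp [c]
      field_simp
  have key1 : segment ℝ (c η) 1 ⊆ g ⁻¹' V ∩ Fᶜ := by
    intro z hz
    refine ⟨hgc.segment_subset hη h1 hz, fun hzF => ?_⟩
    obtain ⟨a, b, ha, hb, hab, rfl⟩ := hz
    by_cases hb0 : a = 0
    · apply h1F
      have : b = 1 := by linarith
      simpa [hb0, this] using hzF
    · apply hη'
      refine Or.inr ⟨_, hzF, ?_⟩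
      have : b = 1 - a := by linarith
      simp [c, this]
      have e : 2 * (1 - (a * 2⁻¹ + (1 - a))) = a := by ring
      rw [e]
      field_simp
  have hj : JoinedIn (g ⁻¹' V ∩ Fᶜ) 0 1 :=
    (JoinedIn.of_segment_subset key0).trans (JoinedIn.of_segment_subset key1)
  obtain ⟨p, hp⟩ := hj
  have e0 : g 0 = x := by simp [g]
  have e1 : g 1 = y := by simp [g]
  refine ⟨(p.map hg).cast e0.symm e1.symm, fun t => ?_⟩
  exact ⟨(hp t).1, (hp t).2⟩

theorem thin_Tot (𝒜 : Fam S) {k : S → ℂ} (hk : PolyLine k) (hne : ∃ s, k s ≠ 0)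
    (V : Set (S × ℂ)) (hVT : V ⊆ 𝒜.Tot univ) (hV : IsOpen V) (hc : Convex ℝ V) (hn : V.Nonempty) :
    IsPathConnected (V ∩ 𝒜.Tot {s | k s ≠ 0}) := by
  have hk' : PolyLine (fun q : S × ℂ => k q.1) := by
    intro x v
    obtain ⟨p, hp⟩ := hk x.1 v.1
    exact ⟨p, fun l => by simpa using hp l⟩
  have := thin_path hk' (by obtain ⟨s, hs⟩ := hne; exact ⟨(s, 0), hs⟩) hV hc hn
  have e : V ∩ 𝒜.Tot {s | k s ≠ 0} = V ∩ {q : S × ℂ | k q.1 ≠ 0} := by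
    ext q
    constructor
    · rintro ⟨h1, h2⟩
      exact ⟨h1, h2.1⟩
    · rintro ⟨h1, h2⟩
      exact ⟨h1, h2, (hVT h1).2⟩
  rw [e]
  exact this

theorem thin_conn {k : S → ℂ} (hk : PolyLine k) (hne : ∃ s, k s ≠ 0) :
    IsPathConnected {s | k s ≠ 0} := by
  have := thin_path hk hne isOpen_univ convex_univ ⟨0, trivial⟩
  rwa [univ_inter] at this

end thin
end
end OS


open Set Topology
set_option linter.all false

namespace OS

noncomputable section

theorem near_root {N : ℕ} (σ : Fin N → ℂ) (z : ℂ) (η : ℝ) (hη : 0 < η)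
    (h : ‖∏ i, (z - σ i)‖ < η ^ N) : ∃ i, ‖z - σ i‖ < η := by
  by_contra hcon
  push Not at hcon
  have : η ^ N ≤ ‖∏ i, (z - σ i)‖ := by
    rw [norm_prod]
    calc η ^ N = ∏ i : Fin N, η := by simp
      _ ≤ _ := Finset.prod_le_prod (fun _ _ => hη.le) (fun i _ => hcon i)
  linarith

theorem exists_eps {N : ℕ} (r : Fin N → ℂ) (hr : Function.Injective r) (h0 : ∀ i, r i ≠ 0) :
    ∃ ε : ℝ, 0 < ε ∧ (∀ i j, i ≠ j → 8 * ε ≤ ‖r i - r j‖) ∧ ∀ i, 8 * ε ≤ ‖r i‖ := by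
  have h1 : ∀ c : ℝ, 0 < c → ∀ᶠ ε in 𝓝[>] (0:ℝ), 8 * ε ≤ c := by
    intro c hc
    apply eventually_nhdsWithin_of_eventually_nhds
    have : Filter.Tendsto (fun ε : ℝ => 8 * ε) (𝓝 0) (𝓝 (8 * 0)) :=
      (continuous_const.mul continuous_id).tendsto 0
    rw [mul_zero] at this
    exact this.eventually (eventually_le_nhds hc)
  have h2 : ∀ᶠ ε in 𝓝[>] (0:ℝ), ∀ i j, i ≠ j → 8 * ε ≤ ‖r i - r j‖ := by
    rw [Filter.eventually_all]
    intro i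
    rw [Filter.eventually_all]
    intro j
    by_cases hij : i = j
    · exact Filter.Eventually.of_forall (fun ε h => absurd hij h)
    · filter_upwards [h1 ‖r i - r j‖ (norm_pos_iff.2 (sub_ne_zero.2 (hr.ne hij)))] with ε hε _
      exact hε
  have h3 : ∀ᶠ ε in 𝓝[>] (0:ℝ), ∀ i, 8 * ε ≤ ‖r i‖ := by
    rw [Filter.eventually_all]
    intro i
    exact h1 _ (norm_pos_iff.2 (h0 i))
  obtain ⟨ε, h⟩ := (h2.and (h3.and self_mem_nhdsWithin)).exists
  exact ⟨ε, h.2.2, h.1, h.2.1⟩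

section
variable {S : Type*} [NormedAddCommGroup S] [NormedSpace ℝ S]

theorem roots_nbhd {N : ℕ} (B : S → ℂ → ℂ) (hB : ∀ z, Continuous fun s => B s z)
    (hσ : ∀ s, ∃ σ : Fin N → ℂ, ∀ z, B s z = ∏ i, (z - σ i)) (s₁ : S) (r : Fin N → ℂ)
    (hr : ∀ z, B s₁ z = ∏ i, (z - r i)) (ε δ : ℝ) (hδ : 0 < δ) (hδε : δ ≤ ε)
    (hsep : ∀ i j, i ≠ j → 8 * ε ≤ ‖r i - r j‖) :
    ∃ W : Set S, IsOpen W ∧ s₁ ∈ W ∧ ∃ ρ : Fin N → S → ℂ, (∀ i, ContinuousOn (ρ i) W) ∧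
      (∀ s ∈ W, ∀ i, ‖r i - ρ i s‖ < δ) ∧ ∀ s ∈ W, ∀ z, B s z = 0 ↔ ∃ i, z = ρ i s := by
  let W : Set S := ⋂ i, {s | ‖B s (r i)‖ < δ ^ N}
  have hW : IsOpen W := isOpen_iInter_of_finite fun i =>
    isOpen_lt (hB (r i)).norm continuous_const
  have hs₁ : s₁ ∈ W := by
    refine mem_iInter.2 fun i => ?_
    have : B s₁ (r i) = 0 := by
      rw [hr]
      exact Finset.prod_eq_zero (Finset.mem_univ i) (sub_self _)
    simp only [mem_setOf_eq, this, norm_zero]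
    positivity
  have hex : ∀ s ∈ W, ∀ i, ∃ z, ‖r i - z‖ < δ ∧ B s z = 0 := by
    intro s hs i
    obtain ⟨σ, hσ⟩ := hσ s
    have := mem_iInter.1 hs i
    simp only [mem_setOf_eq, hσ] at this
    obtain ⟨j, hj⟩ := near_root σ (r i) δ hδ this
    refine ⟨σ j, hj, ?_⟩
    rw [hσ]
    exact Finset.prod_eq_zero (Finset.mem_univ j) (sub_self _)
  have hcov : ∀ s ∈ W, ∀ i, ∀ z, ‖r i - z‖ < δ → B s z = 0 → ∀ z', B s z' = 0 → 
      (∃ i', ‖r i' - z'‖ < δ) ∧ (‖r i - z'‖ < δ → z' = z) := by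
    intro s hs i z hz hz0 z' hz'
    obtain ⟨σ, hσ⟩ := hσ s
    have hex' : ∀ i, ∃ j, ‖r i - σ j‖ < δ := by
      intro i
      have := mem_iInter.1 hs i
      simp only [mem_setOf_eq, hσ] at this
      exact near_root σ (r i) δ hδ this
    choose j hj using hex'
    have hsep' : ∀ i i' w, ‖r i - w‖ < δ → ‖r i' - w‖ < δ → i = i' := by
      intro i i' w h h'
      by_contra hne
      have h1 := hsep i i' hne
      have h2 : ‖r i - r i'‖ ≤ ‖r i - w‖ + ‖r i' - w‖ := by
        have : r i - r i' = (r i - w) - (r i' - w) := by ring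
        rw [this]; exact norm_sub_le _ _
      linarith
    have hjinj : Function.Injective j := by
      intro a b hab
      exact hsep' a b (σ (j a)) (hj a) (by rw [hab]; exact hj b)
    have hjs : Function.Surjective j := Finite.surjective_of_injective hjinj
    have hz_eq : ∀ w, B s w = 0 → ∃ a, w = σ (j a) := by
      intro w hw
      rw [hσ, Finset.prod_eq_zero_iff] at hw
      obtain ⟨c, -, hc⟩ := hw
      obtain ⟨a, rfl⟩ := hjs c
      exact ⟨a, sub_eq_zero.1 hc⟩
    obtain ⟨a, ha⟩ := hz_eq z hz0
    obtain ⟨a', ha'⟩ := hz_eq z' hz'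
    refine ⟨⟨a', by rw [ha']; exact hj a'⟩, fun h => ?_⟩
    have e1 : i = a := hsep' i a z hz (by rw [ha]; exact hj a)
    have e2 : i = a' := hsep' i a' z' h (by rw [ha']; exact hj a')
    rw [ha, ha', ← e1, ← e2]
  have hex2 : ∀ i s, ∃ z, s ∈ W → ‖r i - z‖ < δ ∧ B s z = 0 := by
    intro i s
    by_cases hs : s ∈ W
    · obtain ⟨z, hz⟩ := hex s hs i
      exact ⟨z, fun _ => hz⟩
    · exact ⟨0, fun h => absurd h hs⟩
  choose ρ hρ using hex2
  refine ⟨W, hW, hs₁, ρ, ?_, fun s hs i => (hρ i s hs).1, ?_⟩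
  · intro i s hs
    apply ContinuousAt.continuousWithinAt
    rw [Metric.continuousAt_iff']
    intro e he
    set η := min e (δ - ‖r i - ρ i s‖) with hηd
    have hη : 0 < η := lt_min he (sub_pos.2 (hρ i s hs).1)
    have h1 : ∀ᶠ s' in 𝓝 s, ‖B s' (ρ i s)‖ < η ^ N := by
      have hc := (hB (ρ i s)).norm.tendsto s
      simp only [(hρ i s hs).2, norm_zero] at hc
      exact hc.eventually (gt_mem_nhds (by positivity))
    filter_upwards [h1, hW.mem_nhds hs] with s' h1 h2
    obtain ⟨σ, hσ⟩ := hσ s'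
    rw [hσ] at h1
    obtain ⟨j, hj⟩ := near_root σ (ρ i s) η hη h1
    have hz : B s' (σ j) = 0 := by
      rw [hσ]
      exact Finset.prod_eq_zero (Finset.mem_univ j) (sub_self _)
    have hclose : ‖r i - σ j‖ < δ := by
      have e1 : r i - σ j = (r i - ρ i s) + (ρ i s - σ j) := by ring
      have e2 := norm_add_le (r i - ρ i s) (ρ i s - σ j)
      have e3 : η ≤ δ - ‖r i - ρ i s‖ := min_le_right _ _
      rw [e1]; linarith
    have := (hcov s' h2 i (ρ i s') (hρ i s' h2).1 (hρ i s' h2).2 (σ j) hz).2 hclose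
    rw [← this, dist_comm, dist_eq_norm]
    exact hj.trans_le (min_le_left _ _)
  · intro s hs z
    constructor
    · intro hz
      -- some index exists, since B s z = 0
      have hN : ∃ i : Fin N, True := by
        obtain ⟨σ, hσ⟩ := hσ s
        rw [hσ, Finset.prod_eq_zero_iff] at hz
        obtain ⟨c, -, hc⟩ := hz
        exact ⟨c, trivial⟩
      obtain ⟨i₀, -⟩ := hN
      obtain ⟨i, hi⟩ := (hcov s hs i₀ _ (hρ i₀ s hs).1 (hρ i₀ s hs).2 z hz).1
      exact ⟨i, (hcov s hs i _ (hρ i s hs).1 (hρ i s hs).2 z hz).2 hi⟩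
    · rintro ⟨i, rfl⟩
      exact (hρ i s hs).2

/-- bump functions -/
def chi (ε : ℝ) (r z : ℂ) : ℝ := max 0 (1 - ‖z - r‖ / (2 * ε))

theorem chi_self (ε : ℝ) (r : ℂ) : chi ε r r = 1 := by simp [chi]

theorem chi_far {ε : ℝ} (hε : 0 < ε) {r z : ℂ} (h : 8 * ε ≤ ‖z - r‖) : chi ε r z = 0 := by
  rw [chi, max_eq_left]
  rw [sub_nonpos, le_div_iff₀ (by positivity)]
  linarith

theorem chi_le {ε : ℝ} (hε : 0 < ε) (r z : ℂ) : |chi ε r z| ≤ 1 := by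
  rw [chi, abs_of_nonneg (le_max_left _ _)]
  apply max_le (by norm_num)
  have : 0 ≤ ‖z - r‖ / (2 * ε) := by positivity
  linarith

theorem chi_lip {ε : ℝ} (hε : 0 < ε) (r z z' : ℂ) :
    |chi ε r z - chi ε r z'| ≤ ‖z - z'‖ / (2 * ε) := by
  rw [chi, chi]
  refine (abs_max_sub_max_le_max _ _ _ _).trans ?_
  apply max_le
  · simp; positivity
  · have : 1 - ‖z - r‖ / (2 * ε) - (1 - ‖z' - r‖ / (2 * ε)) = (‖z' - r‖ - ‖z - r‖) / (2 * ε) := by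
      ring
    rw [this, abs_div, abs_of_pos (by positivity : 0 < 2 * ε)]
    gcongr
    have h1 := abs_norm_sub_norm_le (z' - r) (z - r)
    have h2 : z' - r - (z - r) = -(z - z') := by ring
    rwa [h2, norm_neg] at h1

theorem chi_cont (ε : ℝ) (r : ℂ) : Continuous (chi ε r) := by
  unfold chi
  fun_prop

theorem exists_inv (g : ℂ → ℂ) (hg : ∀ z z', ‖g z - g z'‖ ≤ 1/2 * ‖z - z'‖) (z : ℂ) :
    ∃ u, u + g u = z := by
  have hc : ContractingWith (1/2) (fun u => z - g u) := by
    refine ⟨by rw [← NNReal.coe_lt_coe]; norm_num, LipschitzWith.of_dist_le_mul fun x y => ?_⟩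
    rw [dist_eq_norm, dist_eq_norm]
    have : z - g x - (z - g y) = -(g x - g y) := by ring
    rw [this, norm_neg]
    simpa using hg x y
  refine ⟨hc.fixedPoint, ?_⟩
  have := hc.fixedPoint_isFixedPt
  have h2 : z - g hc.fixedPoint = hc.fixedPoint := this
  rw [← sub_eq_iff_eq_add.1 h2]

theorem inj_bound (g g' : ℂ → ℂ) (hg : ∀ z z', ‖g z - g z'‖ ≤ 1/2 * ‖z - z'‖) (E : ℝ)
    (hE : ∀ z, ‖g z - g' z‖ ≤ E) (u u' : ℂ) :
    ‖u - u'‖ ≤ 2 * (‖(u + g u) - (u' + g' u')‖ + E) := by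
  have e : u - u' = ((u + g u) - (u' + g' u')) - (g u - g u') - (g u' - g' u') := by ring
  have h1 := norm_sub_le (((u + g u) - (u' + g' u')) - (g u - g u')) (g u' - g' u')
  have h2 := norm_sub_le ((u + g u) - (u' + g' u')) (g u - g u')
  have h3 := hg u u'
  have h4 := hE u'
  rw [← e] at h1
  linarith

theorem flow_exists {N : ℕ} (r : Fin N → ℂ) (ε : ℝ) (hε : 0 < ε)
    (hsep : ∀ i j, i ≠ j → 8 * ε ≤ ‖r i - r j‖) (h0 : ∀ i, 8 * ε ≤ ‖r i‖) (W : Set S)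
    (ρ : Fin N → S → ℂ) (hρ : ∀ i, ContinuousOn (ρ i) W)
    (hclose : ∀ s ∈ W, ∀ i, ‖r i - ρ i s‖ < ε / (N + 1)) :
    ∃ φ : S → S → ℂ → ℂ, 
      ContinuousOn (fun q : S × S × ℂ => φ q.1 q.2.1 q.2.2) (W ×ˢ (W ×ˢ univ)) ∧ 
      (∀ s ∈ W, ∀ s' ∈ W, ∀ z, ∀ i, φ s s' z = ρ i s → z = ρ i s') ∧
      (∀ s ∈ W, ∀ z, φ s s z = z) ∧ (∀ s ∈ W, ∀ s' ∈ W, φ s s' 0 = 0) ∧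
      (∀ s ∈ W, ∀ s' ∈ W, ∀ s'' ∈ W, ∀ z, φ s s' (φ s' s'' z) = φ s s'' z) := by
  let g : S → ℂ → ℂ := fun s z => ∑ i, (chi ε (r i) z : ℂ) * (ρ i s - r i)
  have hg : ∀ s ∈ W, ∀ z z', ‖g s z - g s z'‖ ≤ 1/2 * ‖z - z'‖ := by
    intro s hs z z'
    have e : g s z - g s z' = ∑ i, ((chi ε (r i) z - chi ε (r i) z' : ℝ) : ℂ) * (ρ i s - r i) := by
      simp only [g]
      rw [← Finset.sum_sub_distrib]
      refine Finset.sum_congr rfl fun i _ => ?_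
      push_cast; ring
    rw [e]
    refine (norm_sum_le _ _).trans ?_
    have : ∀ i ∈ Finset.univ, ‖((chi ε (r i) z - chi ε (r i) z' : ℝ) : ℂ) * (ρ i s - r i)‖ ≤
        ‖z - z'‖ / (2 * ε) * (ε / (N + 1)) := by
      intro i _
      rw [norm_mul, Complex.norm_real, norm_sub_rev (ρ i s)]
      exact mul_le_mul (chi_lip hε _ _ _) (hclose s hs i).le (norm_nonneg _) (by positivity)
    refine (Finset.sum_le_sum this).trans ?_
    rw [Finset.sum_const, Finset.card_univ, Fintype.card_fin, nsmul_eq_mul]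
    have e2 : (N : ℝ) * (‖z - z'‖ / (2 * ε) * (ε / (N + 1))) = 
        1/2 * ‖z - z'‖ * (N / (N + 1)) := by
      field_simp
    rw [e2]
    have : (N : ℝ) / (N + 1) ≤ 1 := by
      rw [div_le_one (by positivity)]; linarith
    have h3 : 0 ≤ 1/2 * ‖z - z'‖ := by positivity
    nlinarith
  have hE : ∀ s s' z, ‖g s z - g s' z‖ ≤ ∑ i, ‖ρ i s - ρ i s'‖ := by
    intro s s' z
    have e : g s z - g s' z = ∑ i, (chi ε (r i) z : ℂ) * (ρ i s - ρ i s') := by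
      simp only [g]
      rw [← Finset.sum_sub_distrib]
      refine Finset.sum_congr rfl fun i _ => ?_
      ring
    rw [e]
    refine (norm_sum_le _ _).trans (Finset.sum_le_sum fun i _ => ?_)
    rw [norm_mul, Complex.norm_real]
    have := chi_le hε (r i) z
    exact mul_le_of_le_one_left (norm_nonneg _) this
  have hex : ∀ s z, ∃ u, s ∈ W → u + g s u = z := by
    intro s z
    by_cases hs : s ∈ W
    · obtain ⟨u, hu⟩ := exists_inv (g s) (hg s hs) z
      exact ⟨u, fun _ => hu⟩
    · exact ⟨0, fun h => absurd h hs⟩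
  choose H hH using hex
  have hinj : ∀ s ∈ W, ∀ u u', u + g s u = u' + g s u' → u = u' := by
    intro s hs u u' h
    have := inj_bound (g s) (g s) (hg s hs) 0 (by simp) u u'
    rw [h] at this
    simp at this
    exact sub_eq_zero.1 this
  have hHg : ∀ s ∈ W, ∀ u, H s (u + g s u) = u := fun s hs u => hinj s hs _ _ (hH s _ hs)
  have hgr : ∀ s, ∀ i, r i + g s (r i) = ρ i s := by
    intro s i
    have : g s (r i) = ρ i s - r i := by
      simp only [g]
      rw [Finset.sum_eq_single i]
      · simp [chi_self]
      · intro j _ hj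
        rw [chi_far hε (hsep i j hj.symm)]
        simp
      · simp
    rw [this]; ring
  have hg0 : ∀ s, g s 0 = 0 := by
    intro s
    simp only [g]
    refine Finset.sum_eq_zero fun i _ => ?_
    rw [chi_far hε (by simpa using h0 i)]
    simp
  have hHc : ContinuousOn (fun q : S × ℂ => H q.1 q.2) (W ×ˢ univ) := by
    rintro ⟨s, z⟩ ⟨hs, -⟩
    rw [ContinuousWithinAt, tendsto_iff_dist_tendsto_zero]
    have hlim : Filter.Tendsto (fun q : S × ℂ => 2 * (‖q.2 - z‖ + ∑ i, ‖ρ i q.1 - ρ i s‖))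
        (𝓝[W ×ˢ univ] (s, z)) (𝓝 (2 * (‖z - z‖ + ∑ i, ‖ρ i s - ρ i s‖))) := by
      refine Filter.Tendsto.const_mul _ (Filter.Tendsto.add ?_ (tendsto_finsetSum _ fun i _ => ?_))
      · exact Filter.Tendsto.mono_left ((by fun_prop : Continuous fun q : S × ℂ => ‖q.2 - z‖).tendsto (s, z))
          nhdsWithin_le_nhds
      · have h1 : ContinuousWithinAt (fun q : S × ℂ => ρ i q.1) (W ×ˢ univ) (s, z) :=
          ContinuousWithinAt.comp (f := Prod.fst) (g := ρ i) (t := W) (hρ i s hs)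
            continuous_fst.continuousWithinAt (fun q hq => hq.1)
        exact (h1.sub continuousWithinAt_const).norm
    simp only [sub_self, norm_zero, Finset.sum_const_zero, add_zero, mul_zero] at hlim
    refine squeeze_zero' (Filter.Eventually.of_forall fun _ => dist_nonneg) ?_ hlim
    filter_upwards [self_mem_nhdsWithin] with q hq
    rw [dist_eq_norm]
    have := inj_bound (g q.1) (g s) (hg q.1 hq.1) _ (hE q.1 s) (H q.1 q.2) (H s z)
    rwa [hH _ _ hq.1, hH _ _ hs] at this
  refine ⟨fun s s' z => H s' z + g s (H s' z), ?_, ?_, ?_, ?_, ?_⟩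
  · have h1 : ContinuousOn (fun q : S × S × ℂ => H q.2.1 q.2.2) (W ×ˢ (W ×ˢ univ)) :=
      hHc.comp (f := fun q : S × S × ℂ => q.2) continuous_snd.continuousOn (fun q hq => hq.2)
    refine h1.add ?_
    refine continuousOn_finset_sum _ fun i _ => ContinuousOn.mul ?_ (ContinuousOn.sub ?_ continuousOn_const)
    · exact (Complex.continuous_ofReal.comp (chi_cont ε (r i))).comp_continuousOn h1
    · exact (hρ i).comp (f := fun q : S × S × ℂ => q.1) continuous_fst.continuousOn (fun q hq => hq.1)
  · intro s hs s' hs' z i h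
    have h' : H s' z + g s (H s' z) = r i + g s (r i) := h.trans (hgr s i).symm
    have := hinj s hs _ _ h'
    rw [← hH s' z hs', this, hgr]
  · intro s hs z
    exact hH s z hs
  · intro s hs s' hs'
    have : H s' 0 = 0 := by
      have := hHg s' hs' 0
      rwa [hg0, add_zero] at this
    simp only [this, hg0, add_zero]
  · intro s hs s' hs' s'' hs'' z
    simp only [hHg s' hs']

theorem loc_triv (𝒜 : Fam S) {D : Set S} (hD : IsOpen D) (N : ℕ)
    (h : ∀ s, ∃ σ : Fin N → ℂ, ∀ z, 𝒜.A s z = ∏ i, (z - σ i))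
    (hinj : ∀ s ∈ D, ∃ σ : Fin N → ℂ, Function.Injective σ ∧ ∀ z, 𝒜.A s z = ∏ i, (z - σ i)) :
    𝒜.LocTriv D := by
  intro s₁ hs₁
  let B : S → ℂ → ℂ := fun s z => 𝒜.A s (z + 𝒜.m s)
  have hB : ∀ z, Continuous fun s => B s z := by
    intro z
    have := 𝒜.hm
    exact 𝒜.hA.comp (f := fun s => (s, z + 𝒜.m s)) (by fun_prop)
  have hσ : ∀ s, ∃ σ : Fin N → ℂ, ∀ z, B s z = ∏ i, (z - σ i) := by
    intro s
    obtain ⟨σ, hσ⟩ := h s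
    refine ⟨fun i => σ i - 𝒜.m s, fun z => ?_⟩
    simp only [B, hσ]
    refine Finset.prod_congr rfl fun i _ => by ring
  obtain ⟨r', hr'inj, hr'⟩ := hinj s₁ hs₁
  let r : Fin N → ℂ := fun i => r' i - 𝒜.m s₁
  have hr : ∀ z, B s₁ z = ∏ i, (z - r i) := by
    intro z
    simp only [B, hr', r]
    refine Finset.prod_congr rfl fun i _ => by ring
  have hrinj : Function.Injective r := fun i j hij => hr'inj (by simpa [r] using hij)
  have hr0 : ∀ i, r i ≠ 0 := by
    intro i hi
    apply 𝒜.ne s₁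
    rw [hr', Finset.prod_eq_zero (Finset.mem_univ i)]
    have : r' i - 𝒜.m s₁ = 0 := hi
    rw [sub_eq_zero] at this ⊢
    exact this.symm
  obtain ⟨ε, hε, hsep, h0⟩ := exists_eps r hrinj hr0
  obtain ⟨W, hW, hsW, ρ, hρ, hcl, hz⟩ := roots_nbhd B hB hσ s₁ r hr ε (ε / (N + 1)) (by positivity)
    (div_le_self hε.le (by linarith [(Nat.cast_nonneg N : (0:ℝ) ≤ N)])) hsep
  obtain ⟨φ, hφ1, hφ2, hφ3, hφ4, hφ5⟩ := flow_exists r ε hε hsep h0 W ρ hρ hcl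
  obtain ⟨η, hη, hball⟩ := Metric.isOpen_iff.1 (hW.inter hD) s₁ ⟨hsW, hs₁⟩
  have hU : ∀ s ∈ Metric.ball s₁ η, s ∈ W := fun s hs => (hball hs).1
  refine ⟨Metric.ball s₁ η, Metric.isOpen_ball, convex_ball _ _, Metric.mem_ball_self hη,
    fun s hs => (hball hs).2, ⟨⟨fun s s' z => φ s s' (z - 𝒜.m s') + 𝒜.m s, ?_, ?_, ?_, ?_, ?_⟩⟩⟩
  · have hm := 𝒜.hm
    refine ContinuousOn.add ?_ (Continuous.continuousOn (by fun_prop))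
    exact hφ1.comp (f := fun q : S × S × ℂ => (q.1, q.2.1, q.2.2 - 𝒜.m q.2.1))
      (Continuous.continuousOn (by fun_prop)) (fun q hq => ⟨hU _ hq.1, hU _ hq.2.1, trivial⟩)
  · intro s hs s' hs' z hz1 hz2
    have : B s (φ s s' (z - 𝒜.m s')) = 0 := hz2
    obtain ⟨i, hi⟩ := (hz s (hU _ hs) _).1 this
    have h1 := hφ2 s (hU _ hs) s' (hU _ hs') _ i hi
    have h2 : B s' (z - 𝒜.m s') = 0 := (hz s' (hU _ hs') _).2 ⟨i, h1⟩
    apply hz1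
    simpa [B] using h2
  · intro s hs z
    simp only [hφ3 s (hU _ hs), sub_add_cancel]
  · intro s hs s' hs'
    simp only [sub_self, hφ4 s (hU _ hs) s' (hU _ hs'), zero_add]
  · intro s hs s' hs' s'' hs'' z
    simp only [add_sub_cancel_right, hφ5 s (hU _ hs) s' (hU _ hs') s'' (hU _ hs'')]

end
end
end OS


open Set Topology Polynomial
set_option linter.all false

namespace OS

noncomputable section

/-- specialisation of the coefficient variable -/
def fb (F : ℂ[X][X]) (x : ℂ) : ℂ[X] := F.map (evalRingHom x)

/-- evaluation of a two variable polynomial -/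
def ev (F : ℂ[X][X]) (x z : ℂ) : ℂ := (fb F x).eval z

theorem ev_sum (F : ℂ[X][X]) (x z : ℂ) :
    ev F x z = ∑ i ∈ Finset.range (F.natDegree + 1), (F.coeff i).eval x * z ^ i := by
  rw [ev, fb, eval_map, eval₂_eq_sum_range]
  rfl

theorem ev_cont (F : ℂ[X][X]) : Continuous fun q : ℂ × ℂ => ev F q.1 q.2 := by
  simp only [ev_sum]
  fun_prop

theorem ev_line (F : ℂ[X][X]) (a u b v : ℂ) : ∃ p : ℂ[X], ∀ l : ℂ,
    ev F (a + l * u) (b + l * v) = p.eval l := by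
  refine ⟨∑ i ∈ Finset.range (F.natDegree + 1), (F.coeff i).comp (C a + X * C u) *
    (C b + X * C v) ^ i, fun l => ?_⟩
  rw [ev_sum, eval_finsetSum]
  refine Finset.sum_congr rfl fun i _ => ?_
  simp only [eval_mul, eval_pow, eval_comp, eval_add, eval_C, eval_X]

theorem ev_polyLine (F : ℂ[X][X]) : PolyLine (fun q : ℂ × ℂ => ev F q.1 q.2) := by
  intro x v
  obtain ⟨p, hp⟩ := ev_line F x.1 v.1 x.2 v.2
  exact ⟨p, fun l => by simpa using hp l⟩

theorem ev_polyLine' (F : ℂ[X][X]) : PolyLine (fun q : ℂ × ℂ => ev F q.2 q.1) := by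
  intro x v
  obtain ⟨p, hp⟩ := ev_line F x.2 v.2 x.1 v.1
  exact ⟨p, fun l => by simpa using hp l⟩

theorem eval_polyLine (p : ℂ[X]) : PolyLine (fun z : ℂ => p.eval z) := by
  intro x v
  refine ⟨p.comp (C x + X * C v), fun l => ?_⟩
  simp only [smul_eq_mul, eval_mul, eval_pow, eval_comp, eval_add, eval_C, eval_X]

theorem fb_monic {F : ℂ[X][X]} (hF : F.Monic) (x : ℂ) : (fb F x).Monic := hF.map _

theorem fb_deg {F : ℂ[X][X]} (hF : F.Monic) (x : ℂ) : (fb F x).natDegree = F.natDegree :=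
  hF.natDegree_map _

theorem exists_factors (p : ℂ[X]) (hp : p.Monic) (N : ℕ) (hN : p.natDegree = N) :
    ∃ σ : Fin N → ℂ, (∀ z, p.eval z = ∏ i, (z - σ i)) ∧ (p.Separable → Function.Injective σ) := by
  have hs := IsAlgClosed.splits p
  have h1 := hs.eq_prod_roots_of_monic hp
  have h2 : p.roots.toList.length = N := by
    rw [Multiset.length_toList, ← hN, hs.natDegree_eq_card_roots]
  subst h2
  refine ⟨fun i => p.roots.toList.get i, fun z => ?_, fun hsep => ?_⟩
  · conv_lhs => rw [h1]
    rw [eval_multiset_prod, Multiset.map_map]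
    conv_lhs => rw [← Multiset.coe_toList p.roots]
    rw [Multiset.map_coe, Multiset.prod_coe, ← List.prod_ofFn]
    congr 1
    conv_lhs => rw [← List.ofFn_get p.roots.toList]
    rw [List.map_ofFn]
    congr 1
    funext i
    simp
  · have := nodup_roots hsep
    rw [← Multiset.coe_toList p.roots, Multiset.coe_nodup] at this
    exact List.nodup_iff_injective_get.1 this

theorem root_bound {p : ℂ[X]} (hp : p.Monic) {z : ℂ}
    (hz : 1 + ∑ i ∈ Finset.range p.natDegree, ‖p.coeff i‖ < ‖z‖) : p.eval z ≠ 0 := by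
  intro h0
  have hp0 : p ≠ 0 := hp.ne_zero
  have := IsRoot.norm_lt_cauchyBound hp0 h0
  have h2 : (cauchyBound p : ℝ) ≤ 1 + ∑ i ∈ Finset.range p.natDegree, ‖p.coeff i‖ := by
    rw [cauchyBound, hp.leadingCoeff]
    have h3 : (Finset.range p.natDegree).sup (fun i => ‖p.coeff i‖₊) ≤
        ∑ i ∈ Finset.range p.natDegree, ‖p.coeff i‖₊ :=
      Finset.sup_le fun i hi => Finset.single_le_sum (f := fun i => ‖p.coeff i‖₊) (fun _ _ => zero_le) hi
    have h4 : (((Finset.range p.natDegree).sup (fun i => ‖p.coeff i‖₊) : NNReal) : ℝ) ≤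
        ∑ i ∈ Finset.range p.natDegree, ‖p.coeff i‖ := by
      have := NNReal.coe_le_coe.2 h3
      simpa using this
    simp only [nnnorm_one, div_one, NNReal.coe_add, NNReal.coe_one]
    linarith
  have h5 : ‖z‖ < (cauchyBound p : ℝ) := by exact_mod_cast this
  linarith

/-- bound for the roots -/
def bd (F : ℂ[X][X]) (x : ℂ) : ℝ := 2 + ∑ i ∈ Finset.range F.natDegree, ‖(F.coeff i).eval x‖

theorem bd_cont (F : ℂ[X][X]) : Continuous (bd F) := by
  unfold bd
  fun_prop

theorem bd_pos (F : ℂ[X][X]) (x : ℂ) : 0 < bd F x := by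
  unfold bd
  positivity

theorem bd_ne {F : ℂ[X][X]} (hF : F.Monic) {x z : ℂ} (h : bd F x ≤ ‖z‖) : ev F x z ≠ 0 := by
  apply root_bound (fb_monic hF x)
  rw [fb_deg hF]
  have : ∀ i, (fb F x).coeff i = (F.coeff i).eval x := fun i => by simp [fb]
  simp only [this]
  unfold bd at h
  linarith

/-- resultants and specialisation -/
theorem eval_res {A : Type*} [CommRing A] (e : A →+* ℂ) {F : A[X]} (hF : F.Monic) (G : A[X]) :
    e (resultant F G) ≠ 0 ↔ IsCoprime (F.map e) (G.map e) := by
  have hd : (F.map e).natDegree = F.natDegree := hF.natDegree_map e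
  obtain ⟨k, hk⟩ := Nat.exists_eq_add_of_le (natDegree_map_le (f := e) (p := G))
  rw [← resultant_map_map, hk, ← hd, resultant_add_right_deg _ _ _ _ _ le_rfl,
    (hF.map e).coeff_natDegree, one_pow, one_mul, ← isUnit_resultant_iff_isCoprime (hF.map e),
    isUnit_iff_ne_zero]

theorem eval_disc {F : ℂ[X][X]} (hF : F.Monic) (x : ℂ) :
    (resultant F (derivative F)).eval x ≠ 0 ↔ (fb F x).Separable := by
  have := eval_res (evalRingHom x) hF (derivative F)
  rw [← derivative_map] at this
  exact this

theorem coprime_of_roots {p q : ℂ[X]} (h : ∀ z, p.eval z = 0 → q.eval z ≠ 0) : IsCoprime p q := by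
  refine (Polynomial.isCoprime_iff_aeval_ne_zero_of_isAlgClosed ℂ ℂ p q).2 ?_
  intro a
  simp only [coe_aeval_eq_eval]
  by_cases ha : p.eval a = 0
  · exact Or.inr (h a ha)
  · exact Or.inl ha

theorem sep_shift {p : ℂ[X]} (hp : p.Separable) (t : ℂ) : (p.comp (X - C t)).Separable := by
  rw [separable_def, derivative_comp]
  have h := IsCoprime.map hp (compRingHom (X - C t))
  simpa using h

section
variable (P R : ℂ[X][X]) (hP : P.Monic) (hR : R.Monic)

def msec (s : ℂ × ℂ) : ℂ := ((bd P s.1 + bd R s.1 + ‖s.2‖ : ℝ) : ℂ)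

theorem msec_cont : Continuous (msec P R) := by
  have := bd_cont P
  have := bd_cont R
  unfold msec
  fun_prop

theorem msec_norm (s : ℂ × ℂ) : ‖msec P R s‖ = bd P s.1 + bd R s.1 + ‖s.2‖ := by
  rw [msec, Complex.norm_real, Real.norm_of_nonneg]
  have := bd_pos P s.1
  have := bd_pos R s.1
  positivity

theorem msec_P {P : ℂ[X][X]} (hP : P.Monic) (R : ℂ[X][X]) (s : ℂ × ℂ) :
    ev P s.1 (msec P R s) ≠ 0 := by
  apply bd_ne hP
  rw [msec_norm]
  have := bd_pos R s.1
  have := norm_nonneg s.2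
  linarith

theorem msec_R (P : ℂ[X][X]) {R : ℂ[X][X]} (hR : R.Monic) (s : ℂ × ℂ) :
    ev R s.1 (msec P R s - s.2) ≠ 0 := by
  apply bd_ne hR
  have h1 := norm_sub_norm_le (msec P R s) s.2
  rw [msec_norm] at h1
  have := bd_pos P s.1
  linarith

end

theorem pi1_change {X : Set (ℂ × ℂ)} (hX : IsPathConnected X) (a b : X) :
    Nonempty (FundamentalGroup X a ≃* FundamentalGroup X b) := by
  haveI : PathConnectedSpace X := isPathConnected_iff_pathConnectedSpace.1 hX
  exact ⟨FundamentalGroup.fundamentalGroupMulEquivOfPathConnected a b⟩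

theorem os_poly (P R K : ℂ[X][X]) (hP : P.Monic) (hR : R.Monic) (hK : K.Monic)
    (hK0 : (fb K 0).Separable)
    (hsep : ∀ w t, ev K t w ≠ 0 → (fb P w).Separable ∧ (fb R w).Separable ∧
      ∀ z, ev P w z = 0 → ev R w (z - t) ≠ 0)
    (X₁ X₂ X₁₂ : Set (ℂ × ℂ)) (h₁ : X₁ = {p | ev P p.1 p.2 ≠ 0}) (h₂ : X₂ = {p | ev R p.1 p.2 ≠ 0})
    (h₁₂ : X₁₂ = {p | ev P p.1 p.2 ≠ 0 ∧ ev R p.1 p.2 ≠ 0})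
    (x : ℂ × ℂ) (x1 : x ∈ X₁) (x2 : x ∈ X₂) (x12 : x ∈ X₁₂) :
    Nonempty (FundamentalGroup X₁₂ ⟨x, x12⟩ ≃* FundamentalGroup X₁ ⟨x, x1⟩ ×
      FundamentalGroup X₂ ⟨x, x2⟩) := by
  subst h₁ h₂ h₁₂
  let k : ℂ × ℂ → ℂ := fun q => ev K q.2 q.1
  have hkc : Continuous k := (ev_cont K).comp (f := fun q : ℂ × ℂ => (q.2, q.1)) (by fun_prop)
  have hkl : PolyLine k := ev_polyLine' K
  let D : Set (ℂ × ℂ) := {s | k s ≠ 0}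
  have hD : IsOpen D := isOpen_ne_fun hkc continuous_const
  -- the family over `t`
  let 𝓑 : Fam ℂ := ⟨ev K, ev_cont K, fun t => (bd K t : ℂ),
    Complex.continuous_ofReal.comp (bd_cont K), fun t => bd_ne hK (by
      rw [Complex.norm_real, Real.norm_of_nonneg (bd_pos K t).le])⟩
  let w₀ : ℂ := 𝓑.m 0
  have hw₀ : ev K 0 w₀ ≠ 0 := 𝓑.ne 0
  have hl₀ : iL w₀ ∈ D := hw₀
  let 𝒜 := fam2 (ev P) (ev R) (ev_cont P) (ev_cont R) (msec P R) (msec_cont P R)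
    (msec_P hP R) (msec_R P hR)
  -- local triviality of the main family
  have hpoly : ∀ s : ℂ × ℂ, ∀ z, 𝒜.A s z = (fb P s.1 * (fb R s.1).comp (X - C s.2)).eval z := by
    intro s z
    show ev P s.1 z * ev R s.1 (z - s.2) = _
    simp [ev]
  have hmon : ∀ s : ℂ × ℂ, (fb P s.1 * (fb R s.1).comp (X - C s.2)).Monic := fun s =>
    (fb_monic hP _).mul ((fb_monic hR _).comp (monic_X_sub_C _) (by simp))
  have hdeg : ∀ s : ℂ × ℂ, (fb P s.1 * (fb R s.1).comp (X - C s.2)).natDegree =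
      P.natDegree + R.natDegree := by
    intro s
    rw [(fb_monic hP _).natDegree_mul ((fb_monic hR _).comp (monic_X_sub_C _) (by simp)),
      natDegree_comp, natDegree_X_sub_C, mul_one, fb_deg hP, fb_deg hR]
  have hloc : 𝒜.LocTriv D := by
    refine loc_triv 𝒜 hD (P.natDegree + R.natDegree) (fun s => ?_) (fun s hs => ?_)
    · obtain ⟨σ, h, -⟩ := exists_factors _ (hmon s) _ (hdeg s)
      exact ⟨σ, fun z => by rw [hpoly, h]⟩
    · obtain ⟨σ, h, hi⟩ := exists_factors _ (hmon s) _ (hdeg s)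
      refine ⟨σ, hi ?_, fun z => by rw [hpoly, h]⟩
      obtain ⟨a1, a2, a3⟩ := hsep s.1 s.2 hs
      refine Separable.mul a1 (sep_shift a2 _) (coprime_of_roots fun z hz => ?_)
      have := a3 z hz
      simpa [ev] using this
  have hkne : ∃ s, k s ≠ 0 := ⟨(w₀, 0), hw₀⟩
  have hthin := thin_Tot 𝒜 hkl hkne
  have hkl' : PolyLine (fun w => k (iL w)) := by
    intro a v
    obtain ⟨p, hp⟩ := hkl (iL a) (iL v)
    refine ⟨p, fun l => ?_⟩
    rw [← hp l]
    congr 1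
    simp [iL_ap]
  have hthin' := thin_Tot (𝒜.pull iL) hkl' ⟨w₀, hw₀⟩
  have hfib : ∀ s, IsPathConnected (𝒜.Fib s) := by
    intro s
    have := thin_conn (eval_polyLine (fb P s.1 * (fb R s.1).comp (X - C s.2)))
      ⟨𝒜.m s, by rw [← hpoly]; exact 𝒜.ne s⟩
    have e : 𝒜.Fib s = {z | (fb P s.1 * (fb R s.1).comp (X - C s.2)).eval z ≠ 0} := by
      ext z
      simp only [Fam.Fib, mem_setOf_eq, hpoly]
    rw [e]
    exact this
  have hDc : IsPathConnected D := thin_conn hkl hkne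
  -- Zariski
  have hκ0 : (resultant K (derivative K)).eval 0 ≠ 0 := (eval_disc hK 0).2 hK0
  let D' : Set ℂ := {t | (resultant K (derivative K)).eval t ≠ 0}
  have hD' : IsOpen D' := isOpen_ne_fun (by fun_prop) continuous_const
  have hBloc : 𝓑.LocTriv D' := by
    refine loc_triv 𝓑 hD' K.natDegree (fun s => ?_) (fun s hs => ?_)
    · obtain ⟨σ, h, -⟩ := exists_factors _ (fb_monic hK s) _ (fb_deg hK s)
      exact ⟨σ, h⟩
    · obtain ⟨σ, h, hi⟩ := exists_factors _ (fb_monic hK s) _ (fb_deg hK s)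
      exact ⟨σ, hi ((eval_disc hK s).1 hs), h⟩
  have hBthin := thin_Tot 𝓑 (eval_polyLine (resultant K (derivative K))) ⟨0, hκ0⟩
  have hZ : ∀ β : Q (⟨iL w₀, hl₀⟩ : D) ⟨iL w₀, hl₀⟩, ∃ β' : Q (⟨w₀, hl₀⟩ : iL ⁻¹' D) ⟨w₀, hl₀⟩,
      mapE (Fam.iD iL D) (Fam.iD_mk iL D w₀ hl₀) (Fam.iD_mk iL D w₀ hl₀) β' = β := by
    intro β
    let sw : C(D, 𝓑.Tot univ) := ⟨fun x => ⟨(x.1.2, x.1.1), mem_univ _, x.2⟩, by fun_prop⟩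
    let sw' : C(𝓑.Tot univ, D) := ⟨fun x => ⟨(x.1.2, x.1.1), x.2.2⟩, by fun_prop⟩
    let id' : C(𝓑.Fib 0, iL ⁻¹' D) := ⟨fun x => ⟨x.1, x.2⟩, by fun_prop⟩
    let bD : D := ⟨iL w₀, hl₀⟩
    let bT : 𝓑.Tot univ := 𝓑.sec univ (Fam.un 0)
    have e1 : sw bD = bT := rfl
    have e2 : sw' bT = bD := rfl
    have e3 : id' (𝓑.bp 0) = (⟨w₀, hl₀⟩ : iL ⁻¹' D) := rfl
    obtain ⟨a, ha⟩ := 𝓑.lemmaA hD' hBloc hBthin 0 hκ0 (𝓑.bp 0) (mapE sw e1 e1 β)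
    refine ⟨mapE id' e3 e3 a, ?_⟩
    have f1 : mapE sw' e2 e2 (mapE sw e1 e1 β) = β :=
      (mapE_mapE sw sw' e1 e1 e2 e2 β).trans (mapE_id _ (fun x => rfl) _ _ _)
    refine Eq.trans ?_ f1
    refine Eq.trans ?_ (congrArg (mapE sw' e2 e2) ha)
    refine (mapE_mapE id' (Fam.iD iL D) e3 e3 _ _ a).trans (Eq.symm ?_)
    exact mapE_mapE (𝓑.inF (Fam.un 0)) sw' (x' := bT) (y' := bT) rfl rfl e2 e2 a
  -- conclusion
  let b : ℂ × ℂ := (w₀, msec P R (w₀, 0))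
  have b1 : ev P b.1 b.2 ≠ 0 := msec_P hP R (w₀, 0)
  have b2 : ev R b.1 b.2 ≠ 0 := by
    have := msec_R P hR (w₀, 0)
    simpa [b] using this
  obtain ⟨Φ⟩ := os_abs (ev P) (ev R) (ev_cont P) (ev_cont R) (msec P R) (msec_cont P R)
    (msec_P hP R) (msec_R P hR) D hD hloc hthin hthin' hfib hDc w₀ hl₀ hZ b rfl b1 b2 _ rfl ⟨b1, b2⟩
  have c1 : IsPathConnected {p : ℂ × ℂ | ev P p.1 p.2 ≠ 0} := thin_conn (ev_polyLine P) ⟨b, b1⟩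
  have c2 : IsPathConnected {p : ℂ × ℂ | ev R p.1 p.2 ≠ 0} := thin_conn (ev_polyLine R) ⟨b, b2⟩
  have c12 : IsPathConnected {p : ℂ × ℂ | ev P p.1 p.2 ≠ 0 ∧ ev R p.1 p.2 ≠ 0} := by
    have hl : PolyLine (fun q : ℂ × ℂ => ev P q.1 q.2 * ev R q.1 q.2) := by
      intro x v
      obtain ⟨p, hp⟩ := ev_polyLine P x v
      obtain ⟨q, hq⟩ := ev_polyLine R x v
      exact ⟨p * q, fun l => by rw [eval_mul, ← hp, ← hq]⟩
    have := thin_conn hl ⟨b, mul_ne_zero b1 b2⟩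
    have e : {p : ℂ × ℂ | ev P p.1 p.2 ≠ 0 ∧ ev R p.1 p.2 ≠ 0} =
        {s : ℂ × ℂ | ev P s.1 s.2 * ev R s.1 s.2 ≠ 0} := by
      ext q
      simp [mul_eq_zero, not_or]
    rw [e]
    exact this
  obtain ⟨u1⟩ := pi1_change c1 ⟨b, b1⟩ ⟨x, x1⟩
  obtain ⟨u2⟩ := pi1_change c2 ⟨b, b2⟩ ⟨x, x2⟩
  obtain ⟨u3⟩ := pi1_change c12 ⟨x, x12⟩ ⟨b, b1, b2⟩
  exact ⟨u3.trans (Φ.trans (MulEquiv.prodCongr u1 u2))⟩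

end
end OS


open Set Topology Polynomial
set_option linter.all false

namespace OS

noncomputable section

theorem growth_aux (q : ℂ[X]) (C₀ a : ℝ) (ha : 0 ≤ a) (N D : ℕ) (hND : N ≤ D) (hD : q.natDegree ≤ D)
    (h : ∀ w, ‖q.eval w‖ ≤ C₀ * (a + ‖w‖) ^ N) : ‖q.coeff D‖ ≤ C₀ * 0 ^ (D - N) := by
  have h1 : ∀ s : ℂ, s ≠ 0 → ‖(reflect D q).eval s‖ ≤ C₀ * (a * ‖s‖ + 1) ^ N * ‖s‖ ^ (D - N) := by
    intro s hs
    haveI : Invertible s⁻¹ := invertibleOfNonzero (inv_ne_zero hs)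
    have e := eval₂_reflect_mul_pow (RingHom.id ℂ) s⁻¹ D q hD
    have e2 : ⅟(s⁻¹) = s := by rw [invOf_eq_inv, inv_inv]
    rw [e2] at e
    have e3 : (reflect D q).eval s = q.eval s⁻¹ * s ^ D := by
      have : eval s (reflect D q) * s⁻¹ ^ D = eval s⁻¹ q := e
      rw [← this, mul_assoc, ← mul_pow, inv_mul_cancel₀ hs, one_pow, mul_one]
    have hs' : 0 < ‖s‖ := norm_pos_iff.2 hs
    rw [e3, norm_mul, norm_pow]
    calc _ ≤ (C₀ * (a + ‖s⁻¹‖) ^ N) * ‖s‖ ^ D := by gcongr; exact h _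
      _ = C₀ * ((a + ‖s⁻¹‖) * ‖s‖) ^ N * ‖s‖ ^ (D - N) := by
        rw [mul_pow, ← Nat.add_sub_cancel' hND, pow_add]
        simp only [Nat.add_sub_cancel_left]
        ring
      _ = _ := by
        rw [add_mul, norm_inv, inv_mul_cancel₀ hs'.ne']
  have h2 : (reflect D q).eval 0 = q.coeff D := by
    rw [← coeff_zero_eq_eval_zero, coeff_reflect, revAt_zero]
  have t1 : Filter.Tendsto (fun s : ℂ => ‖(reflect D q).eval s‖) (𝓝[≠] 0)
      (𝓝 ‖(reflect D q).eval 0‖) := by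
    have : Continuous fun s : ℂ => ‖(reflect D q).eval s‖ := by fun_prop
    exact this.continuousAt.tendsto.mono_left nhdsWithin_le_nhds
  have t2 : Filter.Tendsto (fun s : ℂ => C₀ * (a * ‖s‖ + 1) ^ N * ‖s‖ ^ (D - N)) (𝓝[≠] 0)
      (𝓝 (C₀ * (a * ‖(0 : ℂ)‖ + 1) ^ N * ‖(0 : ℂ)‖ ^ (D - N))) := by
    have : Continuous fun s : ℂ => C₀ * (a * ‖s‖ + 1) ^ N * ‖s‖ ^ (D - N) := by fun_prop
    exact this.continuousAt.tendsto.mono_left nhdsWithin_le_nhds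
  have := le_of_tendsto_of_tendsto t1 t2
    (Filter.eventually_of_mem self_mem_nhdsWithin fun s hs => h1 s hs)
  simpa [h2] using this

theorem growth (q : ℂ[X]) (C₀ a : ℝ) (ha : 0 ≤ a) (N : ℕ)
    (h : ∀ w, ‖q.eval w‖ ≤ C₀ * (a + ‖w‖) ^ N) : q.natDegree ≤ N ∧ ‖q.coeff N‖ ≤ C₀ := by
  have h1 : q.natDegree ≤ N := by
    by_contra hc
    push Not at hc
    have := growth_aux q C₀ a ha N q.natDegree hc.le le_rfl h
    rw [zero_pow (by omega), mul_zero, norm_le_zero_iff, coeff_natDegree,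
      leadingCoeff_eq_zero] at this
    rw [this] at hc
    simp at hc
  refine ⟨h1, ?_⟩
  simpa using growth_aux q C₀ a ha N N le_rfl h1 h

theorem bdd_const (q : ℂ[X]) (C₀ : ℝ) (h : ∀ w, ‖q.eval w‖ ≤ C₀) : q = C (q.eval 0) := by
  have := (growth q C₀ 0 le_rfl 0 (by simpa using h)).1
  rw [← coeff_zero_eq_eval_zero]
  exact eq_C_of_natDegree_le_zero this

theorem multiset_prod_le (s : Multiset ℂ) (M : ℝ) (h : ∀ x ∈ s, ‖x‖ ≤ M) :
    ‖s.prod‖ ≤ M ^ s.card := by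
  induction s using Multiset.induction_on with
  | empty => simp
  | cons a s ih =>
    rw [Multiset.prod_cons, Multiset.card_cons, norm_mul, pow_succ']
    have h1 := h a (Multiset.mem_cons_self _ _)
    have h2 := ih fun x hx => h x (Multiset.mem_cons_of_mem hx)
    exact mul_le_mul h1 h2 (norm_nonneg _) ((norm_nonneg _).trans h1)

theorem res_norm {p q : ℂ[X]} (hp : p.Monic) (hq : q.Monic) (M : ℝ)
    (h : ∀ x y, p.eval x = 0 → q.eval y = 0 → ‖x - y‖ ≤ M) :
    ‖resultant p q‖ ≤ M ^ (p.natDegree * q.natDegree) := by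
  have hps := IsAlgClosed.splits p
  have hqs := IsAlgClosed.splits q
  rw [resultant_eq_prod_roots_sub p q hp hq hps hqs]
  refine (multiset_prod_le _ M ?_).trans (le_of_eq ?_)
  · intro x hx
    obtain ⟨ij, hij, rfl⟩ := Multiset.mem_map.1 hx
    rw [Multiset.mem_product] at hij
    exact h _ _ (isRoot_of_mem_roots hij.1) (isRoot_of_mem_roots hij.2)
  · rw [Multiset.card_map, Multiset.card_product, ← hps.natDegree_eq_card_roots,
      ← hqs.natDegree_eq_card_roots]

/-- linear bound for the roots -/
def LB (F : ℂ[X][X]) : Prop := ∃ c : ℝ, 0 ≤ c ∧ ∀ w z, ev F w z = 0 → ‖z‖ ≤ c * (1 + ‖w‖)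

theorem ev_mul (F G : ℂ[X][X]) (w z : ℂ) : ev (F * G) w z = ev F w z * ev G w z := by
  simp [ev, fb]

theorem ev_add (F G : ℂ[X][X]) (w z : ℂ) : ev (F + G) w z = ev F w z + ev G w z := by
  simp [ev, fb]

theorem ev_C (p : ℂ[X]) (w z : ℂ) : ev (C p) w z = p.eval w := by
  simp [ev, fb]

theorem ev_X (w z : ℂ) : ev X w z = z := by
  simp [ev, fb]

theorem LB.of_dvd {F G : ℂ[X][X]} (h : LB G) (hd : F ∣ G) : LB F := by
  obtain ⟨c, hc, h⟩ := h
  obtain ⟨H, rfl⟩ := hd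
  exact ⟨c, hc, fun w z hz => h w z (by rw [ev_mul, hz, zero_mul])⟩

/-- the evaluation homomorphism -/
def evHom (t w : ℂ) : ℂ[X][X] →+* ℂ := (evalRingHom w).comp (mapRingHom (evalRingHom t))

theorem evHom_ap (t w : ℂ) (F : ℂ[X][X]) : evHom t w F = ev F t w := rfl

/-- resultant with a shift, polynomial in `t` then `w` -/
def resSh (P R : ℂ[X][X]) : ℂ[X][X] :=
  resultant (P.map (mapRingHom C)) ((R.map (mapRingHom C)).comp (X - C (C X)))

theorem evHom_C (t w : ℂ) : (evHom t w).comp (mapRingHom C) = evalRingHom w := by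
  ext <;> simp [evHom]

theorem resSh_maps (P R : ℂ[X][X]) (t w : ℂ) :
    (P.map (mapRingHom C)).map (evHom t w) = fb P w ∧
    ((R.map (mapRingHom C)).comp (X - C (C X))).map (evHom t w) = (fb R w).comp (X - C t) := by
  constructor
  · rw [map_map, evHom_C]; rfl
  · rw [Polynomial.map_comp, map_map, evHom_C]
    simp [fb, evHom]

theorem resSh_ne {P R : ℂ[X][X]} (hP : P.Monic) (t w : ℂ) :
    ev (resSh P R) t w ≠ 0 ↔ IsCoprime (fb P w) ((fb R w).comp (X - C t)) := by
  have := eval_res (evHom t w) (hP.map (mapRingHom C)) ((R.map (mapRingHom C)).comp (X - C (C X)))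
  rw [(resSh_maps P R t w).1, (resSh_maps P R t w).2] at this
  exact this

theorem resSh_eval {P R : ℂ[X][X]} (hP : P.Monic) (hR : R.Monic) (t w : ℂ) :
    ev (resSh P R) t w = resultant (fb P w) ((fb R w).comp (X - C t)) := by
  have hP' : (P.map (mapRingHom (C : ℂ →+* ℂ[X]))).Monic := hP.map _
  have hR' : ((R.map (mapRingHom (C : ℂ →+* ℂ[X]))).comp (X - C (C X))).Monic :=
    (hR.map _).comp (monic_X_sub_C _) (by simp)
  rw [← evHom_ap, resSh, ← resultant_map_map, ← hP'.natDegree_map (evHom t w),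
    ← hR'.natDegree_map (evHom t w), (resSh_maps P R t w).1, (resSh_maps P R t w).2]

theorem res_fb {P R : ℂ[X][X]} (hP : P.Monic) (hR : R.Monic) (w : ℂ) :
    (resultant P R).eval w = resultant (fb P w) (fb R w) := by
  rw [fb_deg hP, fb_deg hR]
  exact (resultant_map_map P R _ _ (evalRingHom w)).symm

theorem resSh_zero {P R : ℂ[X][X]} (hP : P.Monic) (hR : R.Monic) :
    fb (resSh P R) 0 = resultant P R := by
  refine Polynomial.funext fun w => ?_
  have := resSh_eval hP hR 0 w
  rw [C_0, sub_zero, comp_X, ← res_fb hP hR] at this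
  exact this

theorem resSh_bound {P R : ℂ[X][X]} (hP : P.Monic) (hR : R.Monic) (lP : LB P) (lR : LB R) :
    ∃ c : ℝ, 0 ≤ c ∧ ∀ t w, ‖ev (resSh P R) t w‖ ≤
      (c * (1 + ‖w‖) + ‖t‖) ^ (P.natDegree * R.natDegree) := by
  obtain ⟨a, ha, hA⟩ := lP
  obtain ⟨b, hb, hB⟩ := lR
  refine ⟨a + b, by positivity, fun t w => ?_⟩
  have hR' : ((fb R w).comp (X - C t)).Monic := (fb_monic hR w).comp (monic_X_sub_C _) (by simp)
  have hd : ((fb R w).comp (X - C t)).natDegree = R.natDegree := by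
    rw [natDegree_comp, natDegree_X_sub_C, mul_one, fb_deg hR]
  rw [resSh_eval hP hR]
  have := res_norm (fb_monic hP w) hR' ((a + b) * (1 + ‖w‖) + ‖t‖) (by
    intro x y hx hy
    have h1 := hA w x hx
    have h2 := hB w (y - t) (by simpa [ev] using hy)
    calc ‖x - y‖ = ‖x - (y - t) - t‖ := by congr 1; ring
      _ ≤ ‖x‖ + ‖y - t‖ + ‖t‖ := (norm_sub_le _ _).trans (by gcongr; exact norm_sub_le _ _)
      _ ≤ _ := by linarith)
  refine this.trans (le_of_eq ?_)
  rw [hd, fb_deg hP]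

theorem res_deg {P R : ℂ[X][X]} (hP : P.Monic) (hR : R.Monic) (lP : LB P) (lR : LB R) :
    (resultant P R).natDegree ≤ P.natDegree * R.natDegree := by
  obtain ⟨c, hc, h⟩ := resSh_bound hP hR lP lR
  refine (growth _ (c ^ (P.natDegree * R.natDegree)) 1 zero_le_one _ fun w => ?_).1
  rw [← resSh_zero hP hR, ← mul_pow]
  simpa [ev] using h 0 w

theorem resSh_top {P R : ℂ[X][X]} (hP : P.Monic) (hR : R.Monic) (lP : LB P) (lR : LB R) :
    (resSh P R).natDegree ≤ P.natDegree * R.natDegree ∧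
    (resSh P R).coeff (P.natDegree * R.natDegree) =
      C ((resultant P R).coeff (P.natDegree * R.natDegree)) := by
  obtain ⟨c, hc, h⟩ := resSh_bound hP hR lP lR
  set N := P.natDegree * R.natDegree with hN
  have h1 : ∀ t, (fb (resSh P R) t).natDegree ≤ N ∧ ‖(fb (resSh P R) t).coeff N‖ ≤ (c + 1) ^ N := by
    intro t
    refine growth _ ((c + 1) ^ N) (1 + ‖t‖) (by positivity) N fun w => ?_
    refine (h t w).trans ?_
    rw [← mul_pow]
    refine pow_le_pow_left₀ (by positivity) ?_ _
    have := norm_nonneg t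
    have := norm_nonneg w
    nlinarith [mul_nonneg hc (norm_nonneg t)]
  have hco : ∀ t i, (fb (resSh P R) t).coeff i = ((resSh P R).coeff i).eval t := fun t i => by
    simp [fb]
  constructor
  · refine natDegree_le_iff_coeff_eq_zero.2 fun i hi => Polynomial.funext fun t => ?_
    rw [← hco, eval_zero]
    exact coeff_eq_zero_of_natDegree_lt ((h1 t).1.trans_lt hi)
  · rw [bdd_const ((resSh P R).coeff N) ((c + 1) ^ N) fun t => by rw [← hco]; exact (h1 t).2,
      ← hco, resSh_zero hP hR]

/-- total degree bound -/
def TD (F : ℂ[X][X]) (d : ℕ) : Prop := ∀ i j, d < i + j → (F.coeff i).coeff j = 0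

theorem TD.add {F G : ℂ[X][X]} {d : ℕ} (hF : TD F d) (hG : TD G d) : TD (F + G) d := by
  intro i j h
  simp [hF i j h, hG i j h]

theorem TD.mono {F : ℂ[X][X]} {d e : ℕ} (hF : TD F d) (h : d ≤ e) : TD F e :=
  fun i j hij => hF i j (by omega)

theorem TD.mul {F G : ℂ[X][X]} {d e : ℕ} (hF : TD F d) (hG : TD G e) : TD (F * G) (d + e) := by
  intro i j h
  rw [coeff_mul, finsetSum_coeff]
  refine Finset.sum_eq_zero fun a ha => ?_
  rw [coeff_mul]
  refine Finset.sum_eq_zero fun b hb => ?_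
  rw [Finset.HasAntidiagonal.mem_antidiagonal] at ha hb
  rcases le_or_gt (a.1 + b.1) d with h1 | h1
  · rw [hG a.2 b.2 (by omega), mul_zero]
  · rw [hF a.1 b.1 h1, zero_mul]

theorem TD.one : TD 1 0 := by
  intro i j h
  rw [coeff_one]
  split_ifs with hi
  · rw [coeff_one, if_neg (by omega)]
  · simp

theorem TD.pow {F : ℂ[X][X]} {d : ℕ} (hF : TD F d) (n : ℕ) : TD (F ^ n) (n * d) := by
  induction n with
  | zero => simpa using TD.one
  | succ n ih => rw [pow_succ, add_mul, one_mul]; exact ih.mul hF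

theorem TD.const (c : ℂ) : TD (C (C c)) 0 := by
  intro i j h
  rw [coeff_C]
  split_ifs with hi
  · rw [coeff_C, if_neg (by omega)]
  · simp

theorem TD.X0 : TD (C X) 1 := by
  intro i j h
  rw [coeff_C]
  split_ifs with hi
  · rw [coeff_X, if_neg (by omega)]
  · simp

theorem TD.X1 : TD X 1 := by
  intro i j h
  rw [coeff_X]
  split_ifs with hi
  · rw [coeff_one, if_neg (by omega)]
  · simp

theorem TD.zero (d : ℕ) : TD 0 d := by
  intro i j h
  simp

theorem poly_bound (p : ℂ[X]) (k : ℕ) (h : p.natDegree ≤ k) : ∃ c : ℝ, 0 ≤ c ∧ ∀ w,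
    ‖p.eval w‖ ≤ c * (1 + ‖w‖) ^ k := by
  refine ⟨∑ i ∈ Finset.range (p.natDegree + 1), ‖p.coeff i‖, by positivity, fun w => ?_⟩
  rw [eval_eq_sum_range, Finset.sum_mul]
  refine (norm_sum_le _ _).trans (Finset.sum_le_sum fun i hi => ?_)
  rw [norm_mul, norm_pow]
  gcongr
  calc ‖w‖ ^ i ≤ (1 + ‖w‖) ^ i := by gcongr; linarith
    _ ≤ _ := pow_le_pow_right₀ (by linarith [norm_nonneg w]) (by
      have := Finset.mem_range.1 hi; omega)

theorem TD.lb {F : ℂ[X][X]} (hm : F.Monic) (h : TD F F.natDegree) : LB F := by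
  set d := F.natDegree with hd
  have h1 : ∀ i : ℕ, ∃ c : ℝ, 0 ≤ c ∧ (i < d → ∀ w, ‖(F.coeff i).eval w‖ ≤ c * (1 + ‖w‖) ^ (d - i)) := by
    intro i
    by_cases hi : i < d
    · obtain ⟨c, hc, h'⟩ := poly_bound (F.coeff i) (d - i)
        (natDegree_le_iff_coeff_eq_zero.2 fun j hj => h i j (by omega))
      exact ⟨c, hc, fun _ => h'⟩
    · exact ⟨0, le_rfl, fun h => absurd h hi⟩
  choose c hc h1 using h1
  refine ⟨1 + ∑ i ∈ Finset.range d, c i, by have := Finset.sum_nonneg fun i (_ : i ∈ Finset.range d) => hc i; linarith,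
    fun w z hz => ?_⟩
  have hS := Finset.sum_nonneg fun i (_ : i ∈ Finset.range d) => hc i
  set S := ∑ i ∈ Finset.range d, c i with hSd
  set A := 1 + ‖w‖ with hA
  have hA1 : 1 ≤ A := by linarith [norm_nonneg w]
  by_contra hcon
  push Not at hcon
  have hz1 : A ≤ ‖z‖ := by nlinarith
  have hzp : 0 < ‖z‖ := by linarith
  rw [ev_sum, Finset.sum_range_succ, ← hd, hm.coeff_natDegree, eval_one, one_mul] at hz
  rcases Nat.eq_zero_or_pos d with h0 | hpos
  · simp [h0] at hz
  have e : z ^ d = - ∑ i ∈ Finset.range d, (F.coeff i).eval w * z ^ i := by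
    linear_combination hz
  have e2 : ‖z‖ ^ d ≤ ∑ i ∈ Finset.range d, c i * (A * ‖z‖ ^ (d - 1)) := by
    rw [← norm_pow, e, norm_neg]
    refine (norm_sum_le _ _).trans (Finset.sum_le_sum fun i hi => ?_)
    have hi := Finset.mem_range.1 hi
    rw [norm_mul, norm_pow]
    calc _ ≤ c i * A ^ (d - i) * ‖z‖ ^ i := by gcongr; exact h1 i hi w
      _ = c i * (A * (A ^ (d - 1 - i) * ‖z‖ ^ i)) := by
        rw [show d - i = (d - 1 - i) + 1 by omega, pow_succ]; ring
      _ ≤ c i * (A * (‖z‖ ^ (d - 1 - i) * ‖z‖ ^ i)) := by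
        have := hc i
        gcongr
      _ = _ := by rw [← pow_add]; congr 3; omega
  rw [← Finset.sum_mul, ← hSd, show d = (d - 1) + 1 by omega, pow_succ] at e2
  simp only [Nat.add_sub_cancel] at e2
  have hp : 0 < ‖z‖ ^ (d - 1) := by positivity
  have : ‖z‖ ≤ S * A := by
    by_contra hh
    push Not at hh
    nlinarith
  nlinarith

end
end OS


open Set Topology Polynomial
set_option linter.all false

namespace OS

noncomputable section

/-- derivative with respect to the coefficient variable -/
def Dw (F : ℂ[X][X]) : ℂ[X][X] := Bivariate.swap (derivative (Bivariate.swap F))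

theorem Dw_add (F G : ℂ[X][X]) : Dw (F + G) = Dw F + Dw G := by
  simp only [Dw, map_add]

theorem Dw_mul (F G : ℂ[X][X]) : Dw (F * G) = Dw F * G + F * Dw G := by
  simp only [Dw, map_mul, derivative_mul, map_add, Bivariate.swap_swap_apply]

theorem Dw_C (p : ℂ[X]) : Dw (C p) = C (derivative p) := by
  rw [Dw, Bivariate.swap_C, derivative_map, Bivariate.swap_map_C]

theorem Dw_X : Dw X = 0 := by
  rw [Dw, Bivariate.swap_Y, derivative_C, map_zero]

theorem Dw_monomial (n : ℕ) (p : ℂ[X]) : Dw (monomial n p) = monomial n (derivative p) := by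
  have h : ∀ n : ℕ, Dw ((X : ℂ[X][X]) ^ n) = 0 := by
    intro n
    induction n with
    | zero => rw [pow_zero, ← C_1, Dw_C]; simp
    | succ n ih => rw [pow_succ, Dw_mul, ih, Dw_X]; simp
  rw [← C_mul_X_pow_eq_monomial, ← C_mul_X_pow_eq_monomial, Dw_mul, h, Dw_C]
  simp

theorem Dw_coeff (F : ℂ[X][X]) (i : ℕ) : (Dw F).coeff i = derivative (F.coeff i) := by
  induction F using Polynomial.induction_on' with
  | add p q hp hq => rw [Dw_add, coeff_add, hp, hq, coeff_add, derivative_add]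
  | monomial n p =>
    rw [Dw_monomial, coeff_monomial, coeff_monomial]
    split_ifs <;> simp

theorem ev_smul (c : ℂ) (F : ℂ[X][X]) (w z : ℂ) : ev (C (C c) * F) w z = c * ev F w z := by
  rw [ev_mul, ev_C, eval_C]

/-- restriction to a line -/
def Ln (a u b v : ℂ) : ℂ[X][X] →+* ℂ[X] :=
  eval₂RingHom (compRingHom (C a + X * C u)) (C b + X * C v)

theorem Ln_C (a u b v : ℂ) (p : ℂ[X]) : Ln a u b v (C p) = p.comp (C a + X * C u) := by
  simp [Ln]

theorem Ln_X (a u b v : ℂ) : Ln a u b v X = C b + X * C v := by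
  simp [Ln]

theorem Ln_eval (a u b v : ℂ) (F : ℂ[X][X]) (l : ℂ) :
    (Ln a u b v F).eval l = ev F (a + l * u) (b + l * v) := by
  induction F using Polynomial.induction_on' with
  | add p q hp hq => rw [map_add, eval_add, hp, hq, ev_add]
  | monomial n p =>
    rw [← C_mul_X_pow_eq_monomial, map_mul, map_pow, Ln_C, Ln_X]
    simp only [ev, fb, Polynomial.map_mul, Polynomial.map_pow, map_X, map_C, eval_mul, eval_pow,
      eval_comp, eval_add, eval_X, eval_C, coe_evalRingHom]

theorem Ln_deriv (a u b v : ℂ) (F : ℂ[X][X]) :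
    derivative (Ln a u b v F) = C u * Ln a u b v (Dw F) + C v * Ln a u b v (derivative F) := by
  have hX : ∀ n : ℕ, derivative (Ln a u b v (X ^ n)) = C v * Ln a u b v (derivative (X ^ n)) := by
    intro n
    rw [map_pow, Ln_X, derivative_pow, derivative_X_pow, map_mul, Ln_C, map_pow, Ln_X]
    simp
    ring
  induction F using Polynomial.induction_on' with
  | add p q hp hq => rw [map_add, derivative_add, hp, hq, Dw_add, derivative_add, map_add, map_add]; ring
  | monomial n p =>
    rw [Dw_monomial, ← C_mul_X_pow_eq_monomial, ← C_mul_X_pow_eq_monomial, map_mul, derivative_mul,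
      hX, derivative_mul, derivative_C, zero_mul, zero_add, map_mul, map_mul, Ln_C, Ln_C,
      derivative_comp]
    simp
    ring

/-- normalising divisors of monic polynomials -/
theorem exists_monic {F P : ℂ[X][X]} (hP : P.Monic) (h : F ∣ P) :
    ∃ F', F'.Monic ∧ Associated F F' := by
  obtain ⟨G, rfl⟩ := h
  have h1 : F.leadingCoeff * G.leadingCoeff = 1 := by
    rw [← leadingCoeff_mul]; exact hP
  refine ⟨C G.leadingCoeff * F, monic_C_mul_of_mul_leadingCoeff_eq_one (by rw [mul_comm]; exact h1), ?_⟩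
  have hu : IsUnit (C G.leadingCoeff : ℂ[X][X]) :=
    isUnit_C.2 (IsUnit.of_mul_eq_one F.leadingCoeff (by rw [mul_comm]; exact h1))
  obtain ⟨u, hu⟩ := hu
  exact ⟨u, by rw [hu, mul_comm]⟩

theorem fin_roots {h : ℂ[X][X]} (hm : h.Monic) (w : ℂ) : {z | ev h w z = 0}.Finite := by
  refine ((fb h w).roots.toFinset.finite_toSet).subset fun z hz => ?_
  simp only [Finset.mem_coe, Multiset.mem_toFinset]
  exact (mem_roots (fb_monic hm w).ne_zero).2 hz

theorem fin_zeros {q : ℂ[X]} (hq : q ≠ 0) : {z | q.eval z = 0}.Finite := by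
  refine (q.roots.toFinset.finite_toSet).subset fun z hz => ?_
  simp only [Finset.mem_coe, Multiset.mem_toFinset]
  exact (mem_roots hq).2 hz

theorem res_zero_of_common {P : ℂ[X][X]} (hP : P.Monic) {R : ℂ[X][X]} {w z : ℂ}
    (h1 : ev P w z = 0) (h2 : ev R w z = 0) : (resultant P R).eval w = 0 := by
  by_contra hc
  obtain ⟨a, b, hab⟩ := (eval_res (evalRingHom w) hP R).1 hc
  have := congrArg (eval z) hab
  rw [eval_add, eval_mul, eval_mul] at this
  change eval z a * ev P w z + eval z b * ev R w z = _ at this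
  rw [h1, h2] at this
  simp at this

theorem common_of_res_zero {P : ℂ[X][X]} (hP : P.Monic) {R : ℂ[X][X]} {w : ℂ}
    (h : (resultant P R).eval w = 0) : ∃ z, ev P w z = 0 ∧ ev R w z = 0 := by
  by_contra hc
  push Not at hc
  exact (eval_res (evalRingHom w) hP R).2 (coprime_of_roots hc) h

theorem dvd_of_res {K : Type*} [Field K] [Algebra ℂ[X] K] [IsFractionRing ℂ[X] K] {h e : ℂ[X][X]}
    (hm : h.Monic) (hi : Irreducible h) (hr : resultant h e = 0) : h ∣ e := by
  have hinj : Function.Injective (algebraMap ℂ[X] K) := IsFractionRing.injective _ _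
  have hK : (h.map (algebraMap ℂ[X] K)).Monic := hm.map _
  have hirr : Irreducible (h.map (algebraMap ℂ[X] K)) :=
    (hm.irreducible_iff_irreducible_map_fraction_map).1 hi
  have hres : resultant (h.map (algebraMap ℂ[X] K)) (e.map (algebraMap ℂ[X] K)) = 0 := by
    rw [natDegree_map_eq_of_injective hinj, natDegree_map_eq_of_injective hinj, resultant_map_map,
      hr, map_zero]
  have hnc : ¬ IsCoprime (h.map (algebraMap ℂ[X] K)) (e.map (algebraMap ℂ[X] K)) := by
    rw [← isUnit_resultant_iff_isCoprime hK, hres]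
    exact not_isUnit_zero
  rw [hirr.coprime_iff_not_dvd, not_not] at hnc
  exact (Polynomial.map_dvd_map _ hinj hm).1 hnc

/-- weak Bezout -/
theorem dvd_of_infinite {h e : ℂ[X][X]} (hm : h.Monic) (hi : Irreducible h) {T : Set (ℂ × ℂ)}
    (hT : T.Infinite) (h1 : ∀ q ∈ T, ev h q.1 q.2 = 0) (h2 : ∀ q ∈ T, ev e q.1 q.2 = 0) : h ∣ e := by
  have hr : resultant h e = 0 := by
    by_contra hr
    apply hT
    have hf := fin_zeros hr
    refine (hf.biUnion (t := fun w => (fun z => (w, z)) '' {z | ev h w z = 0})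
      fun w _ => (fin_roots hm w).image _).subset fun q hq => ?_
    simp only [mem_iUnion]
    exact ⟨q.1, res_zero_of_common hm (h1 q hq) (h2 q hq), q.2, h1 q hq, rfl⟩
  exact dvd_of_res (K := FractionRing ℂ[X]) hm hi hr

theorem multiset_ev_prod (s : Multiset ℂ[X][X]) (w z : ℂ) (h : ev s.prod w z = 0) :
    ∃ F ∈ s, ev F w z = 0 := by
  induction s using Multiset.induction_on with
  | empty =>
    rw [Multiset.prod_zero, ← C_1, ev_C, eval_one] at h
    exact absurd h one_ne_zero
  | cons a s ih =>
    rw [Multiset.prod_cons, ev_mul, mul_eq_zero] at h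
    rcases h with h | h
    · exact ⟨a, Multiset.mem_cons_self _ _, h⟩
    · obtain ⟨F, hF, h⟩ := ih h
      exact ⟨F, Multiset.mem_cons_of_mem hF, h⟩

theorem ev_dvd {F G : ℂ[X][X]} (h : F ∣ G) {w z : ℂ} (hz : ev F w z = 0) : ev G w z = 0 := by
  obtain ⟨H, rfl⟩ := h
  rw [ev_mul, hz, zero_mul]

theorem sq_lemma {P : ℂ[X][X]} (hP : P.Monic) (hs : Squarefree P) (𝒟 : ℂ[X][X] → ℂ[X][X])
    (h𝒟 : ∀ F G, 𝒟 (F * G) = 𝒟 F * G + F * 𝒟 G) {T : Set (ℂ × ℂ)} (hT : T.Infinite)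
    (h1 : ∀ q ∈ T, ev P q.1 q.2 = 0) (h2 : ∀ q ∈ T, ev (𝒟 P) q.1 q.2 = 0) :
    ∃ h : ℂ[X][X], h.Monic ∧ h ∣ 𝒟 h ∧ {q ∈ T | ev h q.1 q.2 = 0}.Infinite := by
  obtain ⟨s, hsp, hsa⟩ := UniqueFactorizationMonoid.exists_prime_factors P hP.ne_zero
  have key : ∃ F ∈ s, {q ∈ T | ev F q.1 q.2 = 0}.Infinite := by
    by_contra hc
    push Not at hc
    apply hT
    classical
    refine ((s.toFinset.finite_toSet).biUnion (t := fun F => {q ∈ T | ev F q.1 q.2 = 0})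
      fun F hF => hc F (by simpa using hF)).subset fun q hq => ?_
    obtain ⟨F, hF, h⟩ := multiset_ev_prod s q.1 q.2 (ev_dvd hsa.symm.dvd (h1 q hq))
    simp only [mem_iUnion]
    exact ⟨F, by simpa using hF, hq, h⟩
  obtain ⟨F, hF, hinf⟩ := key
  have hFP : F ∣ P := (Multiset.dvd_prod hF).trans hsa.dvd
  obtain ⟨h, hm, ha⟩ := exists_monic hP hFP
  have hpr : Prime h := ha.prime (hsp F hF)
  have hTh : {q ∈ T | ev h q.1 q.2 = 0}.Infinite :=
    hinf.mono fun q hq => ⟨hq.1, ev_dvd ha.dvd hq.2⟩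
  refine ⟨h, hm, ?_, hTh⟩
  obtain ⟨g, rfl⟩ := ha.symm.dvd.trans hFP
  have hd : h ∣ 𝒟 h * g := by
    refine dvd_of_infinite hm hpr.irreducible hTh (fun q hq => hq.2) fun q hq => ?_
    have := h2 q hq.1
    rw [h𝒟, ev_add, ev_mul h, hq.2, zero_mul, add_zero] at this
    exact this
  rcases hpr.dvd_or_dvd hd with h | h
  · exact h
  · exact absurd (hs _ (mul_dvd_mul_left _ h)) hpr.not_unit

/-- Euler derivation centred at `(a, b)` -/
def Eu (a b : ℂ) (F : ℂ[X][X]) : ℂ[X][X] := C (X - C a) * Dw F + (X - C (C b)) * derivative F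

theorem Eu_mul (a b : ℂ) (F G : ℂ[X][X]) : Eu a b (F * G) = Eu a b F * G + F * Eu a b G := by
  simp only [Eu, Dw_mul, derivative_mul]
  ring

theorem Eu_eq {a b : ℂ} {h : ℂ[X][X]} (hm : h.Monic) (hd : h ∣ Eu a b h) :
    Eu a b h = C (C (h.natDegree : ℂ)) * h := by
  by_contra hc
  set n := h.natDegree with hn
  have hne : Eu a b h - C (C (n : ℂ)) * h ≠ 0 := sub_ne_zero.2 hc
  have hdv : h ∣ Eu a b h - C (C (n : ℂ)) * h := dvd_sub hd (Dvd.intro_left _ rfl)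
  have hco : ∀ i, n ≤ i → (Eu a b h - C (C (n : ℂ)) * h).coeff i = 0 := by
    intro i hi
    have e1 : (X * derivative h).coeff i = (i : ℂ[X]) * h.coeff i := by
      cases i with
      | zero => simp
      | succ i => rw [coeff_X_mul, coeff_derivative]; push_cast; ring
    have e2 : derivative (h.coeff i) = 0 := by
      rcases hi.lt_or_eq with h1 | h1
      · rw [coeff_eq_zero_of_natDegree_lt h1, derivative_zero]
      · rw [← h1, hm.coeff_natDegree, derivative_one]
    have e3 : (derivative h).coeff i = 0 := by
      rw [coeff_derivative, coeff_eq_zero_of_natDegree_lt (by omega), zero_mul]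
    rw [coeff_sub, Eu, coeff_add, coeff_C_mul, Dw_coeff, e2, mul_zero, zero_add, sub_mul, coeff_sub, e1, coeff_C_mul, e3,
      coeff_C_mul]
    rcases hi.lt_or_eq with h1 | h1
    · rw [coeff_eq_zero_of_natDegree_lt h1]; simp
    · rw [← h1, hm.coeff_natDegree]; simp
  have hlt : (Eu a b h - C (C (n : ℂ)) * h).natDegree < n := by
    by_contra hh
    push Not at hh
    have := hco _ hh
    rw [coeff_natDegree, leadingCoeff_eq_zero] at this
    exact hne this
  exact hm.not_dvd_of_natDegree_lt hne hlt hdv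

theorem euler_poly {φ : ℂ[X]} {n : ℕ} (h : X * derivative φ = C (n : ℂ) * φ) (h1 : φ.eval 1 = 0) :
    φ = 0 := by
  have hc : ∀ i, i ≠ n → φ.coeff i = 0 := by
    intro i hi
    have := congrArg (fun p => coeff p i) h
    simp only [coeff_C_mul] at this
    have e1 : (X * derivative φ).coeff i = (i : ℂ) * φ.coeff i := by
      cases i with
      | zero => simp
      | succ i => rw [coeff_X_mul, coeff_derivative]; push_cast; ring
    rw [e1] at this
    have h2 : ((i : ℂ) - n) * φ.coeff i = 0 := by linear_combination this
    rcases mul_eq_zero.1 h2 with h3 | h3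
    · exact absurd (by exact_mod_cast sub_eq_zero.1 h3) hi
    · exact h3
  have hm : φ = monomial n (φ.coeff n) := by
    ext i
    rw [coeff_monomial]
    split_ifs with h
    · rw [h]
    · exact hc i (Ne.symm h)
  rw [hm] at h1
  simp at h1
  rw [hm, h1, monomial_zero_right]

theorem cone_lemma {a b : ℂ} {h : ℂ[X][X]} (hm : h.Monic) (hd : h ∣ Eu a b h) {u v : ℂ}
    (h0 : ev h (a + u) (b + v) = 0) (l : ℂ) : ev h (a + l * u) (b + l * v) = 0 := by
  rw [← Ln_eval]
  have e : X * derivative (Ln a u b v h) = C (h.natDegree : ℂ) * Ln a u b v h := by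
    have := congrArg (Ln a u b v) (Eu_eq hm hd)
    rw [Eu, map_add, map_mul, map_mul, map_mul, Ln_C, (Ln a u b v).map_sub, Ln_X, Ln_C, Ln_C] at this
    simp only [sub_comp, X_comp, C_comp] at this
    rw [Ln_deriv, ← this]
    ring
  rw [euler_poly e (by rw [Ln_eval]; simpa using h0), eval_zero]

theorem pencil {P : ℂ[X][X]} (hP : P.Monic) (hs : Squarefree P) (a b : ℂ)
    (hg : ev (Dw P) a b ≠ 0 ∨ ev (derivative P) a b ≠ 0) :
    {u : ℂ | ∃ l : ℂ, ev P (a + l * u) (b + l) = 0 ∧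
      u * ev (Dw P) (a + l * u) (b + l) + ev (derivative P) (a + l * u) (b + l) = 0}.Finite := by
  set U := {u : ℂ | ∃ l : ℂ, ev P (a + l * u) (b + l) = 0 ∧
      u * ev (Dw P) (a + l * u) (b + l) + ev (derivative P) (a + l * u) (b + l) = 0} with hU
  by_contra hinf
  have hinf : U.Infinite := hinf
  set B : Set ℂ := {0} ∪ {u | u * ev (Dw P) a b + ev (derivative P) a b = 0} with hB
  have hBf : B.Finite := by
    refine (finite_singleton 0).union ?_
    refine (finite_singleton (-ev (derivative P) a b / ev (Dw P) a b)).subset fun u hu => ?_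
    simp only [mem_setOf_eq] at hu
    by_cases hz : ev (Dw P) a b = 0
    · rw [hz, mul_zero, zero_add] at hu
      rcases hg with h | h
      · exact absurd hz h
      · exact absurd hu h
    · rw [mem_singleton_iff, eq_div_iff hz]
      linear_combination hu
  have hU' : (U \ B).Infinite := hinf.diff hBf
  choose! l hl1 hl2 using (fun u (hu : u ∈ U) => hu)
  have hl0 : ∀ u ∈ U \ B, l u ≠ 0 := by
    intro u hu h0
    have := hl2 u hu.1
    rw [h0] at this
    simp only [zero_mul, add_zero] at this
    exact hu.2 (Or.inr this)
  let q : ℂ → ℂ × ℂ := fun u => (a + l u * u, b + l u)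
  have hinj : InjOn q (U \ B) := by
    intro u hu v hv huv
    have e1 : a + l u * u = a + l v * v := congrArg Prod.fst huv
    have e2 : b + l u = b + l v := congrArg Prod.snd huv
    have e3 : l u = l v := add_left_cancel e2
    rw [← e3] at e1
    exact mul_left_cancel₀ (hl0 u hu) (add_left_cancel e1)
  have hT : (q '' (U \ B)).Infinite := hU'.image hinj
  obtain ⟨h, hm, hd, hTh⟩ := sq_lemma hP hs (Eu a b) (Eu_mul a b) hT
    (by rintro _ ⟨u, hu, rfl⟩; exact hl1 u hu.1)
    (by
      rintro _ ⟨u, hu, rfl⟩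
      have := hl2 u hu.1
      rw [Eu, ev_add, ev_mul, ev_mul, ev_C]
      have e : ev (X - C (C b)) (q u).1 (q u).2 = l u := by
        simp [ev, fb, q]
      rw [e]
      simp only [q, eval_sub, eval_X, eval_C]
      linear_combination l u * this)
  have hUh : {u ∈ U \ B | ev h (q u).1 (q u).2 = 0}.Infinite := by
    intro hf
    apply hTh
    refine (hf.image q).subset ?_
    rintro _ ⟨⟨u, hu, rfl⟩, hq⟩
    exact ⟨u, ⟨hu, hq⟩, rfl⟩
  have hinj2 : InjOn (fun u : ℂ => b + u⁻¹) {u ∈ U \ B | ev h (q u).1 (q u).2 = 0} := by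
    intro u _ v _ huv
    exact inv_injective (add_left_cancel huv)
  apply hUh.image hinj2
  refine (fin_roots hm (a + 1)).subset ?_
  rintro _ ⟨u, ⟨hu, hq⟩, rfl⟩
  have hl := hl0 u hu
  have hu0 : u ≠ 0 := fun h0 => hu.2 (Or.inl h0)
  have := cone_lemma hm hd (u := l u * u) (v := l u) hq ((l u * u)⁻¹)
  rw [inv_mul_cancel₀ (mul_ne_zero hl hu0)] at this
  have e : (l u * u)⁻¹ * l u = u⁻¹ := by field_simp
  rw [e] at this
  exact this

end
end OS


open Set Topology Polynomial
set_option linter.all false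

namespace OS

noncomputable section

theorem res_ne {P R : ℂ[X][X]} (hP : P.Monic)
    (hfin : {q : ℂ × ℂ | ev P q.1 q.2 = 0 ∧ ev R q.1 q.2 = 0}.Finite) : resultant P R ≠ 0 := by
  intro h0
  have h1 : ∀ w : ℂ, ∃ z, ev P w z = 0 ∧ ev R w z = 0 := fun w =>
    common_of_res_zero hP (by rw [h0, eval_zero])
  choose z hz using h1
  have hinj : Function.Injective fun w : ℂ => (w, z w) := fun a b h => congrArg Prod.fst h
  exact (infinite_range_of_injective hinj) (hfin.subset (by rintro _ ⟨w, rfl⟩; exact hz w))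

theorem sep_of_roots {q : ℂ[X]} (hq : q ≠ 0) (W : Finset ℂ) (hW : q.natDegree ≤ W.card)
    (hz : ∀ w ∈ W, q.eval w = 0) : q.natDegree = W.card ∧ q.Separable := by
  have h1 : W.val ≤ q.roots := (Multiset.le_iff_subset W.nodup).2 fun w hw =>
    (mem_roots hq).2 (hz w hw)
  have h2 := (card_roots' q)
  have h3 := Multiset.card_le_card h1
  have h4 : W.val = q.roots := Multiset.eq_of_le_of_card_le h1 (h2.trans hW)
  have h5 : W.card ≤ q.roots.card := h3
  refine ⟨by omega, (nodup_roots_iff_of_splits hq (IsAlgClosed.splits q)).1 ?_⟩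
  rw [← h4]
  exact W.nodup

theorem sqf {P R : ℂ[X][X]} (hP : P.Monic) (hR : R.Monic) (lP : LB P) (lR : LB R)
    (hR0 : R.natDegree ≠ 0) (hd : (resultant P R).natDegree = P.natDegree * R.natDegree)
    (hs : (resultant P R).Separable) : Squarefree P := by
  intro x hx
  obtain ⟨h, hm, ha⟩ := exists_monic hP ((dvd_mul_right x x).trans hx)
  have hhP : h * h ∣ P := (mul_dvd_mul ha.symm.dvd ha.symm.dvd).trans hx
  obtain ⟨g, rfl⟩ := hhP
  have hhm : (h * h).Monic := hm.mul hm
  have hg : g.Monic := hhm.of_mul_monic_left hP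
  have hdeg : (h * h * g).natDegree = h.natDegree + h.natDegree + g.natDegree := by
    rw [hhm.natDegree_mul hg, hm.natDegree_mul hm]
  have e1 : resultant (h * h * g) R = resultant h R * resultant h R * resultant g R := by
    have a1 := resultant_mul_left (h * h) g R R.natDegree le_rfl
    have a2 := resultant_mul_left h h R R.natDegree le_rfl
    rw [hhm.natDegree_mul hg, a1, hm.natDegree_mul hm, a2]
  have hu : IsUnit (resultant h R) := hs.squarefree _ ⟨resultant g R, e1⟩
  have hgd := res_deg hg hR (lP.of_dvd (Dvd.intro_left _ rfl)) lR
  have hle : (resultant (h * h * g) R).natDegree ≤ g.natDegree * R.natDegree := by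
    rw [e1]
    refine natDegree_mul_le.trans ?_
    have : (resultant h R * resultant h R).natDegree = 0 := natDegree_eq_zero_of_isUnit (hu.mul hu)
    omega
  rw [hd, hdeg] at hle
  have h0 : h.natDegree = 0 := by
    have := Nat.le_of_mul_le_mul_right hle (Nat.pos_of_ne_zero hR0)
    omega
  have h1 : h = 1 := hm.natDegree_eq_zero.1 h0
  rw [h1] at ha
  exact associated_one_iff_isUnit.1 ha

theorem ev_zero' (w z : ℂ) : ev 0 w z = 0 := by simp [ev, fb]

theorem grad {P R : ℂ[X][X]} (hR0 : R.natDegree ≠ 0) (hs : (resultant P R).Separable) {a b : ℂ}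
    (hr : (resultant P R).eval a = 0)
    (h1 : ev P a b = 0) (h2 : ev R a b = 0) (h3 : ev (Dw P) a b = 0) (h4 : ev (derivative P) a b = 0) :
    ev (derivative R) a b = 0 ∧ ev (Dw R) a b ≠ 0 := by
  obtain ⟨p, q, -, -, h⟩ := exists_mul_add_mul_eq_C_resultant P R le_rfl le_rfl (Or.inr hR0)
  have e1 := congrArg (fun F => ev (Dw F) a b) h
  have e2 := congrArg (fun F => ev (derivative F) a b) h
  simp only [Dw_add, Dw_mul, Dw_C, ev_add, ev_mul, ev_C, h1, h2, h3] at e1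
  simp only [derivative_add, derivative_mul, derivative_C, ev_add, ev_mul, ev_zero', h1, h2, h4] at e2
  have hne : (derivative (resultant P R)).eval a ≠ 0 := by
    have := hs.aeval_derivative_ne_zero (x := a) (by rw [coe_aeval_eq_eval]; exact hr)
    rwa [coe_aeval_eq_eval] at this
  rw [← e1] at hne
  simp only [zero_mul, zero_add, add_zero] at hne e2
  refine ⟨?_, left_ne_zero_of_mul hne⟩
  exact (mul_eq_zero.1 e2).resolve_right (right_ne_zero_of_mul hne)

theorem os_final (P R : ℂ[X][X]) (hP : P.Monic) (hR : R.Monic) (lP : LB P) (lR : LB R)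
    (hd : (resultant P R).natDegree = P.natDegree * R.natDegree)
    (hs : (resultant P R).Separable) (hr : ∃ w, (resultant P R).eval w = 0)
    (hfs : ∀ w, (resultant P R).eval w = 0 → (fb P w).Separable ∧ (fb R w).Separable)
    (x : ℂ × ℂ) (x1 : x ∈ {p : ℂ × ℂ | ev P p.1 p.2 ≠ 0}) (x2 : x ∈ {p : ℂ × ℂ | ev R p.1 p.2 ≠ 0})
    (x12 : x ∈ {p : ℂ × ℂ | ev P p.1 p.2 ≠ 0 ∧ ev R p.1 p.2 ≠ 0}) :
    Nonempty (FundamentalGroup {p : ℂ × ℂ | ev P p.1 p.2 ≠ 0 ∧ ev R p.1 p.2 ≠ 0} ⟨x, x12⟩ ≃*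
      FundamentalGroup {p : ℂ × ℂ | ev P p.1 p.2 ≠ 0} ⟨x, x1⟩ ×
      FundamentalGroup {p : ℂ × ℂ | ev R p.1 p.2 ≠ 0} ⟨x, x2⟩) := by
  classical
  set N := P.natDegree * R.natDegree with hN
  set δ := resultant P (derivative P) * resultant R (derivative R) with hδ
  have hδw : ∀ w, δ.eval w ≠ 0 ↔ (fb P w).Separable ∧ (fb R w).Separable := by
    intro w
    rw [hδ, eval_mul, mul_ne_zero_iff, eval_disc hP, eval_disc hR]
  have hδ0 : δ ≠ 0 := by
    obtain ⟨w, hw⟩ := hr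
    intro h0
    have := (hδw w).2 (hfs w hw)
    rw [h0, eval_zero] at this
    exact this rfl
  set Kz : ℂ[X] := ∏ ζ ∈ δ.roots.toFinset, (X - C ζ) with hKz
  have hKzm : Kz.Monic := monic_prod_of_monic _ _ fun ζ _ => monic_X_sub_C ζ
  have hKz0 : ∀ w, Kz.eval w = 0 ↔ δ.eval w = 0 := by
    intro w
    rw [hKz, eval_prod, Finset.prod_eq_zero_iff]
    constructor
    · rintro ⟨ζ, hζ, h⟩
      rw [Multiset.mem_toFinset, mem_roots hδ0] at hζ
      rw [eval_sub, eval_X, eval_C, sub_eq_zero] at h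
      rw [h]
      exact hζ
    · intro h
      exact ⟨w, by rw [Multiset.mem_toFinset, mem_roots hδ0]; exact h, by simp⟩
  have hKzs : Kz.Separable := by
    rw [hKz]
    exact separable_prod_X_sub_C_iff'.2 fun a _ b _ h => h
  set c := (resultant P R).coeff N with hc
  have hres0 : resultant P R ≠ 0 := hs.ne_zero
  have hc0 : c ≠ 0 := by
    rw [hc, ← hd, coeff_natDegree]
    exact leadingCoeff_ne_zero.2 hres0
  obtain ⟨ht1, ht2⟩ := resSh_top hP hR lP lR
  have hm2 : (C (C c⁻¹) * resSh P R).Monic := by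
    refine monic_of_natDegree_le_of_coeff_eq_one N ?_ ?_
    · exact (natDegree_C_mul_le _ _).trans ht1
    · rw [coeff_C_mul, ht2, ← C_mul, ← hc, inv_mul_cancel₀ hc0, C_1]
  have hK : (Kz.map C * (C (C c⁻¹) * resSh P R)).Monic := (hKzm.map _).mul hm2
  have hevK : ∀ t w, ev (Kz.map C * (C (C c⁻¹) * resSh P R)) t w =
      Kz.eval w * (c⁻¹ * ev (resSh P R) t w) := by
    intro t w
    rw [ev_mul, ev_smul]
    congr 1
    rw [ev, fb, map_map]
    have : (evalRingHom t).comp (C : ℂ →+* ℂ[X]) = RingHom.id ℂ := by ext; simp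
    rw [this, Polynomial.map_id]
  refine os_poly P R (Kz.map C * (C (C c⁻¹) * resSh P R)) hP hR hK ?_ ?_ _ _ _ rfl rfl rfl x x1 x2 x12
  · have e : fb (Kz.map C * (C (C c⁻¹) * resSh P R)) 0 = Kz * (C c⁻¹ * resultant P R) := by
      refine Polynomial.funext fun w => ?_
      rw [eval_mul, eval_mul, eval_C, ← resSh_zero hP hR]
      exact hevK 0 w
    rw [e]
    have hu : IsUnit (C c⁻¹ : ℂ[X]) := isUnit_C.2 (inv_ne_zero hc0).isUnit
    have hs2 : (C c⁻¹ * resultant P R).Separable := by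
      exact Separable.unit_mul hu hs
    refine hKzs.mul hs2 (coprime_of_roots fun w hw => ?_)
    rw [eval_mul, eval_C]
    refine mul_ne_zero (inv_ne_zero hc0) fun h0 => ?_
    exact (hδw w).2 (hfs w h0) ((hKz0 w).1 hw)
  · intro w t h
    rw [hevK] at h
    have a1 := left_ne_zero_of_mul h
    have a2 := right_ne_zero_of_mul (right_ne_zero_of_mul h)
    have a3 := (hδw w).1 fun h0 => a1 ((hKz0 w).2 h0)
    refine ⟨a3.1, a3.2, fun z hz hz2 => ?_⟩
    obtain ⟨u, v, huv⟩ := (resSh_ne hP t w).1 a2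
    have := congrArg (eval z) huv
    rw [eval_add, eval_mul, eval_mul, eval_comp, eval_sub, eval_X, eval_C] at this
    change eval z u * ev P w z + eval z v * ev R w (z - t) = _ at this
    rw [hz, hz2] at this
    simp at this

end
end OS


open Set Topology Polynomial
set_option linter.all false

namespace OS

noncomputable section

theorem pi1_homeo {X Y : Type*} [TopologicalSpace X] [TopologicalSpace Y] (e : X ≃ₜ Y) {x : X} {y : Y}
    (h : e x = y) : Nonempty (FundamentalGroup X x ≃* FundamentalGroup Y y) := by
  let f : C(X, Y) := ⟨e, e.continuous⟩
  let g : C(Y, X) := ⟨e.symm, e.symm.continuous⟩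
  have hf : f x = y := h
  have hg : g y = x := by rw [← h]; exact e.symm_apply_apply x
  refine ⟨MulEquiv.ofBijective (FundamentalGroup.mapOfEq f hf) ?_⟩
  rw [Function.bijective_iff_has_inverse]
  refine ⟨fun γ => mapE g hg hg γ, fun γ => ?_, fun γ => ?_⟩
  · have e1 : FundamentalGroup.mapOfEq f hf γ = mapE f hf hf γ := FundamentalGroup.mapOfEq_apply f hf γ
    rw [e1]
    exact (mapE_mapE f g hf hf hg hg γ).trans (mapE_id _ (fun a => e.symm_apply_apply a) _ _ _)
  · refine (FundamentalGroup.mapOfEq_apply f hf _).trans ?_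
    exact (mapE_mapE g f hg hg hf hf γ).trans (mapE_id _ (fun a => e.apply_symm_apply a) _ _ _)

/-- evaluation of `f` -/
def φ (f : MvPolynomial (Fin 2) ℂ) (x y : ℂ) : ℂ :=
  MvPolynomial.eval (fun i : Fin 2 => if i = 0 then x else y) f

/-- sheared polynomial -/
def S (m : ℂ) : MvPolynomial (Fin 2) ℂ →+* ℂ[X][X] :=
  MvPolynomial.eval₂Hom ((C : ℂ[X] →+* ℂ[X][X]).comp C)
    (fun i : Fin 2 => if i = 0 then C X + C (C m) * X else X)

theorem S_C (m c : ℂ) : S m (MvPolynomial.C c) = C (C c) := by simp [S]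

theorem S_X0 (m : ℂ) : S m (MvPolynomial.X 0) = C X + C (C m) * X := by simp [S]

theorem S_X1 (m : ℂ) : S m (MvPolynomial.X 1) = X := by simp [S]

theorem S_ev (m : ℂ) (f : MvPolynomial (Fin 2) ℂ) (w z : ℂ) :
    ev (S m f) w z = φ f (w + m * z) z := by
  induction f using MvPolynomial.induction_on with
  | C a => rw [S_C, ev_C, eval_C, φ, MvPolynomial.eval_C]
  | add p q hp hq => rw [map_add, ev_add, hp, hq, φ, φ, φ, map_add]
  | mul_X p n hp =>
    rw [map_mul, ev_mul, hp, φ, φ, map_mul, MvPolynomial.eval_X]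
    congr 1
    fin_cases n
    · show ev (S m (MvPolynomial.X 0)) w z = _
      rw [S_X0, ev_add, ev_C, ev_smul, ev_X]
      simp
    · show ev (S m (MvPolynomial.X 1)) w z = _
      rw [S_X1, ev_X]
      simp

theorem S_Dw (m : ℂ) (f : MvPolynomial (Fin 2) ℂ) :
    Dw (S m f) = S m (MvPolynomial.pderiv 0 f) := by
  induction f using MvPolynomial.induction_on with
  | C a => rw [S_C, Dw_C, derivative_C, MvPolynomial.pderiv_C, map_zero, map_zero]
  | add p q hp hq => rw [map_add, Dw_add, hp, hq, map_add, map_add]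
  | mul_X p n hp =>
    have : Dw (S m (MvPolynomial.X n)) = S m (MvPolynomial.pderiv 0 (MvPolynomial.X n)) := by
      fin_cases n
      · show Dw (S m (MvPolynomial.X 0)) = S m (MvPolynomial.pderiv 0 (MvPolynomial.X 0))
        rw [S_X0, MvPolynomial.pderiv_X_self, map_one, Dw_add, Dw_mul, Dw_C, Dw_C, Dw_X]
        simp
      · show Dw (S m (MvPolynomial.X 1)) = S m (MvPolynomial.pderiv 0 (MvPolynomial.X 1))
        rw [S_X1, Dw_X, MvPolynomial.pderiv_X_of_ne (by decide), map_zero]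
    rw [map_mul, Dw_mul, hp, MvPolynomial.pderiv_mul, map_add, map_mul, map_mul, this]

theorem S_Dz (m : ℂ) (f : MvPolynomial (Fin 2) ℂ) :
    derivative (S m f) = C (C m) * S m (MvPolynomial.pderiv 0 f) + S m (MvPolynomial.pderiv 1 f) := by
  induction f using MvPolynomial.induction_on with
  | C a =>
    rw [S_C, derivative_C, MvPolynomial.pderiv_C, MvPolynomial.pderiv_C, map_zero, mul_zero, add_zero]
  | add p q hp hq => simp only [map_add, hp, hq]; ring
  | mul_X p n hp =>
    rw [map_mul, derivative_mul, hp, MvPolynomial.pderiv_mul, MvPolynomial.pderiv_mul, map_add,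
      map_add, map_mul, map_mul, map_mul, map_mul]
    have : derivative (S m (MvPolynomial.X n)) = C (C m) * S m (MvPolynomial.pderiv 0 (MvPolynomial.X n))
        + S m (MvPolynomial.pderiv 1 (MvPolynomial.X n)) := by
      fin_cases n
      · show derivative (S m (MvPolynomial.X 0)) = C (C m) * S m (MvPolynomial.pderiv 0 (MvPolynomial.X 0))
          + S m (MvPolynomial.pderiv 1 (MvPolynomial.X 0))
        rw [S_X0, MvPolynomial.pderiv_X_self, map_one, MvPolynomial.pderiv_X_of_ne (by decide)]
        simp
      · show derivative (S m (MvPolynomial.X 1)) = C (C m) * S m (MvPolynomial.pderiv 0 (MvPolynomial.X 1))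
          + S m (MvPolynomial.pderiv 1 (MvPolynomial.X 1))
        rw [S_X1, MvPolynomial.pderiv_X_self, map_one, MvPolynomial.pderiv_X_of_ne (by decide)]
        simp
    rw [this]
    ring

theorem S_monomial (m : ℂ) (v : Fin 2 →₀ ℕ) (c : ℂ) :
    S m (MvPolynomial.monomial v c) = C (C c) * ((C X + C (C m) * X) ^ v 0 * X ^ v 1) := by
  rw [S, MvPolynomial.coe_eval₂Hom, MvPolynomial.eval₂_monomial,
    Finsupp.prod_fintype _ _ (fun i => pow_zero _), Fin.prod_univ_two]
  simp

theorem sum_le_td {f : MvPolynomial (Fin 2) ℂ} {v : Fin 2 →₀ ℕ} (hv : v ∈ f.support) :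
    v 0 + v 1 ≤ f.totalDegree := by
  have := MvPolynomial.le_totalDegree hv
  rwa [Finsupp.sum_fintype _ _ (fun i => rfl), Fin.sum_univ_two] at this

theorem S_TD (m : ℂ) (f : MvPolynomial (Fin 2) ℂ) : TD (S m f) f.totalDegree := by
  rw [f.as_sum, map_sum]
  rw [← f.as_sum]
  have key : ∀ s : Finset (Fin 2 →₀ ℕ), s ⊆ f.support →
      TD (∑ v ∈ s, S m (MvPolynomial.monomial v (f.coeff v))) f.totalDegree := by
    classical
    intro s
    induction s using Finset.induction_on with
    | empty => intro _; simpa using TD.zero _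
    | insert a s ha ih =>
      intro hs
      rw [Finset.sum_insert ha]
      refine TD.add ?_ (ih fun x hx => hs (Finset.mem_insert_of_mem hx))
      rw [S_monomial]
      have h1 : TD (C X + C (C m) * X) 1 := by
        refine TD.X0.add ?_
        have := (TD.const m).mul TD.X1
        simpa using this
      have h2 := (TD.const (f.coeff a)).mul ((h1.pow (a 0)).mul (TD.X1.pow (a 1)))
      refine h2.mono ?_
      have := sum_le_td (hs (Finset.mem_insert_self a s))
      omega
  exact key _ (Finset.Subset.refl _)

/-- top coefficient as a polynomial in the slope -/
def top (f : MvPolynomial (Fin 2) ℂ) : ℂ[X] :=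
  ∑ v ∈ f.support, if v 0 + v 1 = f.totalDegree then C (f.coeff v) * X ^ v 0 else 0

theorem top_eval (m : ℂ) (f : MvPolynomial (Fin 2) ℂ) :
    ((S m f).coeff f.totalDegree).coeff 0 = (top f).eval m := by
  have h1 : ((S m f).coeff f.totalDegree).coeff 0 = (fb (S m f) 0).coeff f.totalDegree := by
    rw [fb, coeff_map, coe_evalRingHom, coeff_zero_eq_eval_zero]
  have h2 : fb (S m f) 0 = ∑ v ∈ f.support, fb (S m (MvPolynomial.monomial v (f.coeff v))) 0 := by
    conv_lhs => rw [f.as_sum]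
    rw [map_sum, fb, Polynomial.map_sum]
    rfl
  rw [h1, h2, finsetSum_coeff, top, eval_finsetSum]
  refine Finset.sum_congr rfl fun v _ => ?_
  have h3 : fb (S m (MvPolynomial.monomial v (f.coeff v))) 0 =
      C (f.coeff v * m ^ v 0) * X ^ (v 0 + v 1) := by
    rw [S_monomial, fb]
    simp only [Polynomial.map_mul, map_C, Polynomial.map_pow, Polynomial.map_add, map_X,
      coe_evalRingHom, eval_C, eval_X, C_0, zero_add, mul_pow, C_mul, C_pow, pow_add]
    ring
  rw [h3, coeff_C_mul, coeff_X_pow]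
  by_cases h : v 0 + v 1 = f.totalDegree
  · rw [if_pos h.symm, if_pos h]; simp
  · rw [if_neg (Ne.symm h), if_neg h]; simp

theorem top_ne {f : MvPolynomial (Fin 2) ℂ} (hf : f ≠ 0) : top f ≠ 0 := by
  obtain ⟨v, hv, hd⟩ := Finset.exists_mem_eq_sup f.support (MvPolynomial.support_nonempty.2 hf)
    (fun s => s.sum fun _ e => e)
  have hd' : f.totalDegree = v 0 + v 1 := by
    rw [MvPolynomial.totalDegree, hd, Finsupp.sum_fintype _ _ (fun i => rfl), Fin.sum_univ_two]
  intro h0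
  have h1 : (top f).coeff (v 0) = f.coeff v := by
    rw [top, finsetSum_coeff, Finset.sum_eq_single v]
    · rw [if_pos hd'.symm]; simp
    · intro u _ huv
      split_ifs with h
      · rw [coeff_C_mul, coeff_X_pow, if_neg, mul_zero]
        intro h2
        apply huv
        ext i
        fin_cases i
        · exact h2.symm
        · show u 1 = v 1
          omega
      · simp
    · intro h; exact absurd hv h
  rw [h0, coeff_zero] at h1
  exact (MvPolynomial.mem_support_iff.1 hv) h1.symm

/-- monic normalisation -/
def Sn (m : ℂ) (f : MvPolynomial (Fin 2) ℂ) : ℂ[X][X] := C (C ((top f).eval m)⁻¹) * S m f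

section
variable {m : ℂ} {f : MvPolynomial (Fin 2) ℂ} (h : (top f).eval m ≠ 0)

theorem Sn_TD (m : ℂ) (f : MvPolynomial (Fin 2) ℂ) : TD (Sn m f) f.totalDegree := by
  have := (TD.const ((top f).eval m)⁻¹).mul (S_TD m f)
  rwa [zero_add] at this

theorem Sn_natDegree_le (m : ℂ) (f : MvPolynomial (Fin 2) ℂ) : (Sn m f).natDegree ≤ f.totalDegree := by
  refine natDegree_le_iff_coeff_eq_zero.2 fun i hi => ?_
  ext j
  rw [Sn_TD m f i j (by omega), coeff_zero]

theorem Sn_coeff {m : ℂ} {f : MvPolynomial (Fin 2) ℂ} (h : (top f).eval m ≠ 0) :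
    (Sn m f).coeff f.totalDegree = 1 := by
  ext j
  rcases Nat.eq_zero_or_pos j with rfl | hj
  · rw [Sn, coeff_C_mul, coeff_C_mul, top_eval, inv_mul_cancel₀ h, coeff_one_zero]
  · rw [Sn_TD m f _ j (by omega), coeff_one, if_neg (by omega)]

theorem Sn_monic {m : ℂ} {f : MvPolynomial (Fin 2) ℂ} (h : (top f).eval m ≠ 0) : (Sn m f).Monic :=
  monic_of_natDegree_le_of_coeff_eq_one _ (Sn_natDegree_le m f) (Sn_coeff h)

theorem Sn_natDegree {m : ℂ} {f : MvPolynomial (Fin 2) ℂ} (h : (top f).eval m ≠ 0) :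
    (Sn m f).natDegree = f.totalDegree :=
  le_antisymm (Sn_natDegree_le m f) (le_natDegree_of_ne_zero (by rw [Sn_coeff h]; exact one_ne_zero))

theorem Sn_LB {m : ℂ} {f : MvPolynomial (Fin 2) ℂ} (h : (top f).eval m ≠ 0) : LB (Sn m f) :=
  TD.lb (Sn_monic h) (by rw [Sn_natDegree h]; exact Sn_TD m f)

theorem Sn_ev (m : ℂ) (f : MvPolynomial (Fin 2) ℂ) (w z : ℂ) :
    ev (Sn m f) w z = ((top f).eval m)⁻¹ * φ f (w + m * z) z := by
  rw [Sn, ev_smul, S_ev]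

theorem Sn_ev0 {m : ℂ} {f : MvPolynomial (Fin 2) ℂ} (h : (top f).eval m ≠ 0) (w z : ℂ) :
    ev (Sn m f) w z = 0 ↔ φ f (w + m * z) z = 0 := by
  rw [Sn_ev, mul_eq_zero]
  exact or_iff_right (inv_ne_zero h)

theorem Sn_Dw (m : ℂ) (f : MvPolynomial (Fin 2) ℂ) (w z : ℂ) :
    ev (Dw (Sn m f)) w z = ((top f).eval m)⁻¹ * φ (MvPolynomial.pderiv 0 f) (w + m * z) z := by
  rw [Sn, Dw_mul, Dw_C, derivative_C, C_0, zero_mul, zero_add, ev_smul, S_Dw, S_ev]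

theorem Sn_Dz (m : ℂ) (f : MvPolynomial (Fin 2) ℂ) (w z : ℂ) :
    ev (derivative (Sn m f)) w z = ((top f).eval m)⁻¹ *
      (m * φ (MvPolynomial.pderiv 0 f) (w + m * z) z + φ (MvPolynomial.pderiv 1 f) (w + m * z) z) := by
  rw [Sn, derivative_mul, derivative_C, zero_mul, zero_add, ev_smul, S_Dz, ev_add, ev_smul, S_ev, S_ev]

end

end
end OS


open Set Topology Polynomial
set_option linter.all false

namespace OS

noncomputable section

/-- Common zeros. -/
def Zc (f g : MvPolynomial (Fin 2) ℂ) : Set (ℂ × ℂ) := {p | φ f p.1 p.2 = 0 ∧ φ g p.1 p.2 = 0}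

theorem Zc_comm (f g : MvPolynomial (Fin 2) ℂ) : Zc f g = Zc g f := by
  apply Set.ext; intro p; exact and_comm

/-- The intersection hypotheses. -/
def Hy (f g : MvPolynomial (Fin 2) ℂ) : Prop :=
  f ≠ 0 ∧ g ≠ 0 ∧ (Zc f g).Finite ∧ (Zc f g).ncard = f.totalDegree * g.totalDegree ∧
    f.totalDegree ≠ 0 ∧ g.totalDegree ≠ 0

theorem Hy.symm {f g : MvPolynomial (Fin 2) ℂ} (h : Hy f g) : Hy g f := by
  obtain ⟨h1, h2, h3, h4, h5, h6⟩ := h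
  refine ⟨h2, h1, ?_, ?_, h6, h5⟩
  · rw [Zc_comm]; exact h3
  · rw [Zc_comm, h4, mul_comm]

/-- Good directions. -/
def Gd (f g : MvPolynomial (Fin 2) ℂ) (m : ℂ) : Prop :=
  (top f).eval m ≠ 0 ∧ (top g).eval m ≠ 0 ∧ InjOn (fun p : ℂ × ℂ => p.1 - m * p.2) (Zc f g)

theorem Gd.symm {f g : MvPolynomial (Fin 2) ℂ} {m : ℂ} (h : Gd f g m) : Gd g f m := by
  obtain ⟨h1, h2, h3⟩ := h
  refine ⟨h2, h1, ?_⟩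
  rw [Zc_comm]; exact h3

theorem Gd_fin {f g : MvPolynomial (Fin 2) ℂ} (h : Hy f g) : {m | ¬ Gd f g m}.Finite := by
  obtain ⟨h1, h2, h3, h4, h5, h6⟩ := h
  have A := fin_zeros (top_ne h1)
  have B := fin_zeros (top_ne h2)
  have C : (⋃ p ∈ Zc f g, ⋃ q ∈ Zc f g, ({(p.1 - q.1) / (p.2 - q.2)} : Set ℂ)).Finite :=
    h3.biUnion fun p _ => h3.biUnion fun q _ => Set.finite_singleton _
  refine ((A.union B).union C).subset ?_
  intro m hm
  by_contra hc
  apply hm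
  simp only [Set.mem_union, Set.mem_setOf_eq, not_or] at hc
  obtain ⟨⟨c1, c2⟩, c3⟩ := hc
  refine ⟨c1, c2, ?_⟩
  intro p hp q hq e
  by_contra hne
  apply c3
  have e' : p.1 - m * p.2 = q.1 - m * q.2 := e
  have h2 : p.2 - q.2 ≠ 0 := by
    intro h0
    have h0' : p.2 = q.2 := sub_eq_zero.mp h0
    apply hne
    refine Prod.ext ?_ h0'
    rw [h0'] at e'
    linear_combination e'
  refine Set.mem_biUnion hp (Set.mem_biUnion hq ?_)
  show m = _
  rw [eq_div_iff h2]
  linear_combination -e'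

theorem res_main {f g : MvPolynomial (Fin 2) ℂ} (h : Hy f g) {m : ℂ} (hm : Gd f g m) :
    (resultant (Sn m f) (Sn m g)).natDegree = (Sn m f).natDegree * (Sn m g).natDegree ∧
      (resultant (Sn m f) (Sn m g)).Separable := by
  obtain ⟨h1, h2, h3, h4, h5, h6⟩ := h
  obtain ⟨m1, m2, m3⟩ := hm
  have key : ∀ p ∈ Zc f g, ev (Sn m f) (p.1 - m * p.2) p.2 = 0 ∧ ev (Sn m g) (p.1 - m * p.2) p.2 = 0 := by
    intro p hp
    have e : p.1 - m * p.2 + m * p.2 = p.1 := by ring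
    refine ⟨(Sn_ev0 m1 _ _).2 ?_, (Sn_ev0 m2 _ _).2 ?_⟩
    · rw [e]; exact hp.1
    · rw [e]; exact hp.2
  have hr : resultant (Sn m f) (Sn m g) ≠ 0 := by
    refine res_ne (Sn_monic m1) ?_
    refine (h3.image (fun p : ℂ × ℂ => (p.1 - m * p.2, p.2))).subset ?_
    rintro q ⟨q1, q2⟩
    refine ⟨(q.1 + m * q.2, q.2), ⟨(Sn_ev0 m1 _ _).1 q1, (Sn_ev0 m2 _ _).1 q2⟩, ?_⟩
    refine Prod.ext ?_ rfl
    show q.1 + m * q.2 - m * q.2 = q.1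
    ring
  classical
  let W : Finset ℂ := h3.toFinset.image (fun p : ℂ × ℂ => p.1 - m * p.2)
  have hW : W.card = (Sn m f).natDegree * (Sn m g).natDegree := by
    rw [Sn_natDegree m1, Sn_natDegree m2, ← h4, Set.ncard_eq_toFinset_card _ h3]
    apply Finset.card_image_of_injOn
    intro p hp q hq e
    exact m3 (by simpa using hp) (by simpa using hq) e
  have hz : ∀ w ∈ W, (resultant (Sn m f) (Sn m g)).eval w = 0 := by
    intro w hw
    obtain ⟨p, hp, rfl⟩ := Finset.mem_image.1 hw
    have k := key p (by simpa using hp)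
    exact res_zero_of_common (Sn_monic m1) k.1 k.2
  have hd := res_deg (Sn_monic m1) (Sn_monic m2) (Sn_LB m1) (Sn_LB m2)
  have := sep_of_roots hr W (by rw [hW]; exact hd) hz
  rw [hW] at this
  exact this

theorem sq_main {f g : MvPolynomial (Fin 2) ℂ} (h : Hy f g) {m : ℂ} (hm : Gd f g m) :
    Squarefree (Sn m f) := by
  obtain ⟨a, b⟩ := res_main h hm
  refine sqf (Sn_monic hm.1) (Sn_monic hm.2.1) (Sn_LB hm.1) (Sn_LB hm.2.1) ?_ a b
  rw [Sn_natDegree hm.2.1]; exact h.2.2.2.2.2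

theorem grad1 {f g : MvPolynomial (Fin 2) ℂ} (h : Hy f g) {m : ℂ} (hm : Gd f g m) {p : ℂ × ℂ}
    (hp : p ∈ Zc f g) (hx : φ (MvPolynomial.pderiv 0 f) p.1 p.2 = 0)
    (hy : φ (MvPolynomial.pderiv 1 f) p.1 p.2 = 0) :
    m * φ (MvPolynomial.pderiv 0 g) p.1 p.2 + φ (MvPolynomial.pderiv 1 g) p.1 p.2 = 0 ∧
      φ (MvPolynomial.pderiv 0 g) p.1 p.2 ≠ 0 := by
  obtain ⟨a, b⟩ := res_main h hm
  obtain ⟨m1, m2, m3⟩ := hm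
  have e : p.1 - m * p.2 + m * p.2 = p.1 := by ring
  have k1 : ev (Sn m f) (p.1 - m * p.2) p.2 = 0 := (Sn_ev0 m1 _ _).2 (by rw [e]; exact hp.1)
  have k2 : ev (Sn m g) (p.1 - m * p.2) p.2 = 0 := (Sn_ev0 m2 _ _).2 (by rw [e]; exact hp.2)
  have k3 : ev (Dw (Sn m f)) (p.1 - m * p.2) p.2 = 0 := by
    rw [Sn_Dw, e, hx, mul_zero]
  have k4 : ev (derivative (Sn m f)) (p.1 - m * p.2) p.2 = 0 := by
    rw [Sn_Dz, e, hx, hy]; ring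
  have hR0 : (Sn m g).natDegree ≠ 0 := by rw [Sn_natDegree m2]; exact h.2.2.2.2.2
  obtain ⟨c1, c2⟩ := grad hR0 b (res_zero_of_common (Sn_monic m1) k1 k2) k1 k2 k3 k4
  rw [Sn_Dz, e] at c1
  rw [Sn_Dw, e] at c2
  refine ⟨?_, fun h0 => c2 (by rw [h0, mul_zero])⟩
  exact (mul_eq_zero.1 c1).resolve_left (inv_ne_zero m2)

/-- Bad directions at a point. -/
def Bad (f : MvPolynomial (Fin 2) ℂ) (p : ℂ × ℂ) : Set ℂ :=
  {m | ∃ l : ℂ, φ f (p.1 + l * m) (p.2 + l) = 0 ∧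
    m * φ (MvPolynomial.pderiv 0 f) (p.1 + l * m) (p.2 + l) +
      φ (MvPolynomial.pderiv 1 f) (p.1 + l * m) (p.2 + l) = 0}

theorem Bad_fin {f g : MvPolynomial (Fin 2) ℂ} (h : Hy f g) {p : ℂ × ℂ} (hp : p ∈ Zc f g) :
    (Bad f p).Finite := by
  obtain ⟨m₀, hm₀⟩ := (Gd_fin h).exists_notMem
  obtain ⟨m₁, hm₁⟩ := ((Gd_fin h).union (Set.finite_singleton m₀)).exists_notMem
  have g0 : Gd f g m₀ := not_not.1 hm₀
  have g1 : Gd f g m₁ := by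
    by_contra hc; exact hm₁ (Or.inl hc)
  have ne : m₁ ≠ m₀ := fun hc => hm₁ (Or.inr hc)
  have hg : ¬ (φ (MvPolynomial.pderiv 0 f) p.1 p.2 = 0 ∧ φ (MvPolynomial.pderiv 1 f) p.1 p.2 = 0) := by
    rintro ⟨hx, hy⟩
    obtain ⟨a1, a2⟩ := grad1 h g0 hp hx hy
    obtain ⟨b1, b2⟩ := grad1 h g1 hp hx hy
    have : (m₁ - m₀) * φ (MvPolynomial.pderiv 0 g) p.1 p.2 = 0 := by linear_combination b1 - a1
    rcases mul_eq_zero.1 this with h | h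
    · exact ne (sub_eq_zero.1 h)
    · exact a2 h
  have e : p.1 - m₀ * p.2 + m₀ * p.2 = p.1 := by ring
  have ti : ((top f).eval m₀)⁻¹ ≠ 0 := inv_ne_zero g0.1
  have hg' : ev (Dw (Sn m₀ f)) (p.1 - m₀ * p.2) p.2 ≠ 0 ∨
      ev (derivative (Sn m₀ f)) (p.1 - m₀ * p.2) p.2 ≠ 0 := by
    by_contra hc
    simp only [not_or, not_not] at hc
    obtain ⟨c1, c2⟩ := hc
    rw [Sn_Dw, e] at c1
    rw [Sn_Dz, e] at c2
    have c1' := (mul_eq_zero.1 c1).resolve_left ti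
    have c2' := (mul_eq_zero.1 c2).resolve_left ti
    refine hg ⟨c1', ?_⟩
    rw [c1'] at c2'
    simpa using c2'
  have fin := pencil (Sn_monic g0.1) (sq_main h g0) _ _ hg'
  refine (fin.image (fun u => u + m₀)).subset ?_
  rintro m ⟨l, l1, l2⟩
  refine ⟨m - m₀, ⟨l, ?_, ?_⟩, by simp⟩
  · rw [Sn_ev0 g0.1]
    have e2 : p.1 - m₀ * p.2 + l * (m - m₀) + m₀ * (p.2 + l) = p.1 + l * m := by ring
    rw [e2]; exact l1
  · rw [Sn_Dw, Sn_Dz]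
    have e2 : p.1 - m₀ * p.2 + l * (m - m₀) + m₀ * (p.2 + l) = p.1 + l * m := by ring
    rw [e2]
    linear_combination ((top f).eval m₀)⁻¹ * l2

theorem fb_sep {f : MvPolynomial (Fin 2) ℂ} {m : ℂ} (m1 : (top f).eval m ≠ 0) {w z : ℂ}
    (hb : m ∉ Bad f (w + m * z, z)) : (fb (Sn m f) w).Separable := by
  refine coprime_of_roots ?_
  intro y hy hy'
  have hy2 : ev (derivative (Sn m f)) w y = 0 := by
    refine Eq.trans ?_ hy'
    unfold ev fb
    rw [derivative_map]
  rw [Sn_Dz] at hy2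
  have h2 := (mul_eq_zero.1 hy2).resolve_left (inv_ne_zero m1)
  have h1 : φ f (w + m * y) y = 0 := (Sn_ev0 m1 w y).1 hy
  apply hb
  refine ⟨y - z, ?_⟩
  have e1 : (w + m * z, z).1 + (y - z) * m = w + m * y := by show w + m * z + (y - z) * m = _; ring
  have e2 : (w + m * z, z).2 + (y - z) = y := by show z + (y - z) = _; ring
  rw [e1, e2]
  exact ⟨h1, h2⟩

/-- The shear. -/
def shr (m : ℂ) : (ℂ × ℂ) ≃ₜ (ℂ × ℂ) where
  toFun p := (p.1 + m * p.2, p.2)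
  invFun p := (p.1 - m * p.2, p.2)
  left_inv p := Prod.ext (by simp) rfl
  right_inv p := Prod.ext (by simp) rfl
  continuous_toFun := by fun_prop
  continuous_invFun := by fun_prop

theorem main_pos {f g : MvPolynomial (Fin 2) ℂ} (h : Hy f g) (x : ℂ × ℂ)
    (x1 : φ f x.1 x.2 ≠ 0) (x2 : φ g x.1 x.2 ≠ 0) :
    Nonempty (FundamentalGroup {p : ℂ × ℂ // φ f p.1 p.2 ≠ 0 ∧ φ g p.1 p.2 ≠ 0} ⟨x, x1, x2⟩ ≃*
      FundamentalGroup {p : ℂ × ℂ // φ f p.1 p.2 ≠ 0} ⟨x, x1⟩ ×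
        FundamentalGroup {p : ℂ × ℂ // φ g p.1 p.2 ≠ 0} ⟨x, x2⟩) := by
  have fin1 : (⋃ p ∈ Zc f g, Bad f p).Finite := h.2.2.1.biUnion fun p hp => Bad_fin h hp
  have fin2 : (⋃ p ∈ Zc f g, Bad g p).Finite :=
    h.2.2.1.biUnion fun p hp => Bad_fin h.symm (by rw [Zc_comm]; exact hp)
  obtain ⟨m, hm⟩ := (((Gd_fin h).union fin1).union fin2).exists_notMem
  simp only [Set.mem_union, not_or] at hm
  obtain ⟨⟨n1, n2⟩, n3⟩ := hm
  have gd : Gd f g m := not_not.1 n1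
  obtain ⟨a, b⟩ := res_main h gd
  have hdeg : 0 < (resultant (Sn m f) (Sn m g)).natDegree := by
    rw [a, Sn_natDegree gd.1, Sn_natDegree gd.2.1]
    exact Nat.mul_pos (Nat.pos_of_ne_zero h.2.2.2.2.1) (Nat.pos_of_ne_zero h.2.2.2.2.2)
  have hroot : ∃ w, (resultant (Sn m f) (Sn m g)).eval w = 0 :=
    Complex.exists_root (natDegree_pos_iff_degree_pos.1 hdeg)
  have hfs : ∀ w, (resultant (Sn m f) (Sn m g)).eval w = 0 →
      (fb (Sn m f) w).Separable ∧ (fb (Sn m g) w).Separable := by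
    intro w hw
    obtain ⟨z, z1, z2⟩ := common_of_res_zero (Sn_monic gd.1) hw
    have hI : (w + m * z, z) ∈ Zc f g := ⟨(Sn_ev0 gd.1 w z).1 z1, (Sn_ev0 gd.2.1 w z).1 z2⟩
    refine ⟨fb_sep gd.1 (z := z) ?_, fb_sep gd.2.1 (z := z) ?_⟩
    · intro hc; exact n2 (Set.mem_biUnion hI hc)
    · intro hc; exact n3 (Set.mem_biUnion hI hc)
  have e : x.1 - m * x.2 + m * x.2 = x.1 := by ring
  have y1 : ev (Sn m f) (x.1 - m * x.2) x.2 ≠ 0 := fun hc => x1 (by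
    have := (Sn_ev0 gd.1 _ _).1 hc; rwa [e] at this)
  have y2 : ev (Sn m g) (x.1 - m * x.2) x.2 ≠ 0 := fun hc => x2 (by
    have := (Sn_ev0 gd.2.1 _ _).1 hc; rwa [e] at this)
  obtain ⟨F⟩ := os_final (Sn m f) (Sn m g) (Sn_monic gd.1) (Sn_monic gd.2.1) (Sn_LB gd.1)
    (Sn_LB gd.2.1) a b hroot hfs (x.1 - m * x.2, x.2) y1 y2 ⟨y1, y2⟩
  have i1 : ∀ p : ℂ × ℂ, ev (Sn m f) p.1 p.2 ≠ 0 ↔ φ f (shr m p).1 (shr m p).2 ≠ 0 :=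
    fun p => not_congr (Sn_ev0 gd.1 p.1 p.2)
  have i2 : ∀ p : ℂ × ℂ, ev (Sn m g) p.1 p.2 ≠ 0 ↔ φ g (shr m p).1 (shr m p).2 ≠ 0 :=
    fun p => not_congr (Sn_ev0 gd.2.1 p.1 p.2)
  have ex : shr m (x.1 - m * x.2, x.2) = x := Prod.ext e rfl
  let H1 : {p : ℂ × ℂ // ev (Sn m f) p.1 p.2 ≠ 0} ≃ₜ {p : ℂ × ℂ // φ f p.1 p.2 ≠ 0} :=
    (shr m).subtype i1
  let H2 : {p : ℂ × ℂ // ev (Sn m g) p.1 p.2 ≠ 0} ≃ₜ {p : ℂ × ℂ // φ g p.1 p.2 ≠ 0} :=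
    (shr m).subtype i2
  let H12 : {p : ℂ × ℂ // ev (Sn m f) p.1 p.2 ≠ 0 ∧ ev (Sn m g) p.1 p.2 ≠ 0} ≃ₜ
      {p : ℂ × ℂ // φ f p.1 p.2 ≠ 0 ∧ φ g p.1 p.2 ≠ 0} :=
    (shr m).subtype fun p => and_congr (i1 p) (i2 p)
  obtain ⟨E1⟩ := pi1_homeo H1 (x := ⟨(x.1 - m * x.2, x.2), y1⟩) (y := ⟨x, x1⟩) (Subtype.ext ex)
  obtain ⟨E2⟩ := pi1_homeo H2 (x := ⟨(x.1 - m * x.2, x.2), y2⟩) (y := ⟨x, x2⟩) (Subtype.ext ex)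
  obtain ⟨E12⟩ := pi1_homeo H12 (x := ⟨(x.1 - m * x.2, x.2), y1, y2⟩) (y := ⟨x, x1, x2⟩) (Subtype.ext ex)
  exact ⟨(E12.symm.trans F).trans (MulEquiv.prodCongr E1 E2)⟩

theorem phi_const {f : MvPolynomial (Fin 2) ℂ} (hf : f ≠ 0) (hd : f.totalDegree = 0) (a b : ℂ) :
    φ f a b ≠ 0 := by
  rw [MvPolynomial.totalDegree_eq_zero_iff_eq_C] at hd
  intro h0
  rw [hd] at h0
  unfold φ at h0
  rw [MvPolynomial.eval_C] at h0
  apply hf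
  rw [hd, h0, MvPolynomial.C_0]

theorem pi1_triv {q : ℂ × ℂ → Prop} (hq : ∀ p, q p) (x : {p // q p}) :
    Subsingleton (FundamentalGroup {p : ℂ × ℂ // q p} x) := by
  let e : {p : ℂ × ℂ // q p} ≃ₜ (ℂ × ℂ) :=
    { toFun := fun p => p.1, invFun := fun p => ⟨p, hq p⟩, left_inv := fun p => rfl,
      right_inv := fun p => rfl, continuous_toFun := by fun_prop, continuous_invFun := by fun_prop }
  obtain ⟨E⟩ := pi1_homeo e (x := x) rfl
  have : Subsingleton (FundamentalGroup (ℂ × ℂ) (e x)) :=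
    inferInstanceAs (Subsingleton (Path.Homotopic.Quotient (e x) (e x)))
  exact E.toEquiv.subsingleton

theorem main_all {f g : MvPolynomial (Fin 2) ℂ} (hf : f ≠ 0) (hg : g ≠ 0)
    (hfin : (Zc f g).Finite) (hc : (Zc f g).ncard = f.totalDegree * g.totalDegree) (x : ℂ × ℂ)
    (x1 : φ f x.1 x.2 ≠ 0) (x2 : φ g x.1 x.2 ≠ 0) :
    Nonempty (FundamentalGroup {p : ℂ × ℂ // φ f p.1 p.2 ≠ 0 ∧ φ g p.1 p.2 ≠ 0} ⟨x, x1, x2⟩ ≃*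
      FundamentalGroup {p : ℂ × ℂ // φ f p.1 p.2 ≠ 0} ⟨x, x1⟩ ×
        FundamentalGroup {p : ℂ × ℂ // φ g p.1 p.2 ≠ 0} ⟨x, x2⟩) := by
  by_cases d1 : f.totalDegree = 0
  · have k := phi_const hf d1
    have := pi1_triv (fun p => k p.1 p.2) ⟨x, x1⟩
    let H : {p : ℂ × ℂ // φ f p.1 p.2 ≠ 0 ∧ φ g p.1 p.2 ≠ 0} ≃ₜ {p : ℂ × ℂ // φ g p.1 p.2 ≠ 0} :=
      (Homeomorph.refl _).subtype fun p => ⟨fun h => h.2, fun h => ⟨k _ _, h⟩⟩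
    obtain ⟨E⟩ := pi1_homeo H (x := ⟨x, x1, x2⟩) (y := ⟨x, x2⟩) rfl
    letI : Unique (FundamentalGroup {p : ℂ × ℂ // φ f p.1 p.2 ≠ 0} ⟨x, x1⟩) :=
      { default := 1, uniq := fun a => Subsingleton.elim _ _ }
    exact ⟨E.trans MulEquiv.uniqueProd.symm⟩
  by_cases d2 : g.totalDegree = 0
  · have k := phi_const hg d2
    have := pi1_triv (fun p => k p.1 p.2) ⟨x, x2⟩
    let H : {p : ℂ × ℂ // φ f p.1 p.2 ≠ 0 ∧ φ g p.1 p.2 ≠ 0} ≃ₜ {p : ℂ × ℂ // φ f p.1 p.2 ≠ 0} :=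
      (Homeomorph.refl _).subtype fun p => ⟨fun h => h.1, fun h => ⟨h, k _ _⟩⟩
    obtain ⟨E⟩ := pi1_homeo H (x := ⟨x, x1, x2⟩) (y := ⟨x, x1⟩) rfl
    letI : Unique (FundamentalGroup {p : ℂ × ℂ // φ g p.1 p.2 ≠ 0} ⟨x, x2⟩) :=
      { default := 1, uniq := fun a => Subsingleton.elim _ _ }
    exact ⟨E.trans MulEquiv.prodUnique.symm⟩
  exact main_pos ⟨hf, hg, hfin, hc, d1, d2⟩ x x1 x2

end

end OS

/-- Oka–Sakamoto: If two plane algebraic curves `C₁, C₂ ⊂ ℂ²` of degrees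
`d₁, d₂` intersect in exactly `d₁·d₂` distinct points, then
`π₁(ℂ² \ (C₁ ∪ C₂)) ≅ π₁(ℂ² \ C₁) × π₁(ℂ² \ C₂)`. -/
theorem oka_sakamoto (f₁ f₂ : MvPolynomial (Fin 2) ℂ) (d₁ d₂ : ℕ)
    (hf₁ : f₁ ≠ 0) (hf₂ : f₂ ≠ 0)
    (hd₁ : f₁.totalDegree = d₁) (hd₂ : f₂.totalDegree = d₂)
    (hfin : (zeroSet f₁ ∩ zeroSet f₂).Finite)
    (hcount : (zeroSet f₁ ∩ zeroSet f₂).ncard = d₁ * d₂)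
    (x₀ : ℂ × ℂ) (hx₀ : x₀ ∉ zeroSet f₁ ∪ zeroSet f₂) :
    Nonempty
      (FundamentalGroup {p : ℂ × ℂ // p ∉ zeroSet f₁ ∪ zeroSet f₂} ⟨x₀, hx₀⟩ ≃*
        (FundamentalGroup {p : ℂ × ℂ // p ∉ zeroSet f₁} ⟨x₀, fun h => hx₀ (Or.inl h)⟩ ×
          FundamentalGroup {p : ℂ × ℂ // p ∉ zeroSet f₂} ⟨x₀, fun h => hx₀ (Or.inr h)⟩)) := by
  subst hd₁ hd₂
  have x1 : OS.φ f₁ x₀.1 x₀.2 ≠ 0 := fun h => hx₀ (Or.inl h)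
  have x2 : OS.φ f₂ x₀.1 x₀.2 ≠ 0 := fun h => hx₀ (Or.inr h)
  obtain ⟨E⟩ := OS.main_all hf₁ hf₂ hfin hcount x₀ x1 x2
  let H : {p : ℂ × ℂ // p ∉ zeroSet f₁ ∪ zeroSet f₂} ≃ₜ
      {p : ℂ × ℂ // OS.φ f₁ p.1 p.2 ≠ 0 ∧ OS.φ f₂ p.1 p.2 ≠ 0} :=
    (Homeomorph.refl _).subtype fun p => not_or
  obtain ⟨F⟩ := OS.pi1_homeo H (x := ⟨x₀, hx₀⟩) (y := ⟨x₀, x1, x2⟩) rfl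
  exact ⟨F.trans E⟩
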